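/- For every k ∈ ℕ and every Borel set B ⊆ {1,2}^ℕ, μ((B×A_k) ∩ T^{-n}(B×A_k)) → ∫_B (Leb_α(A_k))² dH(α) as n → ∞, where B×A_k = {(α,x) ∈ Ω : α ∈ B, x ∈ A_k}, A_k = [0, d^{-k}), and Leb_α(A_k) = d^{-k}/(1+α'). -/

import Mathlib

open MeasureTheory Filter Topology Real

noncomputable section

/-- Partial sums `α^{(m-1)} = Σ_{j<m} α_j d^{-(j+1)}`. -/
def chaconPartial (d : ℕ) (a : ℕ → ℕ) (m : ℕ) : ℝ :=
  ∑ j ∈ Finset.range m, (a j : ℝ) * (d : ℝ) ^ (-(j : ℤ) - 1)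

/-- `α' = Σ_{j∈ℕ} α_j d^{-(j+1)}`. -/
def chaconSum (d : ℕ) (a : ℕ → ℕ) : ℝ :=
  ∑' j : ℕ, (a j : ℝ) * (d : ℝ) ^ (-(j : ℤ) - 1)

/-- The index `N(x)` of the unique member `Z_n` of the partition containing `x`:
for `x ∈ [0,1)` it is the unique `n` with `x ∈ [1-d^{-n}, 1-d^{-(n+1)})`, and for
`x ∈ [1, 1+α')` it is the unique `n` with `x ∈ [1+α^{(n-1)}, 1+α^{(n)})`. -/
def chaconIndex (d : ℕ) (a : ℕ → ℕ) (x : ℝ) : ℕ :=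
  if x < 1 then sInf {n : ℕ | x < 1 - (d : ℝ) ^ (-(n : ℤ) - 1)}
  else sInf {n : ℕ | x < 1 + chaconPartial d a (n + 1)}

/-- The Chacon transformation `T_α` on `[0, 1+α')`. -/
def chaconMap (d : ℕ) (a : ℕ → ℕ) (x : ℝ) : ℝ :=
  let n := chaconIndex d a x
  if x < 1 then
    if x < 1 - 2 * (d : ℝ) ^ (-(n : ℤ) - 1) then
      x - (1 - (d : ℝ) ^ (-(n : ℤ))) + (d : ℝ) ^ (-(n : ℤ) - 1)
    else
      x + 2 * (d : ℝ) ^ (-(n : ℤ) - 1) + chaconPartial d a n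
  else
    if 1 + chaconPartial d a (n + 1) - (d : ℝ) ^ (-(n : ℤ) - 1) ≤ x then
      x - (1 + chaconPartial d a (n + 1) - (d : ℝ) ^ (-(n : ℤ) - 1))
        + ((d : ℝ) - 1) * (d : ℝ) ^ (-(n : ℤ) - 1)
    else
      x + (d : ℝ) ^ (-(n : ℤ) - 1)

/-- Normalized Lebesgue measure on `[0, 1+α')`. -/
def lebAlpha (d : ℕ) (a : ℕ → ℕ) : Measure ℝ :=
  (ENNReal.ofReal (1 + chaconSum d a))⁻¹ • (volume.restrict (Set.Ico 0 (1 + chaconSum d a)))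

/-- The skew product `T(α,x) = (α, T_α(x))` on `Ω = {(α,x) : x ∈ [0,1+α')}`
(extended by the identity off `Ω`, so that invariant sets of `T` correspond exactly to
invariant sets of the system on `Ω`). -/
def chaconSkew (d : ℕ) (p : (ℕ → ℕ) × ℝ) : (ℕ → ℕ) × ℝ :=
  (p.1, if 0 ≤ p.2 ∧ p.2 < 1 + chaconSum d p.1 then chaconMap d p.1 p.2 else p.2)

/-- The σ-algebra of invariant measurable sets of `T`. -/
def invSigma {Ω : Type*} [MeasurableSpace Ω] (T : Ω → Ω) : MeasurableSpace Ω where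
  MeasurableSet' A := MeasurableSet A ∧ T ⁻¹' A = A
  measurableSet_empty := ⟨MeasurableSet.empty, by simp⟩
  measurableSet_compl := fun A hA => ⟨hA.1.compl, by rw [Set.preimage_compl, hA.2]⟩
  measurableSet_iUnion := fun f hf =>
    ⟨MeasurableSet.iUnion fun i => (hf i).1, by
      rw [Set.preimage_iUnion]
      exact Set.iUnion_congr fun i => (hf i).2⟩

/-- Time spent in the spacers of stages `< M` between the visits of index `0` and `i` to `[0,1)`. -/
def spacerTime (d : ℕ) (a : ℕ → ℕ) (M i : ℕ) : ℕ :=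
  ∑ l ∈ Finset.range M, a l * ((i + d ^ l) / d ^ (l + 1))

/-- Time of the visit of index `i` to `[0,1)`, for orbits starting in the base of tower `M`. -/
def visitTime (d : ℕ) (a : ℕ → ℕ) (M i : ℕ) : ℕ := i + spacerTime d a M i

/-- Height of the tower of stage `m`. -/
def towerHeight (d : ℕ) (a : ℕ → ℕ) : ℕ → ℕ
  | 0 => 1
  | m + 1 => d * towerHeight d a m + a m

lemma spacerTime_mono (d : ℕ) (a : ℕ → ℕ) (M : ℕ) : Monotone (spacerTime d a M) := by
  intro i j hij
  unfold spacerTime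
  gcongr

lemma visitTime_strictMono (d : ℕ) (a : ℕ → ℕ) (M : ℕ) : StrictMono (visitTime d a M) := by
  intro i j hij
  have := spacerTime_mono d a M hij.le
  unfold visitTime
  omega

lemma spacerTime_split (d : ℕ) (a : ℕ → ℕ) (m N i : ℕ) :
    spacerTime d a (m + N) i =
      spacerTime d a m i + spacerTime d (fun l => a (m + l)) N (i / d ^ m) := by
  rcases Nat.eq_zero_or_pos d with rfl | hd
  · rcases m with _ | m
    · simp [spacerTime]
    · simp [spacerTime]
  unfold spacerTime
  rw [Finset.sum_range_add]
  congr 1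
  refine Finset.sum_congr rfl fun l _ => ?_
  congr 1
  rw [show i + d ^ (m + l) = i + d ^ l * d ^ m by ring, show d ^ (m + l + 1) = d ^ m * d ^ (l + 1) by ring,
    ← Nat.div_div_eq_div_mul, Nat.add_mul_div_right _ _ (by positivity)]

lemma spacerTime_succ_left (d : ℕ) (a : ℕ → ℕ) (N i : ℕ) :
    spacerTime d a (N + 1) i =
      a 0 * ((i + 1) / d) + spacerTime d (fun l => a (l + 1)) N (i / d) := by
  rw [add_comm N 1, spacerTime_split]
  simp [spacerTime, add_comm]

lemma spacerTime_succ (d : ℕ) (a : ℕ → ℕ) (N i : ℕ) :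
    spacerTime d a (N + 1) i = spacerTime d a N i + a N * ((i + d ^ N) / d ^ (N + 1)) := by
  simp [spacerTime, Finset.sum_range_succ]

lemma visitTime_add_mul_pow {d : ℕ} (hd : 0 < d) (a : ℕ → ℕ) (m i c : ℕ) :
    visitTime d a m (i + c * d ^ m) = visitTime d a m i + c * towerHeight d a m := by
  induction m generalizing c with
  | zero => simp [visitTime, spacerTime, towerHeight]
  | succ m ih =>
    have h1 := ih (c * d)
    have h2 : (i + c * d ^ (m + 1) + d ^ m) / d ^ (m + 1) = (i + d ^ m) / d ^ (m + 1) + c := by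
      rw [show i + c * d ^ (m + 1) + d ^ m = i + d ^ m + c * d ^ (m + 1) by ring,
        Nat.add_mul_div_right _ _ (by positivity)]
    unfold visitTime at h1 ⊢
    rw [spacerTime_succ, spacerTime_succ, h2, towerHeight]
    rw [show c * d * d ^ m = c * d ^ (m + 1) by ring] at h1
    linarith [mul_add (a m) ((i + d ^ m) / d ^ (m + 1)) c,
      mul_add c (d * towerHeight d a m) (a m), mul_assoc c d (towerHeight d a m), mul_comm c (a m)]

lemma visitTime_zero {d : ℕ} (hd : 2 ≤ d) (a : ℕ → ℕ) (M : ℕ) : visitTime d a M 0 = 0 := by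
  simp only [visitTime, spacerTime, zero_add, Finset.sum_eq_zero_iff]
  intro l _
  rw [Nat.div_eq_of_lt (Nat.pow_lt_pow_right (by omega) (by omega)), mul_zero]

lemma visitTime_pow {d : ℕ} (hd : 2 ≤ d) (a : ℕ → ℕ) (M : ℕ) :
    visitTime d a M (d ^ M) = towerHeight d a M := by
  have := visitTime_add_mul_pow (by omega : 0 < d) a M 0 1
  simpa [visitTime_zero hd] using this

/-- Passing to the next visit crosses the spacers of at most one stage. -/
lemma spacerTime_succ_le {d : ℕ} (hd : 2 ≤ d) (N : ℕ) :
    ∀ (a : ℕ → ℕ), (∀ j, a j ≤ 2) → ∀ i, spacerTime d a N (i + 1) ≤ spacerTime d a N i + 2 := by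
  induction N with
  | zero => intro a _ i; simp [spacerTime]
  | succ N ih =>
    intro a ha i
    rw [spacerTime_succ_left, spacerTime_succ_left]
    have h0 := ha 0
    by_cases h : d ∣ i + 1
    · have e1 : (i + 1 + 1) / d = (i + 1) / d := by
        rw [Nat.succ_div_of_not_dvd]
        intro h2
        have := (Nat.dvd_add_right h).1 h2
        have := Nat.le_of_dvd one_pos this
        omega
      have e2 : (i + 1) / d = i / d + 1 := Nat.succ_div_of_dvd h
      have := ih (fun l => a (l + 1)) (fun j => ha _) (i / d)
      rw [e1]
      nth_rewrite 2 [e2]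
      omega
    · have e2 : (i + 1) / d = i / d := Nat.succ_div_of_not_dvd h
      have e3 : (i + 1 + 1) / d ≤ (i + 1) / d + 1 := by
        rw [Nat.succ_div]; split_ifs <;> omega
      have e4 : spacerTime d (fun l => a (l + 1)) N ((i + 1) / d) =
          spacerTime d (fun l => a (l + 1)) N (i / d) := by rw [e2]
      rw [e4]
      have := Nat.mul_le_mul_left (a 0) e3
      rw [mul_add] at this
      omega

lemma visitTime_add_pow {d : ℕ} (hd : 2 ≤ d) {a : ℕ → ℕ} (ha : ∀ j, a j ≤ 2) {m M : ℕ}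
    (hm : m ≤ M) (i : ℕ) :
    visitTime d a M i + towerHeight d a m ≤ visitTime d a M (i + d ^ m) ∧
      visitTime d a M (i + d ^ m) ≤ visitTime d a M i + towerHeight d a m + 2 := by
  obtain ⟨N, rfl⟩ := Nat.exists_eq_add_of_le hm
  have h1 := visitTime_add_mul_pow (by omega : 0 < d) a m i 1
  have h2 := spacerTime_succ_le hd N (fun l => a (m + l)) (fun j => ha _) (i / d ^ m)
  have h3 := spacerTime_mono d (fun l => a (m + l)) N (Nat.le_succ (i / d ^ m))
  have e : (i + d ^ m) / d ^ m = i / d ^ m + 1 := Nat.add_div_right _ (by positivity)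
  unfold visitTime at *
  rw [spacerTime_split, spacerTime_split, e]
  simp only [one_mul, Nat.succ_eq_add_one] at h1 h3
  omega

lemma visitTime_add_mul_pow_bounds {d : ℕ} (hd : 2 ≤ d) {a : ℕ → ℕ} (ha : ∀ j, a j ≤ 2) {m M : ℕ}
    (hm : m ≤ M) (i q : ℕ) :
    visitTime d a M i + q * towerHeight d a m ≤ visitTime d a M (i + q * d ^ m) ∧
      visitTime d a M (i + q * d ^ m) ≤ visitTime d a M i + q * (towerHeight d a m + 2) := by
  induction q with
  | zero => simp
  | succ q ih =>
    have := visitTime_add_pow hd ha hm (i + q * d ^ m)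
    rw [show i + (q + 1) * d ^ m = i + q * d ^ m + d ^ m by ring, add_mul, add_mul, one_mul, one_mul]
    omega

lemma visitTime_add_bounds {d : ℕ} (hd : 2 ≤ d) {a : ℕ → ℕ} (ha : ∀ j, a j ≤ 2) {m M : ℕ}
    (hm : m ≤ M) (i r : ℕ) :
    visitTime d a M i + r / d ^ m * towerHeight d a m ≤ visitTime d a M (i + r) ∧
      visitTime d a M (i + r) ≤
        visitTime d a M i + (r / d ^ m + 1) * (towerHeight d a m + 2) := by
  have hp : 0 < d ^ m := by positivity
  have h1 := Nat.div_add_mod r (d ^ m)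
  have h2 := Nat.mod_lt r hp
  constructor
  · refine (visitTime_add_mul_pow_bounds hd ha hm i (r / d ^ m)).1.trans ?_
    apply (visitTime_strictMono d a M).monotone
    linarith [Nat.zero_le (r % d ^ m), mul_comm (d ^ m) (r / d ^ m)]
  · refine le_trans ?_ (visitTime_add_mul_pow_bounds hd ha hm i (r / d ^ m + 1)).2
    apply (visitTime_strictMono d a M).monotone
    have h3 : (r / d ^ m + 1) * d ^ m = d ^ m * (r / d ^ m) + d ^ m := by ring
    linarith

/-- Changing the digit `d-2` of order `j` to `d-1` crosses one block of spacers of stage `j`, while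
smaller digits can be increased without crossing spacers of stage `≥ j`. -/
lemma visitTime_digit_succ {d : ℕ} (hd : 2 ≤ d) (a : ℕ → ℕ) {j M : ℕ} (hj : j < M) (i : ℕ)
    (h : i / d ^ j % d + 1 < d) :
    visitTime d a M (i + d ^ j) =
      visitTime d a M i + towerHeight d a j + if i / d ^ j % d + 2 = d then a j else 0 := by
  obtain ⟨N, rfl⟩ := Nat.exists_eq_add_of_lt hj
  have h1 := visitTime_add_mul_pow (by omega : 0 < d) a j i 1
  have e : (i + d ^ j) / d ^ j = i / d ^ j + 1 := Nat.add_div_right _ (by positivity)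
  unfold visitTime at *
  rw [add_assoc j N 1, spacerTime_split d a j, spacerTime_split d a j, e, spacerTime_succ_left,
    spacerTime_succ_left]
  generalize i / d ^ j = I at *
  have hI := Nat.div_add_mod I d
  have n1 : ¬ d ∣ I + 1 := by
    intro h2
    have := Nat.mod_eq_zero_of_dvd h2
    rw [Nat.add_mod, Nat.mod_eq_of_lt (by omega : 1 < d), Nat.mod_eq_of_lt h] at this
    omega
  have e2 : (I + 1) / d = I / d := Nat.succ_div_of_not_dvd n1
  rw [show spacerTime d (fun l => a (j + (l + 1))) N ((I + 1) / d) =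
    spacerTime d (fun l => a (j + (l + 1))) N (I / d) by rw [e2]]
  have e3 : (I + 1 + 1) / d = (I + 1) / d + if I % d + 2 = d then 1 else 0 := by
    rw [Nat.succ_div]
    congr 1
    have : d ∣ I + 1 + 1 ↔ I % d + 2 = d := by
      constructor
      · intro h2
        by_contra h3
        have := Nat.mod_eq_zero_of_dvd h2
        rw [add_assoc, Nat.add_mod, Nat.mod_eq_of_lt (by omega : 1 + 1 < d), Nat.mod_eq_of_lt (by omega)] at this
        omega
      · intro h2
        refine ⟨I / d + 1, ?_⟩
        rw [mul_add]; omega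
    simp [this]
  rw [e3]
  simp only [one_mul, add_zero] at h1 ⊢
  split_ifs <;> simp [mul_add] <;> omega

/-- Indices `(i, i')` below `d ^ M`, divisible by `d ^ k`, whose visit times differ by `n`. -/
def visitPairs (d k : ℕ) (a : ℕ → ℕ) (M : ℕ) (n : ℤ) : Finset (ℕ × ℕ) :=
  {p ∈ Finset.range (d ^ M) ×ˢ Finset.range (d ^ M) | d ^ k ∣ p.1 ∧ d ^ k ∣ p.2 ∧
    (visitTime d a M p.2 : ℤ) - visitTime d a M p.1 = n}

lemma mem_visitPairs {d k : ℕ} {a : ℕ → ℕ} {M : ℕ} {n : ℤ} {p : ℕ × ℕ} :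
    p ∈ visitPairs d k a M n ↔ (p.1 < d ^ M ∧ p.2 < d ^ M) ∧ d ^ k ∣ p.1 ∧ d ^ k ∣ p.2 ∧
      (visitTime d a M p.2 : ℤ) - visitTime d a M p.1 = n := by
  simp [visitPairs]

lemma card_visitPairs_neg (d k : ℕ) (a : ℕ → ℕ) (M : ℕ) (n : ℤ) :
    (visitPairs d k a M (-n)).card = (visitPairs d k a M n).card := by
  refine Finset.card_nbij' Prod.swap Prod.swap ?_ ?_ (fun _ _ => rfl) (fun _ _ => rfl)
  all_goals
    rintro ⟨i, j⟩ h
    simp only [Finset.mem_coe, mem_visitPairs, Prod.fst_swap, Prod.snd_swap] at h ⊢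
    exact ⟨h.1.symm, h.2.2.1, h.2.1, by omega⟩

lemma visitPairs_fst_injOn (d k : ℕ) (a : ℕ → ℕ) (M : ℕ) (n : ℤ) :
    Set.InjOn Prod.fst (visitPairs d k a M n : Set (ℕ × ℕ)) := by
  rintro ⟨i, j⟩ h ⟨i', j'⟩ h' e
  simp only [Finset.mem_coe, mem_visitPairs] at h h' e
  subst e
  have : visitTime d a M j = visitTime d a M j' := by omega
  rw [(visitTime_strictMono d a M).injective this]

lemma sum_range_pow_succ (d M : ℕ) (f : ℕ → ℝ) :
    ∑ i ∈ Finset.range (d ^ (M + 1)), f i =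
      ∑ c ∈ Finset.range d, ∑ i ∈ Finset.range (d ^ M), f (i + c * d ^ M) := by
  have h : ∀ D : ℕ, ∑ i ∈ Finset.range (D * d ^ M), f i =
      ∑ c ∈ Finset.range D, ∑ i ∈ Finset.range (d ^ M), f (i + c * d ^ M) := by
    intro D
    induction D with
    | zero => simp
    | succ D ih =>
      rw [add_mul, one_mul, Finset.sum_range_add, ih, Finset.sum_range_succ]
      simp [add_comm]
  rw [← h, pow_succ, mul_comm]

/-- Centered indicators of distinct digits are orthogonal. -/
lemma sum_sq_digit {d : ℕ} (hd : 0 < d) {e : ℕ} (he : e < d) (g : ℕ → ℝ) (M : ℕ) :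
    ∑ i ∈ Finset.range (d ^ M),
      (∑ j ∈ Finset.range M, g j * (if i / d ^ j % d = e then (d : ℝ) - 1 else -1)) ^ 2 =
      d ^ M * (d - 1) * ∑ j ∈ Finset.range M, g j ^ 2 := by
  induction M with
  | zero => simp
  | succ M ih =>
    rw [sum_range_pow_succ]
    have key : ∀ c ∈ Finset.range d, ∑ i ∈ Finset.range (d ^ M),
        (∑ j ∈ Finset.range (M + 1),
          g j * (if (i + c * d ^ M) / d ^ j % d = e then (d : ℝ) - 1 else -1)) ^ 2 =
        ∑ i ∈ Finset.range (d ^ M),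
      (∑ j ∈ Finset.range M, g j * (if i / d ^ j % d = e then (d : ℝ) - 1 else -1)) ^ 2 +
        (2 * g M * ∑ i ∈ Finset.range (d ^ M),
      (∑ j ∈ Finset.range M, g j * (if i / d ^ j % d = e then (d : ℝ) - 1 else -1)))
        * (if c = e then (d : ℝ) - 1 else -1) +
        d ^ M * g M ^ 2 * (if c = e then (d : ℝ) - 1 else -1) ^ 2 := by
      intro c hc
      rw [Finset.mem_range] at hc
      have : ∀ i ∈ Finset.range (d ^ M), (∑ j ∈ Finset.range (M + 1),
          g j * (if (i + c * d ^ M) / d ^ j % d = e then (d : ℝ) - 1 else -1)) ^ 2 =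
          (∑ j ∈ Finset.range M, g j * (if i / d ^ j % d = e then (d : ℝ) - 1 else -1)) ^ 2 +
          (2 * g M * (if c = e then (d : ℝ) - 1 else -1)) *
          (∑ j ∈ Finset.range M, g j * (if i / d ^ j % d = e then (d : ℝ) - 1 else -1)) +
          g M ^ 2 * (if c = e then (d : ℝ) - 1 else -1) ^ 2 := by
        intro i hi
        rw [Finset.mem_range] at hi
        rw [Finset.sum_range_succ]
        have h1 : (i + c * d ^ M) / d ^ M % d = c := by
          rw [Nat.add_mul_div_right _ _ (by positivity), Nat.div_eq_of_lt hi, zero_add,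
            Nat.mod_eq_of_lt hc]
        rw [h1]
        have h2 : ∀ j ∈ Finset.range M, (i + c * d ^ M) / d ^ j % d = i / d ^ j % d := by
          intro j hj
          rw [Finset.mem_range] at hj
          obtain ⟨N, rfl⟩ := Nat.exists_eq_add_of_lt hj
          rw [show i + c * d ^ (j + N + 1) = i + (c * d ^ N * d) * d ^ j by ring,
            Nat.add_mul_div_right _ _ (by positivity), Nat.add_mul_mod_self_right]
        rw [Finset.sum_congr rfl fun j hj => by rw [h2 j hj]]
        ring
      rw [Finset.sum_congr rfl this, Finset.sum_add_distrib, Finset.sum_add_distrib,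
        ← Finset.mul_sum]
      simp only [Finset.sum_const, Finset.card_range, nsmul_eq_mul]
      push_cast
      ring
    rw [Finset.sum_congr rfl key, Finset.sum_add_distrib, Finset.sum_add_distrib, ih]
    simp only [← Finset.mul_sum]
    have s1 : ∑ c ∈ Finset.range d, (if c = e then (d : ℝ) - 1 else -1) = 0 := by
      have : ∀ c ∈ Finset.range d, (if c = e then (d : ℝ) - 1 else -1) =
          (if c = e then (d : ℝ) else 0) - 1 := by
        intro c _; split_ifs <;> ring
      rw [Finset.sum_congr rfl this, Finset.sum_sub_distrib, Finset.sum_ite_eq' ]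
      simp [he]
    have s2 : ∑ c ∈ Finset.range d, (if c = e then (d : ℝ) - 1 else -1) ^ 2 = d * (d - 1) := by
      have : ∀ c ∈ Finset.range d, (if c = e then (d : ℝ) - 1 else -1) ^ 2 =
          (if c = e then (d : ℝ) * (d - 2) else 0) + 1 := by
        intro c _; split_ifs <;> ring
      rw [Finset.sum_congr rfl this, Finset.sum_add_distrib, Finset.sum_ite_eq' ]
      simp [he]
      ring
    rw [s1, s2, Finset.sum_range_succ]
    simp only [Finset.sum_const, Finset.card_range, nsmul_eq_mul]
    ring

lemma abs_sum_card_digit_sub_le {d : ℕ} (hd : 0 < d) {e : ℕ} (he : e < d) (k : ℕ) (a : ℕ → ℕ)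
    (M : ℕ) (n : ℤ) {G : Finset ℕ} (hG : ∀ j ∈ G, j < M) :
    |(d : ℝ) * ∑ j ∈ G, (({p ∈ visitPairs d k a M n | p.1 / d ^ j % d = e}).card : ℝ) -
      G.card * (visitPairs d k a M n).card| ≤ d ^ M * (d * √G.card) := by
  classical
  set P := visitPairs d k a M n
  let X : ℕ → ℝ := fun i => ∑ j ∈ G, (if i / d ^ j % d = e then (d : ℝ) - 1 else -1)
  have h1 : (d : ℝ) * ∑ j ∈ G, (({p ∈ P | p.1 / d ^ j % d = e}).card : ℝ) -
      G.card * P.card = ∑ p ∈ P, X p.1 := by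
    simp only [X]
    rw [Finset.sum_comm, Finset.mul_sum, Finset.cast_card, Finset.sum_mul, ← Finset.sum_sub_distrib]
    refine Finset.sum_congr rfl fun j _ => ?_
    rw [Finset.cast_card, Finset.sum_filter, Finset.mul_sum, one_mul, Finset.cast_card,
      ← Finset.sum_sub_distrib]
    refine Finset.sum_congr rfl fun p _ => ?_
    split_ifs <;> simp
  have h2 : ∑ p ∈ P, |X p.1| ≤ ∑ i ∈ Finset.range (d ^ M), |X i| := by
    rw [← Finset.sum_image (f := fun i => |X i|) (visitPairs_fst_injOn d k a M n)]
    refine Finset.sum_le_sum_of_subset_of_nonneg ?_ fun _ _ _ => abs_nonneg _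
    intro i hi
    obtain ⟨p, hp, rfl⟩ := Finset.mem_image.1 hi
    exact Finset.mem_range.2 (mem_visitPairs.1 hp).1.1
  have h3 : ∑ i ∈ Finset.range (d ^ M), X i ^ 2 = d ^ M * (d - 1) * G.card := by
    have := sum_sq_digit hd he (fun j => if j ∈ G then (1 : ℝ) else 0) M
    have hs : ∀ f : ℕ → ℝ, ∑ j ∈ Finset.range M, (if j ∈ G then f j else 0) = ∑ j ∈ G, f j := by
      intro f
      rw [← Finset.sum_filter]
      congr 1
      ext j
      simp only [Finset.mem_filter, Finset.mem_range]
      exact ⟨fun h => h.2, fun h => ⟨hG j h, h⟩⟩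
    simp only [ite_mul, one_mul, zero_mul, ite_pow, one_pow, zero_pow two_ne_zero] at this
    rw [hs] at this
    simp only [hs] at this
    simpa [X] using this
  have h4 : (∑ i ∈ Finset.range (d ^ M), |X i|) ^ 2 ≤ (d ^ M * (d * √G.card)) ^ 2 := by
    have := sq_sum_le_card_mul_sum_sq (s := Finset.range (d ^ M)) (f := fun i => |X i|)
    simp only [sq_abs, h3, Finset.card_range] at this
    refine this.trans ?_
    have hd1 : (1 : ℝ) ≤ d := by exact_mod_cast hd
    rw [mul_pow, mul_pow, Real.sq_sqrt (by positivity)]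
    push_cast
    rw [show (d : ℝ) ^ M * (d ^ M * (d - 1) * G.card) = (d ^ M) ^ 2 * ((d - 1) * G.card) by ring]
    gcongr
    nlinarith
  rw [h1]
  refine (Finset.abs_sum_le_sum_abs _ _).trans (h2.trans ?_)
  exact abs_le_of_sq_le_sq' h4 (by positivity) |>.2

lemma add_pow_lt_pow {d : ℕ} (hd : 0 < d) {j M i : ℕ} (hj : j < M) (hi : i < d ^ M)
    (h : i / d ^ j % d + 1 < d) : i + d ^ j < d ^ M := by
  obtain ⟨N, rfl⟩ := Nat.exists_eq_add_of_lt hj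
  have hp : 0 < d ^ j := by positivity
  rw [show d ^ (j + N + 1) = d ^ j * (d * d ^ N) by ring] at hi ⊢
  have h1 : i / d ^ j < d * d ^ N := Nat.div_lt_of_lt_mul hi
  have h2 : (i + d ^ j) / d ^ j = i / d ^ j + 1 := Nat.add_div_right _ hp
  rw [mul_comm, ← Nat.div_lt_iff_lt_mul hp, h2]
  generalize i / d ^ j = I at *
  have h3 : I / d < d ^ N := Nat.div_lt_of_lt_mul h1
  have h4 := Nat.div_add_mod I d
  nlinarith

/-- If `i' - i` is, modulo `d^(j+1)`, between `2 d^j` and `(d-1) d^j`, a digit `d-2+t` of `i`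
forces the digit of `i'` to lie in `[t, d-3+t]`. -/
lemma digit_of_sub_mem {d : ℕ} (hd : 4 ≤ d) {j i i' t : ℕ} (ht : t ≤ 1) {w : ℤ}
    (h1 : w * d ^ (j + 1) + 2 * d ^ j ≤ (i' : ℤ) - i)
    (h2 : (i' : ℤ) - i ≤ w * d ^ (j + 1) + (d - 1) * d ^ j)
    (hi : i / d ^ j % d = d - 2 + t) : t ≤ i' / d ^ j % d ∧ i' / d ^ j % d + 3 ≤ d + t := by
  have hp : (0 : ℤ) < (d : ℤ) ^ j := by positivity
  have hpn : 0 < d ^ j := by positivity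
  have e1 := Nat.div_add_mod i (d ^ j)
  have e2 := Nat.mod_lt i hpn
  have e3 := Nat.div_add_mod (i / d ^ j) d
  have f1 := Nat.div_add_mod i' (d ^ j)
  have f2 := Nat.mod_lt i' hpn
  rw [hi] at e3
  set I := i / d ^ j
  set I' := i' / d ^ j
  have g1 : (i : ℤ) = d ^ j * I + (i % d ^ j : ℕ) := by exact_mod_cast e1.symm
  have g2 : (i' : ℤ) = d ^ j * I' + (i' % d ^ j : ℕ) := by exact_mod_cast f1.symm
  have g3 : (I : ℤ) = d * (I / d : ℕ) + (d - 2 + t) := by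
    have : ((d - 2 + t : ℕ) : ℤ) = d - 2 + t := by push_cast; omega
    rw [← this]; exact_mod_cast e3.symm
  have b1 : ((i % d ^ j : ℕ) : ℤ) < d ^ j := by exact_mod_cast e2
  have b2 : ((i' % d ^ j : ℕ) : ℤ) < d ^ j := by exact_mod_cast f2
  have b3 : (0 : ℤ) ≤ ((i % d ^ j : ℕ) : ℤ) := by positivity
  have b4 : (0 : ℤ) ≤ ((i' % d ^ j : ℕ) : ℤ) := by positivity
  have c1 : (I : ℤ) + w * d + 2 - 1 < I' := by
    have : (d : ℤ) ^ j * (I + w * d + 2 - 1) < d ^ j * I' := by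
      rw [pow_succ] at h1
      nlinarith
    exact lt_of_mul_lt_mul_left this hp.le
  have c2 : (I' : ℤ) < I + w * d + (d - 1) + 1 := by
    have : (d : ℤ) ^ j * I' < d ^ j * (I + w * d + (d - 1) + 1) := by
      rw [pow_succ] at h2
      nlinarith
    exact lt_of_mul_lt_mul_left this hp.le
  have hv : ∃ v : ℤ, v = (I / d : ℕ) + w + 1 := ⟨_, rfl⟩
  obtain ⟨v, hv⟩ := hv
  have c3 : d * v + t ≤ (I' : ℤ) := by rw [hv]; nlinarith
  have c4 : (I' : ℤ) ≤ d * v + (d - 3 + t) := by rw [hv]; nlinarith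
  have c5 : (I' : ℤ) % d = I' - d * v := by
    rw [show (I' : ℤ) = (I' - d * v) + d * v by ring, Int.add_mul_emod_self_left,
      Int.emod_eq_of_lt (by omega) (by omega)]
    ring
  have c6 : ((I' % d : ℕ) : ℤ) = I' - d * v := by rw [← c5]; norm_cast
  omega

/-- Toggling the digit `j` from `d-2` to `d-1` turns pairs at distance `n+1` into pairs at
distance `n`. -/
lemma card_visitPairs_toggle {d : ℕ} (hd : 4 ≤ d) {k j M : ℕ} (hkj : k ≤ j) (hj : j < M)
    {a : ℕ → ℕ} (ha : a j = 1) {n : ℤ}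
    (h : ∀ p ∈ visitPairs d k a M n ∪ visitPairs d k a M (n + 1), ∃ w : ℤ,
      w * d ^ (j + 1) + 2 * d ^ j ≤ (p.2 : ℤ) - p.1 ∧
      (p.2 : ℤ) - p.1 ≤ w * d ^ (j + 1) + (d - 1) * d ^ j) :
    ({p ∈ visitPairs d k a M (n + 1) | p.1 / d ^ j % d = d - 2}).card =
      ({p ∈ visitPairs d k a M n | p.1 / d ^ j % d = d - 1}).card := by
  have hpn : 0 < d ^ j := by positivity
  have hdvd : d ^ k ∣ d ^ j := pow_dvd_pow d hkj
  refine Finset.card_nbij' (fun p => (p.1 + d ^ j, p.2 + d ^ j))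
    (fun p => (p.1 - d ^ j, p.2 - d ^ j)) ?_ ?_ ?_ ?_
  · rintro ⟨i, i'⟩ hp
    simp only [Finset.mem_coe, Finset.mem_filter] at hp ⊢
    obtain ⟨w, h1, h2⟩ := h (i, i') (Finset.mem_union_right _ hp.1)
    obtain ⟨q1, q2⟩ := digit_of_sub_mem hd (t := 0) (by omega) h1 h2 (by simpa using hp.2)
    have hp1 := mem_visitPairs.1 hp.1
    simp only at hp1 hp q1 q2
    have v1 := visitTime_digit_succ (by omega : 2 ≤ d) a hj i (by omega)
    have v2 := visitTime_digit_succ (by omega : 2 ≤ d) a hj i' (by omega)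
    rw [if_pos (by omega), ha] at v1
    rw [if_neg (by omega)] at v2
    refine ⟨mem_visitPairs.2 ⟨⟨add_pow_lt_pow (by omega) hj hp1.1.1 (by omega),
      add_pow_lt_pow (by omega) hj hp1.1.2 (by omega)⟩, hp1.2.1.add hdvd, hp1.2.2.1.add hdvd, ?_⟩, ?_⟩
    · simp only; omega
    · have e : (i + d ^ j) / d ^ j = i / d ^ j + 1 := Nat.add_div_right _ hpn
      rw [e, Nat.add_mod, hp.2, Nat.mod_eq_of_lt (by omega : 1 < d), Nat.mod_eq_of_lt (by omega)]
      omega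
  · rintro ⟨i, i'⟩ hp
    simp only [Finset.mem_coe, Finset.mem_filter] at hp ⊢
    obtain ⟨w, h1, h2⟩ := h (i, i') (Finset.mem_union_left _ hp.1)
    obtain ⟨q1, q2⟩ := digit_of_sub_mem hd (t := 1) (by omega) h1 h2 (by simp only; omega)
    have hp1 := mem_visitPairs.1 hp.1
    simp only at hp1 hp q1 q2
    have low : ∀ x, 1 ≤ x / d ^ j % d → ∃ y, x = y + d ^ j ∧ y / d ^ j % d + 1 = x / d ^ j % d := by
      intro x hx
      have hx1 : 1 ≤ x / d ^ j := hx.trans (Nat.mod_le _ _)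
      have hx2 : d ^ j ≤ x := by
        by_contra hc
        rw [Nat.div_eq_of_lt (by omega)] at hx1
        omega
      obtain ⟨y, rfl⟩ := Nat.exists_eq_add_of_le' hx2
      refine ⟨y, rfl, ?_⟩
      have e : (y + d ^ j) / d ^ j = y / d ^ j + 1 := Nat.add_div_right _ hpn
      rw [e] at hx ⊢
      have h5 := Nat.mod_lt (y / d ^ j) (by omega : 0 < d)
      by_cases h6 : y / d ^ j % d + 1 = d
      · exfalso
        rw [Nat.add_mod, Nat.mod_eq_of_lt (by omega : 1 < d), h6, Nat.mod_self] at hx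
        omega
      · rw [Nat.add_mod (y / d ^ j) 1 d, Nat.mod_eq_of_lt (by omega : 1 < d),
          Nat.mod_eq_of_lt (by omega : y / d ^ j % d + 1 < d)]
    obtain ⟨y, rfl, hy⟩ := low i (by omega)
    obtain ⟨y', rfl, hy'⟩ := low i' (by omega)
    have v1 := visitTime_digit_succ (by omega : 2 ≤ d) a hj y (by omega)
    have v2 := visitTime_digit_succ (by omega : 2 ≤ d) a hj y' (by omega)
    rw [if_pos (by omega), ha] at v1
    rw [if_neg (by omega)] at v2
    simp only [Nat.add_sub_cancel]
    refine ⟨mem_visitPairs.2 ⟨⟨by simp only; omega, by simp only; omega⟩,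
      (Nat.dvd_add_left hdvd).1 hp1.2.1, (Nat.dvd_add_left hdvd).1 hp1.2.2.1, ?_⟩, by omega⟩
    simp only; omega
  · rintro ⟨i, i'⟩ hp
    simp
  · rintro ⟨i, i'⟩ hp
    simp only [Finset.mem_coe, Finset.mem_filter] at hp
    obtain ⟨w, h1, h2⟩ := h (i, i') (Finset.mem_union_left _ hp.1)
    obtain ⟨q1, q2⟩ := digit_of_sub_mem hd (t := 1) (by omega) h1 h2 (by simp only; omega)
    have low : ∀ x, 1 ≤ x / d ^ j % d → d ^ j ≤ x := by
      intro x hx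
      have hx1 : 1 ≤ x / d ^ j := hx.trans (Nat.mod_le _ _)
      by_contra hc
      rw [Nat.div_eq_of_lt (by omega)] at hx1
      omega
    have l1 := low i (by omega)
    have l2 := low i' (by omega)
    simp [l1, l2]

lemma card_mul_abs_card_visitPairs_sub_le {d : ℕ} (hd : 4 ≤ d) {k M : ℕ} {G : Finset ℕ}
    {a : ℕ → ℕ} (hG : ∀ j ∈ G, k ≤ j ∧ j < M ∧ a j = 1) {n : ℤ}
    (h : ∀ p ∈ visitPairs d k a M n ∪ visitPairs d k a M (n + 1), ∀ j ∈ G, ∃ w : ℤ,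
      w * d ^ (j + 1) + 2 * d ^ j ≤ (p.2 : ℤ) - p.1 ∧
      (p.2 : ℤ) - p.1 ≤ w * d ^ (j + 1) + (d - 1) * d ^ j) :
    (G.card : ℝ) * |((visitPairs d k a M n).card : ℝ) - (visitPairs d k a M (n + 1)).card| ≤
      d ^ M * (2 * d * √G.card) := by
  have h1 := abs_sum_card_digit_sub_le (by omega : 0 < d) (by omega : d - 1 < d) k a M n
    (fun j hj => (hG j hj).2.1)
  have h2 := abs_sum_card_digit_sub_le (by omega : 0 < d) (by omega : d - 2 < d) k a M (n + 1)
    (fun j hj => (hG j hj).2.1)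
  have h3 : ∑ j ∈ G, (({p ∈ visitPairs d k a M (n + 1) | p.1 / d ^ j % d = d - 2}).card : ℝ) =
      ∑ j ∈ G, (({p ∈ visitPairs d k a M n | p.1 / d ^ j % d = d - 1}).card : ℝ) := by
    refine Finset.sum_congr rfl fun j hj => ?_
    rw [card_visitPairs_toggle hd (hG j hj).1 (hG j hj).2.1 (hG j hj).2.2 fun p hp => h p hp j hj]
  rw [h3] at h2
  rw [← abs_of_nonneg (Nat.cast_nonneg (α := ℝ) G.card), ← abs_mul, abs_le]
  rw [abs_le] at h1 h2
  rw [abs_of_nonneg (Nat.cast_nonneg (α := ℝ) G.card)]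
  constructor <;> linarith

lemma zpow_neg_sub_one (x : ℝ) (j : ℕ) : x ^ (-(j : ℤ) - 1) = (x ^ (j + 1))⁻¹ := by
  rw [← zpow_natCast, ← zpow_neg]
  congr 1
  push_cast
  ring

lemma summable_inv_pow_succ {d : ℕ} (hd : 2 ≤ d) : Summable fun j : ℕ => ((d : ℝ) ^ (j + 1))⁻¹ := by
  have h : (1 : ℝ) < d := by exact_mod_cast (by omega : 1 < d)
  have := (summable_geometric_of_lt_one (by positivity) (inv_lt_one_of_one_lt₀ h)).mul_left (d : ℝ)⁻¹
  refine this.congr fun j => ?_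
  rw [pow_succ, mul_inv, inv_pow, mul_comm]

lemma tsum_inv_pow_succ {d : ℕ} (hd : 2 ≤ d) :
    ∑' j : ℕ, ((d : ℝ) ^ (j + 1))⁻¹ = ((d : ℝ) - 1)⁻¹ := by
  have h : (1 : ℝ) < d := by exact_mod_cast (by omega : 1 < d)
  have h0 : (d : ℝ) - 1 ≠ 0 := by linarith
  have e : ∀ j : ℕ, ((d : ℝ) ^ (j + 1))⁻¹ = (d : ℝ)⁻¹ * (d : ℝ)⁻¹ ^ j := by
    intro j
    rw [pow_succ, mul_inv, inv_pow, mul_comm]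
  simp_rw [e]
  rw [tsum_mul_left, tsum_geometric_of_lt_one (by positivity) (inv_lt_one_of_one_lt₀ h)]
  field_simp

lemma summable_chaconSum {d : ℕ} (hd : 2 ≤ d) {a : ℕ → ℕ} (ha : ∀ j, a j ≤ 2) :
    Summable fun j : ℕ => (a j : ℝ) * (d : ℝ) ^ (-(j : ℤ) - 1) := by
  refine Summable.of_nonneg_of_le (fun j => by positivity) (fun j => ?_)
    ((summable_inv_pow_succ hd).mul_left 2)
  rw [zpow_neg_sub_one]
  gcongr
  exact_mod_cast ha j

lemma chaconPartial_succ (d : ℕ) (a : ℕ → ℕ) (m : ℕ) :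
    chaconPartial d a (m + 1) = chaconPartial d a m + a m * ((d : ℝ) ^ (m + 1))⁻¹ := by
  rw [chaconPartial, Finset.sum_range_succ, zpow_neg_sub_one, chaconPartial]

lemma chaconPartial_le_chaconSum {d : ℕ} (hd : 2 ≤ d) {a : ℕ → ℕ} (ha : ∀ j, a j ≤ 2) (m : ℕ) :
    chaconPartial d a m ≤ chaconSum d a :=
  (summable_chaconSum hd ha).sum_le_tsum _ fun j _ => by positivity

lemma chaconPartial_nonneg (d : ℕ) (a : ℕ → ℕ) (m : ℕ) : 0 ≤ chaconPartial d a m :=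
  Finset.sum_nonneg fun j _ => by positivity

lemma chaconSum_nonneg (d : ℕ) (a : ℕ → ℕ) : 0 ≤ chaconSum d a :=
  tsum_nonneg fun j => by positivity

lemma chaconSum_sub_chaconPartial_le {d : ℕ} (hd : 3 ≤ d) {a : ℕ → ℕ} (ha : ∀ j, a j ≤ 2) (m : ℕ) :
    chaconSum d a - chaconPartial d a m ≤ ((d : ℝ) ^ m)⁻¹ := by
  have h : (3 : ℝ) ≤ d := by exact_mod_cast hd
  have hs := summable_chaconSum (by omega : 2 ≤ d) ha
  have e := hs.sum_add_tsum_nat_add m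
  have h2 : ∑' j : ℕ, (a (j + m) : ℝ) * (d : ℝ) ^ (-((j + m : ℕ) : ℤ) - 1) ≤
      ∑' j : ℕ, 2 * ((d : ℝ) ^ m)⁻¹ * ((d : ℝ) ^ (j + 1))⁻¹ := by
    refine ((summable_nat_add_iff m).2 hs).tsum_le_tsum (fun j => ?_)
      ((summable_inv_pow_succ (by omega)).mul_left _)
    rw [zpow_neg_sub_one, mul_assoc, ← mul_inv, ← pow_add, show j + m + 1 = m + (j + 1) by ring]
    gcongr
    exact_mod_cast ha _
  rw [tsum_mul_left, tsum_inv_pow_succ (by omega)] at h2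
  have h3 : 2 * ((d : ℝ) ^ m)⁻¹ * ((d : ℝ) - 1)⁻¹ ≤ ((d : ℝ) ^ m)⁻¹ := by
    have : 2 * ((d : ℝ) - 1)⁻¹ ≤ 1 := by
      rw [← div_eq_mul_inv, div_le_one (by linarith)]; linarith
    calc _ = ((d : ℝ) ^ m)⁻¹ * (2 * ((d : ℝ) - 1)⁻¹) := by ring
      _ ≤ ((d : ℝ) ^ m)⁻¹ * 1 := by gcongr
      _ = _ := mul_one _
  unfold chaconSum chaconPartial
  linarith

lemma chaconSum_le_one {d : ℕ} (hd : 3 ≤ d) {a : ℕ → ℕ} (ha : ∀ j, a j ≤ 2) :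
    chaconSum d a ≤ 1 := by
  simpa [chaconPartial] using chaconSum_sub_chaconPartial_le hd ha 0

lemma towerHeight_eq {d : ℕ} (hd : 0 < d) (a : ℕ → ℕ) (m : ℕ) :
    (towerHeight d a m : ℝ) = d ^ m * (1 + chaconPartial d a m) := by
  induction m with
  | zero => simp [towerHeight, chaconPartial]
  | succ m ih =>
    have : (d : ℝ) ≠ 0 := by positivity
    rw [towerHeight, chaconPartial_succ]
    push_cast
    rw [ih]
    field_simp
    ring

lemma abs_visitTime_sub_le {d : ℕ} (hd : 3 ≤ d) {a : ℕ → ℕ} (ha : ∀ j, a j ≤ 2) {m M : ℕ}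
    (hm : m ≤ M) (i r : ℕ) :
    |(visitTime d a M (i + r) : ℝ) - visitTime d a M i - r * (1 + chaconSum d a)| ≤
      2 * r / d ^ m + 4 * d ^ m := by
  obtain ⟨h1, h2⟩ := visitTime_add_bounds (by omega : 2 ≤ d) ha hm i r
  have hp : (1 : ℝ) ≤ (d : ℝ) ^ m := one_le_pow₀ (by exact_mod_cast (by omega : 1 ≤ d))
  have hp0 : (0 : ℝ) < (d : ℝ) ^ m := by positivity
  have q1 : ((r / d ^ m : ℕ) : ℝ) ≤ r / (d : ℝ) ^ m := by exact_mod_cast Nat.cast_div_le (α := ℝ)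
  have q2 : (r : ℝ) / (d : ℝ) ^ m - 1 ≤ ((r / d ^ m : ℕ) : ℝ) := by
    have h := Nat.lt_div_mul_add (a := r) (b := d ^ m) (by positivity)
    have h' : (r : ℝ) < (r / d ^ m : ℕ) * (d : ℝ) ^ m + (d : ℝ) ^ m := by exact_mod_cast h
    rw [sub_le_iff_le_add, div_le_iff₀ hp0]
    nlinarith
  have h1' : (visitTime d a M i : ℝ) + (r / d ^ m : ℕ) * towerHeight d a m ≤
      visitTime d a M (i + r) := by exact_mod_cast h1
  have h2' : (visitTime d a M (i + r) : ℝ) ≤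
      visitTime d a M i + ((r / d ^ m : ℕ) + 1) * (towerHeight d a m + 2) := by exact_mod_cast h2
  rw [towerHeight_eq (by omega)] at h1' h2'
  have s1 := chaconPartial_le_chaconSum (by omega : 2 ≤ d) ha m
  have s2 := chaconSum_sub_chaconPartial_le hd ha m
  have s3 := chaconSum_le_one hd ha
  have s4 := chaconPartial_nonneg d a m
  set θ := chaconSum d a
  set A := chaconPartial d a m
  set X := (r : ℝ) / (d : ℝ) ^ m with hX
  have hX0 : 0 ≤ X := by positivity
  have hr : (r : ℝ) = X * d ^ m := by rw [hX]; field_simp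
  have s2' : (d : ℝ) ^ m * (θ - A) ≤ 1 := by
    calc _ ≤ (d : ℝ) ^ m * ((d : ℝ) ^ m)⁻¹ := by gcongr
      _ = 1 := mul_inv_cancel₀ hp0.ne'
  generalize (d : ℝ) ^ m = Y at *
  generalize ((r / d ^ m : ℕ) : ℝ) = Z at *
  rw [show 2 * (r : ℝ) / Y = 2 * X by rw [hX]; ring, hr, abs_le]
  have hYA : 0 ≤ Y * (1 + A) := by positivity
  constructor
  · have : (X - 1) * (Y * (1 + A)) ≤ Z * (Y * (1 + A)) := by gcongr
    nlinarith [mul_le_mul_of_nonneg_left s2' hX0, mul_le_mul_of_nonneg_left (s1.trans s3) hp0.le]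
  · have e1 : (Z + 1) * (Y * (1 + A) + 2) ≤ (X + 1) * (Y * (1 + A) + 2) := by gcongr
    have e2 : (X + 1) * (Y * (1 + A) + 2) ≤ (X + 1) * (Y * (1 + θ) + 2) := by gcongr
    nlinarith [mul_le_mul_of_nonneg_left s3 hp0.le]

/-- Visits are equidistributed, uniformly along the orbit. -/
lemma abs_card_visit_window_sub_le {d : ℕ} (hd : 3 ≤ d) {a : ℕ → ℕ} (ha : ∀ j, a j ≤ 2)
    {m M : ℕ} (hm : m ≤ M) (k t L R : ℕ) (hR : t + L ≤ visitTime d a M (d ^ k * R)) :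
    |(({q ∈ Finset.range R | t ≤ visitTime d a M (d ^ k * q) ∧
        visitTime d a M (d ^ k * q) < t + L}).card : ℝ) - L / (d ^ k * (1 + chaconSum d a))| ≤
      2 * L / d ^ m + 24 * d ^ k + 4 * d ^ m := by
  classical
  have hk0 : 0 < d ^ k := by positivity
  set V : ℕ → ℕ := fun q => visitTime d a M (d ^ k * q) with hV
  have hVm : StrictMono V := fun x y hxy =>
    visitTime_strictMono d a M (Nat.mul_lt_mul_of_pos_left hxy hk0)
  have hex : ∀ s, ∃ q, s ≤ V q := fun s => ⟨s, hVm.le_apply⟩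
  have hmono : ∀ s q, Nat.find (hex s) ≤ q ↔ s ≤ V q := fun s q =>
    ⟨fun h => (Nat.find_spec (hex s)).trans (hVm.monotone h), fun h => Nat.find_min' _ h⟩
  set q0 := Nat.find (hex t)
  set q1 := Nat.find (hex (t + L))
  have h01 : q0 ≤ q1 := (hmono t q1).2 ((Nat.le_add_right t L).trans ((hmono (t + L) q1).1 le_rfl))
  have h1R : q1 ≤ R := (hmono (t + L) R).2 hR
  have hQ : {q ∈ Finset.range R | t ≤ V q ∧ V q < t + L} = Finset.Ico q0 q1 := by
    ext q
    simp only [Finset.mem_filter, Finset.mem_range, Finset.mem_Ico]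
    have e1 := hmono t q
    have e2 := hmono (t + L) q
    change q0 ≤ q ↔ _ at e1
    change q1 ≤ q ↔ _ at e2
    omega
  change |(({q ∈ Finset.range R | t ≤ V q ∧ V q < t + L}).card : ℝ) - _| ≤ _
  rw [hQ, Nat.card_Ico]
  have hθ0 := chaconSum_nonneg d a
  have hθ1 := chaconSum_le_one hd ha
  set θ := chaconSum d a
  have hkr : (1 : ℝ) ≤ (d : ℝ) ^ k := by exact_mod_cast hk0
  have hfirst : ∀ s, s ≤ V (Nat.find (hex s)) ∧ (V (Nat.find (hex s)) : ℝ) ≤ s + 8 * d ^ k := by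
    intro s
    have h1 := Nat.find_spec (hex s)
    refine ⟨h1, ?_⟩
    rcases Nat.eq_zero_or_pos (Nat.find (hex s)) with h0 | h0
    · rw [h0]
      have : V 0 = 0 := by simp [hV, visitTime_zero (by omega : 2 ≤ d)]
      rw [this]
      push_cast
      positivity
    · obtain ⟨p, hp⟩ := Nat.exists_eq_add_of_lt h0
      rw [zero_add] at hp
      have h2 := Nat.find_min (hex s) (m := p) (by omega)
      have h3 := abs_visitTime_sub_le hd ha (Nat.zero_le M) (d ^ k * p) (d ^ k)
      rw [hp]
      have e : d ^ k * (p + 1) = d ^ k * p + d ^ k := by ring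
      rw [hV] at h2 ⊢
      simp only [e] at h2 ⊢
      have h4 := (abs_le.1 h3).2
      have h5 : (visitTime d a M (d ^ k * p) : ℝ) ≤ s := by exact_mod_cast (not_le.1 h2).le
      push_cast at h4
      simp only [pow_zero] at h4
      nlinarith
  obtain ⟨a1, a2⟩ := hfirst t
  obtain ⟨b1, b2⟩ := hfirst (t + L)
  change t ≤ V q0 at a1
  change (V q0 : ℝ) ≤ _ at a2
  change t + L ≤ V q1 at b1
  change (V q1 : ℝ) ≤ _ at b2
  have a1' : (t : ℝ) ≤ V q0 := by exact_mod_cast a1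
  have b1' : (t : ℝ) + L ≤ V q1 := by exact_mod_cast b1
  have h4 := abs_visitTime_sub_le hd ha hm (d ^ k * q0) (d ^ k * (q1 - q0))
  have e : d ^ k * q0 + d ^ k * (q1 - q0) = d ^ k * q1 := by
    rw [← mul_add, Nat.add_sub_cancel' h01]
  rw [e] at h4
  change |(V q1 : ℝ) - V q0 - _| ≤ _ at h4
  have h5 : V q0 + d ^ k * (q1 - q0) ≤ V q1 := by
    simp only [hV]
    rw [← e]
    have := spacerTime_mono d a M (Nat.le_add_right (d ^ k * q0) (d ^ k * (q1 - q0)))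
    unfold visitTime
    omega
  have h5' : (V q0 : ℝ) + d ^ k * ((q1 - q0 : ℕ) : ℝ) ≤ V q1 := by exact_mod_cast h5
  push_cast [-Nat.cast_sub] at h4 b2
  set q : ℝ := ((q1 - q0 : ℕ) : ℝ)
  have hp : (1 : ℝ) ≤ (d : ℝ) ^ m := one_le_pow₀ (by exact_mod_cast (by omega : 1 ≤ d))
  have h6 : 2 * ((d : ℝ) ^ k * q) / d ^ m ≤ 2 * L / d ^ m + 16 * d ^ k := by
    have : 2 * ((d : ℝ) ^ k * q) / d ^ m ≤ 2 * (L + 8 * d ^ k) / d ^ m := by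
      gcongr; linarith
    refine this.trans ?_
    rw [mul_add, add_div]
    gcongr
    rw [div_le_iff₀ (by positivity)]
    nlinarith
  have hD : (1 : ℝ) ≤ d ^ k * (1 + θ) := by nlinarith
  have h7 : |q * (d ^ k * (1 + θ)) - L| ≤ 2 * L / d ^ m + 24 * d ^ k + 4 * d ^ m := by
    rw [abs_le] at h4 ⊢
    constructor <;> nlinarith
  have h8 : q - L / (d ^ k * (1 + θ)) = (q * (d ^ k * (1 + θ)) - L) / (d ^ k * (1 + θ)) := by
    field_simp
  rw [h8, abs_div, abs_of_pos (by linarith : (0 : ℝ) < d ^ k * (1 + θ))]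
  exact (div_le_self (abs_nonneg _) hD).trans h7

lemma card_visitPairs_eq_sum {d : ℕ} (hd : 0 < d) (a : ℕ → ℕ) {k M : ℕ} (hk : k ≤ M) (n : ℕ) :
    (visitPairs d k a M n).card = ∑ p ∈ Finset.range (d ^ (M - k)),
      ∑ q ∈ Finset.range (d ^ (M - k)),
        if visitTime d a M (d ^ k * q) = visitTime d a M (d ^ k * p) + n then 1 else 0 := by
  have hp : 0 < d ^ k := by positivity
  have e : d ^ M = d ^ k * d ^ (M - k) := by rw [← pow_add, Nat.add_sub_cancel' hk]
  rw [← Finset.sum_product', ← Finset.card_filter]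
  symm
  refine Finset.card_nbij (fun p => (d ^ k * p.1, d ^ k * p.2)) ?_ ?_ ?_
  · rintro ⟨p, q⟩ h
    simp only [Finset.coe_filter, Finset.mem_product, Finset.mem_range, Set.mem_ofPred_eq,
      Finset.mem_coe, mem_visitPairs] at h ⊢
    rw [e]
    exact ⟨⟨Nat.mul_lt_mul_of_pos_left h.1.1 hp, Nat.mul_lt_mul_of_pos_left h.1.2 hp⟩,
      dvd_mul_right _ _, dvd_mul_right _ _, by omega⟩
  · rintro ⟨p, q⟩ _ ⟨p', q'⟩ _ h
    simpa [hd.ne'] using h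
  · rintro ⟨i, i'⟩ h
    simp only [Finset.mem_coe, mem_visitPairs] at h
    obtain ⟨⟨h1, h2⟩, ⟨p, rfl⟩, ⟨q, rfl⟩, h3⟩ := h
    rw [e] at h1 h2
    refine ⟨(p, q), ?_, rfl⟩
    simp only [Finset.coe_filter, Finset.mem_product, Finset.mem_range, Set.mem_ofPred_eq]
    exact ⟨⟨lt_of_mul_lt_mul_left h1 (Nat.zero_le _), lt_of_mul_lt_mul_left h2 (Nat.zero_le _)⟩,
      by omega⟩

lemma sum_card_visitPairs {d : ℕ} (hd : 0 < d) (a : ℕ → ℕ) {k M : ℕ} (hk : k ≤ M) (n L : ℕ) :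
    ∑ s ∈ Finset.range L, (visitPairs d k a M ((n + s : ℕ) : ℤ)).card =
      ∑ p ∈ Finset.range (d ^ (M - k)),
        ({q ∈ Finset.range (d ^ (M - k)) |
          visitTime d a M (d ^ k * p) + n ≤ visitTime d a M (d ^ k * q) ∧
          visitTime d a M (d ^ k * q) < visitTime d a M (d ^ k * p) + n + L}).card := by
  simp_rw [card_visitPairs_eq_sum hd a hk]
  rw [Finset.sum_comm]
  refine Finset.sum_congr rfl fun p _ => ?_
  rw [Finset.sum_comm, Finset.card_filter]
  refine Finset.sum_congr rfl fun q _ => ?_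
  rw [← Finset.card_filter]
  split_ifs with h
  · rw [Finset.card_eq_one]
    refine ⟨visitTime d a M (d ^ k * q) - (visitTime d a M (d ^ k * p) + n), ?_⟩
    ext s
    simp only [Finset.mem_filter, Finset.mem_range, Finset.mem_singleton]
    omega
  · rw [Finset.card_eq_zero, Finset.filter_eq_empty_iff]
    intro s hs
    rw [Finset.mem_range] at hs
    omega

/-- Cesàro averages of the number of pairs. -/
lemma abs_sum_card_visitPairs_sub_le {d : ℕ} (hd : 3 ≤ d) {a : ℕ → ℕ} (ha : ∀ j, a j ≤ 2)
    {m k M : ℕ} (hm : m ≤ M) (hk : k ≤ M) (n L : ℕ) :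
    |(∑ s ∈ Finset.range L, ((visitPairs d k a M ((n + s : ℕ) : ℤ)).card : ℝ)) -
      d ^ (M - k) * (L / (d ^ k * (1 + chaconSum d a)))| ≤
      d ^ M * (2 * L / d ^ m + 24 * d ^ k + 4 * d ^ m) + (n + L) * L := by
  have hp : 0 < d ^ k := by positivity
  set V : ℕ → ℕ := fun q => visitTime d a M (d ^ k * q) with hV
  have hVm : StrictMono V := fun x y hxy =>
    visitTime_strictMono d a M (Nat.mul_lt_mul_of_pos_left hxy hp)
  set R := d ^ (M - k) with hR
  set E : ℝ := L / (d ^ k * (1 + chaconSum d a)) with hE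
  set err : ℝ := 2 * L / d ^ m + 24 * d ^ k + 4 * d ^ m with herr
  have herr0 : 0 ≤ err := by positivity
  have hkr : (1 : ℝ) ≤ (d : ℝ) ^ k := by exact_mod_cast hp
  have hE0 : 0 ≤ E := div_nonneg (by positivity) (by have := chaconSum_nonneg d a; positivity)
  have hEL : E ≤ L := by
    refine div_le_self (by positivity) ?_
    have := chaconSum_nonneg d a
    nlinarith
  set K : ℕ → ℕ := fun p => ({q ∈ Finset.range R | V p + n ≤ V q ∧ V q < V p + n + L}).card
  have hsum : (∑ s ∈ Finset.range L, ((visitPairs d k a M ((n + s : ℕ) : ℤ)).card : ℝ)) =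
      ∑ p ∈ Finset.range R, (K p : ℝ) := by
    exact_mod_cast sum_card_visitPairs (by omega) a hk n L
  have hKL : ∀ p, (K p : ℝ) ≤ L := by
    intro p
    have : K p ≤ (Finset.Ico (V p + n) (V p + n + L)).card := by
      refine Finset.card_le_card_of_injOn V ?_ (hVm.injective.injOn)
      intro q hq
      simp only [Finset.coe_filter, Set.mem_ofPred_eq] at hq
      simpa using hq.2
    rw [Nat.card_Ico] at this
    exact_mod_cast (by omega : K p ≤ L)
  have hpt : ∀ p, |(K p : ℝ) - E| ≤ err + if V R < V p + n + L then (L : ℝ) else 0 := by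
    intro p
    split_ifs with h
    · have := hKL p
      have h0 : (0 : ℝ) ≤ K p := by positivity
      rw [abs_le]; constructor <;> linarith
    · rw [add_zero]
      exact abs_card_visit_window_sub_le hd ha hm k (V p + n) L R (by simpa [hV] using h)
  have hbad : ({p ∈ Finset.range R | V R < V p + n + L}).card ≤ n + L := by
    have : ({p ∈ Finset.range R | V R < V p + n + L}).card ≤
        (Finset.Ico (V R - (n + L)) (V R)).card := by
      refine Finset.card_le_card_of_injOn V ?_ (hVm.injective.injOn)
      intro q hq
      simp only [Finset.coe_filter, Set.mem_ofPred_eq, Finset.mem_range] at hq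
      have := hVm hq.1
      simp only [Finset.coe_Ico, Set.mem_Ico]
      omega
    rw [Nat.card_Ico] at this
    omega
  have hRE : (d : ℝ) ^ (M - k) * E = ∑ p ∈ Finset.range R, E := by
    simp [hR]
  rw [hsum, hRE, ← Finset.sum_sub_distrib]
  refine (Finset.abs_sum_le_sum_abs _ _).trans ((Finset.sum_le_sum fun p _ => hpt p).trans ?_)
  rw [Finset.sum_add_distrib, ← Finset.sum_filter]
  simp only [Finset.sum_const, nsmul_eq_mul, Finset.card_range]
  gcongr
  · rw [hR]
    push_cast
    exact pow_le_pow_right₀ (by exact_mod_cast (by omega : 1 ≤ d)) (Nat.sub_le _ _)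
  · exact_mod_cast hbad

/-- Reversal of the `M` base-`d` digits. -/
def digitRev (d : ℕ) : ℕ → ℕ → ℕ
  | 0, _ => 0
  | M + 1, i => d * digitRev d M (i % d ^ M) + i / d ^ M

lemma digitRev_lt {d : ℕ} (hd : 0 < d) (M : ℕ) : ∀ i < d ^ M, digitRev d M i < d ^ M := by
  induction M with
  | zero => intro i _; simp [digitRev]
  | succ M ih =>
    intro i hi
    have h1 := ih (i % d ^ M) (Nat.mod_lt _ (by positivity))
    have h2 : i / d ^ M < d := Nat.div_lt_of_lt_mul (by rwa [← pow_succ])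
    rw [digitRev, pow_succ]
    nlinarith

lemma digitRev_injOn {d : ℕ} (hd : 0 < d) (M : ℕ) :
    ∀ i < d ^ M, ∀ j < d ^ M, digitRev d M i = digitRev d M j → i = j := by
  induction M with
  | zero => intro i hi j hj _; simp at hi hj; omega
  | succ M ih =>
    intro i hi j hj h
    have h2 : ∀ l < d ^ (M + 1), l / d ^ M < d := fun l hl =>
      Nat.div_lt_of_lt_mul (by rwa [← pow_succ])
    rw [digitRev, digitRev] at h
    have m1 : i / d ^ M = j / d ^ M := by
      have := congrArg (· % d) h
      simpa [Nat.mul_add_mod, Nat.mod_eq_of_lt (h2 i hi), Nat.mod_eq_of_lt (h2 j hj)] using this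
    rw [m1] at h
    have m2 := ih _ (Nat.mod_lt i (by positivity)) _ (Nat.mod_lt j (by positivity))
      (Nat.eq_of_mul_eq_mul_left hd (Nat.add_right_cancel h))
    rw [← Nat.div_add_mod i (d ^ M), ← Nat.div_add_mod j (d ^ M), m1, m2]

lemma digitRev_surj {d : ℕ} (hd : 0 < d) (M : ℕ) {r : ℕ} (hr : r < d ^ M) :
    ∃ i < d ^ M, digitRev d M i = r := by
  have := Finset.surjOn_of_injOn_of_card_le (s := Finset.range (d ^ M))
    (t := Finset.range (d ^ M)) (digitRev d M)
    (fun i hi => by simpa using digitRev_lt hd M i (by simpa using hi))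
    (fun i hi j hj h => digitRev_injOn hd M i (by simpa using hi) j (by simpa using hj) h) le_rfl
  obtain ⟨i, hi, h⟩ := this (show r ∈ (Finset.range (d ^ M) : Set ℕ) by simpa using hr)
  exact ⟨i, by simpa using hi, h⟩

lemma digitRev_lt_pow_iff {d : ℕ} (hd : 0 < d) (k N : ℕ) :
    ∀ i < d ^ (k + N), (digitRev d (k + N) i < d ^ N ↔ d ^ k ∣ i) := by
  induction N with
  | zero =>
    intro i hi
    have h0 : ∀ M, digitRev d M 0 = 0 := by
      intro M
      induction M with
      | zero => rfl
      | succ M ih => simp [digitRev, ih]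
    simp only [add_zero, pow_zero, Nat.lt_one_iff] at hi ⊢
    constructor
    · intro h
      rw [digitRev_injOn hd k i hi 0 (by positivity) (by rw [h, h0])]
      exact dvd_zero _
    · intro h
      rw [Nat.eq_zero_of_dvd_of_lt h hi, h0]
  | succ N ih =>
    intro i hi
    have h1 := ih (i % d ^ (k + N)) (Nat.mod_lt _ (by positivity))
    have h2 : i / d ^ (k + N) < d := Nat.div_lt_of_lt_mul (by rwa [← pow_succ])
    rw [← add_assoc, digitRev, ← Nat.dvd_mod_iff (pow_dvd_pow d (Nat.le_add_right k N)), ← h1, pow_succ]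
    constructor
    · intro h
      by_contra hc
      have := Nat.mul_le_mul_left d (not_lt.1 hc)
      rw [mul_comm (d ^ N)] at h
      linarith [Nat.zero_le (i / d ^ (k + N))]
    · intro h
      have := Nat.mul_le_mul_left d (Nat.succ_le_of_lt h)
      rw [mul_comm (d ^ N)]
      rw [Nat.mul_succ] at this
      omega

/-- The fibre maps of the skew product. -/
def chaconFiber (d : ℕ) (a : ℕ → ℕ) (x : ℝ) : ℝ :=
  if 0 ≤ x ∧ x < 1 + chaconSum d a then chaconMap d a x else x

lemma chaconSkew_iterate (d n : ℕ) (a : ℕ → ℕ) (x : ℝ) :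
    (chaconSkew d)^[n] (a, x) = (a, (chaconFiber d a)^[n] x) := by
  induction n with
  | zero => rfl
  | succ n ih => rw [Function.iterate_succ_apply', Function.iterate_succ_apply', ih]; rfl

lemma chaconPartial_mono (d : ℕ) (a : ℕ → ℕ) : Monotone (chaconPartial d a) := by
  refine monotone_nat_of_le_succ fun m => ?_
  rw [chaconPartial_succ]
  have : (0 : ℝ) ≤ a m * ((d : ℝ) ^ (m + 1))⁻¹ := by positivity
  linarith

lemma chaconIndex_of_lt_one {d : ℕ} (hd : 2 ≤ d) (a : ℕ → ℕ) (m : ℕ) {x : ℝ}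
    (h1 : 1 - ((d : ℝ) ^ m)⁻¹ ≤ x) (h2 : x < 1 - ((d : ℝ) ^ (m + 1))⁻¹) :
    chaconIndex d a x = m := by
  have hd1 : (1 : ℝ) ≤ d := by exact_mod_cast (by omega : 1 ≤ d)
  have hx : x < 1 := h2.trans (by rw [sub_lt_self_iff]; positivity)
  rw [chaconIndex, if_pos hx]
  simp only [zpow_neg_sub_one]
  refine le_antisymm (Nat.sInf_le h2) (le_csInf ⟨m, h2⟩ fun n hn => ?_)
  by_contra hc
  have : ((d : ℝ) ^ m)⁻¹ ≤ ((d : ℝ) ^ (n + 1))⁻¹ := by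
    gcongr
    omega
  have hn' : x < 1 - ((d : ℝ) ^ (n + 1))⁻¹ := hn
  linarith

lemma chaconIndex_of_one_le {d : ℕ} (a : ℕ → ℕ) (m : ℕ) {x : ℝ}
    (h1 : 1 + chaconPartial d a m ≤ x) (h2 : x < 1 + chaconPartial d a (m + 1)) :
    chaconIndex d a x = m := by
  have hx : ¬ x < 1 := by have := chaconPartial_nonneg d a m; linarith
  rw [chaconIndex, if_neg hx]
  refine le_antisymm (Nat.sInf_le h2) (le_csInf ⟨m, h2⟩ fun n hn => ?_)
  by_contra hc
  have := chaconPartial_mono d a (by omega : n + 1 ≤ m)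
  have hn' : x < 1 + chaconPartial d a (n + 1) := hn
  linarith

lemma inv_pow_eq_mul {d : ℕ} (hd : 0 < d) (m : ℕ) :
    ((d : ℝ) ^ m)⁻¹ = d * ((d : ℝ) ^ (m + 1))⁻¹ := by
  have : (d : ℝ) ≠ 0 := by positivity
  rw [pow_succ]; field_simp

lemma chaconFiber_column {d : ℕ} (hd : 3 ≤ d) (a : ℕ → ℕ) (m : ℕ) {z : ℝ}
    (hz0 : 0 ≤ z) (hz : z < ((d : ℝ) ^ (m + 1))⁻¹) {c : ℕ} (hc : c + 3 ≤ d) :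
    chaconFiber d a (z + c * ((d : ℝ) ^ (m + 1))⁻¹ + 1 - ((d : ℝ) ^ m)⁻¹) =
      z + (c + 1) * ((d : ℝ) ^ (m + 1))⁻¹ := by
  have hθ := chaconSum_nonneg d a
  have hcr : (c : ℝ) + 3 ≤ d := by exact_mod_cast hc
  have hu : (0 : ℝ) < ((d : ℝ) ^ (m + 1))⁻¹ := by positivity
  have hdm : ((d : ℝ) ^ m)⁻¹ ≤ 1 := inv_le_one_of_one_le₀ (one_le_pow₀ (by exact_mod_cast (by omega : 1 ≤ d)))
  have e := inv_pow_eq_mul (by omega : 0 < d) m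
  set u := ((d : ℝ) ^ (m + 1))⁻¹ with hu'
  have hcu : (c : ℝ) * u + 3 * u ≤ d * u := by nlinarith
  have hcu0 : 0 ≤ (c : ℝ) * u := by positivity
  have hidx := chaconIndex_of_lt_one (by omega : 2 ≤ d) a m (x := z + c * u + 1 - ((d : ℝ) ^ m)⁻¹)
    (by linarith) (by rw [e, ← hu']; linarith)
  rw [chaconFiber, if_pos ⟨by linarith, by rw [e]; linarith⟩]
  simp only [chaconMap, hidx, zpow_neg_sub_one, zpow_neg, zpow_natCast]
  rw [← hu', if_pos (by rw [e]; linarith), if_pos (by rw [e]; linarith)]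
  ring

lemma chaconFiber_lastColumn {d : ℕ} (hd : 3 ≤ d) (a : ℕ → ℕ) (m : ℕ) {z : ℝ}
    (hz0 : 0 ≤ z) (hz : z < ((d : ℝ) ^ (m + 1))⁻¹) :
    chaconFiber d a (z + (d - 2) * ((d : ℝ) ^ (m + 1))⁻¹ + 1 - ((d : ℝ) ^ m)⁻¹) =
      z + 1 + chaconPartial d a m := by
  have hθ := chaconSum_nonneg d a
  have hdr : (3 : ℝ) ≤ d := by exact_mod_cast hd
  have hu : (0 : ℝ) < ((d : ℝ) ^ (m + 1))⁻¹ := by positivity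
  have hdm : ((d : ℝ) ^ m)⁻¹ ≤ 1 := inv_le_one_of_one_le₀ (one_le_pow₀ (by exact_mod_cast (by omega : 1 ≤ d)))
  have e := inv_pow_eq_mul (by omega : 0 < d) m
  set u := ((d : ℝ) ^ (m + 1))⁻¹ with hu'
  have hdu : 3 * u ≤ d * u := by nlinarith
  have ex : z + (d - 2) * u + 1 - ((d : ℝ) ^ m)⁻¹ = z + 1 - 2 * u := by rw [e]; ring
  rw [ex]
  have hidx := chaconIndex_of_lt_one (by omega : 2 ≤ d) a m (x := z + 1 - 2 * u)
    (by rw [e]; linarith) (by rw [← hu']; linarith)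
  rw [chaconFiber, if_pos ⟨by linarith, by linarith⟩]
  simp only [chaconMap, hidx, zpow_neg_sub_one, zpow_neg, zpow_natCast]
  rw [← hu', if_pos (by linarith), if_neg (by linarith)]
  ring

lemma chaconFiber_topSpacer {d : ℕ} (hd : 3 ≤ d) {a : ℕ → ℕ} (ha : ∀ j, a j = 1 ∨ a j = 2) (m : ℕ) {z : ℝ}
    (hz0 : 0 ≤ z) (hz : z < ((d : ℝ) ^ (m + 1))⁻¹) :
    chaconFiber d a (z + 1 + chaconPartial d a m + (a m - 1) * ((d : ℝ) ^ (m + 1))⁻¹) =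
      z + (d - 1) * ((d : ℝ) ^ (m + 1))⁻¹ := by
  have hA := chaconPartial_nonneg d a m
  have hs := chaconPartial_le_chaconSum (by omega : 2 ≤ d) (a := a)
    (fun j => by rcases ha j with h | h <;> omega) (m + 1)
  have hu : (0 : ℝ) < ((d : ℝ) ^ (m + 1))⁻¹ := by positivity
  have e := chaconPartial_succ d a m
  have ham : (1 : ℝ) ≤ a m := by rcases ha m with h | h <;> simp [h]
  set u := ((d : ℝ) ^ (m + 1))⁻¹ with hu'
  have hau : u ≤ a m * u := by nlinarith
  have hidx := chaconIndex_of_one_le a m (x := z + 1 + chaconPartial d a m + (a m - 1) * u)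
    (by linarith) (by rw [e]; linarith)
  rw [chaconFiber, if_pos ⟨by linarith, by linarith⟩]
  simp only [chaconMap, hidx, zpow_neg_sub_one, zpow_neg, zpow_natCast]
  rw [← hu', if_neg (by linarith), if_pos (by rw [e]; linarith), e]
  ring

lemma chaconFiber_bottomSpacer {d : ℕ} (hd : 3 ≤ d) {a : ℕ → ℕ} (ha : ∀ j, a j = 1 ∨ a j = 2) (m : ℕ) {z : ℝ}
    (hz0 : 0 ≤ z) (hz : z < ((d : ℝ) ^ (m + 1))⁻¹)
    (h2 : a m = 2) :
    chaconFiber d a (z + 1 + chaconPartial d a m) =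
      z + 1 + chaconPartial d a m + ((d : ℝ) ^ (m + 1))⁻¹ := by
  have hA := chaconPartial_nonneg d a m
  have hs := chaconPartial_le_chaconSum (by omega : 2 ≤ d) (a := a)
    (fun j => by rcases ha j with h | h <;> omega) (m + 1)
  have hu : (0 : ℝ) < ((d : ℝ) ^ (m + 1))⁻¹ := by positivity
  have e := chaconPartial_succ d a m
  rw [h2] at e
  push_cast at e
  set u := ((d : ℝ) ^ (m + 1))⁻¹ with hu'
  have hidx := chaconIndex_of_one_le a m (x := z + 1 + chaconPartial d a m)
    (by linarith) (by rw [e]; linarith)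
  rw [chaconFiber, if_pos ⟨by linarith, by linarith⟩]
  simp only [chaconMap, hidx, zpow_neg_sub_one, zpow_neg, zpow_natCast]
  rw [← hu', if_neg (by linarith), if_neg (by rw [e]; linarith)]

lemma towerHeight_pos {d : ℕ} (hd : 0 < d) (a : ℕ → ℕ) (m : ℕ) : 0 < towerHeight d a m := by
  induction m with
  | zero => simp [towerHeight]
  | succ m ih => rw [towerHeight]; positivity

lemma visitTime_column {d : ℕ} (hd : 2 ≤ d) (a : ℕ → ℕ) (M : ℕ) {c i : ℕ} (hc : c < d)
    (hi : i < d ^ M) :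
    visitTime d a (M + 1) (i + c * d ^ M) =
      visitTime d a M i + (c * towerHeight d a M + if c + 1 = d then a M else 0) := by
  have h1 := visitTime_add_mul_pow (by omega : 0 < d) a M i c
  have h2 : (i + c * d ^ M + d ^ M) / d ^ (M + 1) = if c + 1 = d then 1 else 0 := by
    have e : (i + c * d ^ M + d ^ M) / d ^ M = c + 1 := by
      rw [show i + c * d ^ M + d ^ M = i + (c + 1) * d ^ M by ring,
        Nat.add_mul_div_right _ _ (by positivity), Nat.div_eq_of_lt hi, zero_add]
    rw [pow_succ, ← Nat.div_div_eq_div_mul, e]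
    split_ifs with h
    · rw [h, Nat.div_self (by omega)]
    · exact Nat.div_eq_of_lt (by omega)
  unfold visitTime at h1 ⊢
  rw [spacerTime_succ, h2]
  split_ifs <;> omega

/-- Orbit segments starting in the base of the tower of stage `M`. -/
lemma chaconFiber_iterate {d : ℕ} (hd : 3 ≤ d) {a : ℕ → ℕ} (ha : ∀ j, a j = 1 ∨ a j = 2) (M : ℕ) :
    ∀ z : ℝ, 0 ≤ z → z < ((d : ℝ) ^ M)⁻¹ →
      (chaconFiber d a)^[towerHeight d a M - 1] z = z + 1 - ((d : ℝ) ^ M)⁻¹ ∧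
      (∀ i < d ^ M, (chaconFiber d a)^[visitTime d a M i] z =
        z + digitRev d M i * ((d : ℝ) ^ M)⁻¹) ∧
      ∀ t < towerHeight d a M, (∃ i < d ^ M, visitTime d a M i = t) ∨
        1 ≤ (chaconFiber d a)^[t] z := by
  induction M with
  | zero =>
    intro z h0 h1
    refine ⟨by simp [towerHeight], ?_, ?_⟩
    · intro i hi
      obtain rfl : i = 0 := by simpa using hi
      simp [visitTime, spacerTime, digitRev]
    · intro t ht
      left
      refine ⟨0, by simp, ?_⟩
      simp only [towerHeight] at ht
      simp only [visitTime, spacerTime, Finset.range_zero, Finset.sum_empty]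
      omega
  | succ M ih =>
    intro z h0 h1
    set S := chaconFiber d a
    set h := towerHeight d a M with hh
    have hpos : 0 < h := towerHeight_pos (by omega) a M
    have e := inv_pow_eq_mul (by omega : 0 < d) M
    set u := ((d : ℝ) ^ (M + 1))⁻¹ with hu
    have hu0 : 0 < u := by positivity
    have hA := chaconPartial_nonneg d a M
    have hbase : ∀ c : ℕ, c < d → 0 ≤ z + c * u ∧ z + c * u < ((d : ℝ) ^ M)⁻¹ := by
      intro c hc
      have : (c : ℝ) + 1 ≤ d := by exact_mod_cast hc
      refine ⟨by positivity, ?_⟩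
      rw [e]; nlinarith
    have hstep : ∀ c : ℕ, c < d → S^[h] (z + c * u) = S (z + c * u + 1 - ((d : ℝ) ^ M)⁻¹) := by
      intro c hc
      have := (ih _ (hbase c hc).1 (hbase c hc).2).1
      rw [← this, ← Function.iterate_succ_apply' S]
      congr 2
      omega
    have hcol : ∀ c : ℕ, c + 2 ≤ d → S^[c * h] z = z + c * u := by
      intro c
      induction c with
      | zero => intro _; simp
      | succ c ihc =>
        intro hc
        rw [add_mul, one_mul, add_comm, Function.iterate_add_apply, ihc (by omega),
          hstep c (by omega)]
        refine (chaconFiber_column hd a M h0 h1 (by omega : c + 3 ≤ d)).trans ?_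
        push_cast
        ring
    have hcast : ((d - 2 : ℕ) : ℝ) = d - 2 := by push_cast [(by omega : 2 ≤ d)]; ring
    have hspacer0 : S^[(d - 1) * h] z = z + 1 + chaconPartial d a M := by
      rw [show d - 1 = 1 + (d - 2) by omega, add_mul, one_mul, Function.iterate_add_apply,
        hcol (d - 2) (by omega), hstep (d - 2) (by omega), hcast]
      exact chaconFiber_lastColumn hd a M h0 h1
    have hspacer1 : a M = 2 → S^[(d - 1) * h + 1] z = z + 1 + chaconPartial d a M + u := by
      intro h2
      rw [Function.iterate_succ_apply', hspacer0]
      exact chaconFiber_bottomSpacer hd ha M h0 h1 h2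
    have hlast : S^[(d - 1) * h + a M] z = z + (d - 1) * u := by
      rw [← chaconFiber_topSpacer hd ha M h0 h1, ← hu]
      rcases ha M with h2 | h2
      · rw [h2, Function.iterate_succ_apply', hspacer0]
        simp [S]
      · rw [h2, ← add_assoc ((d - 1) * h) 1 1, Function.iterate_succ_apply', hspacer1 h2]
        norm_num [S]
    have hcol' : ∀ c : ℕ, c < d → S^[c * h + if c + 1 = d then a M else 0] z = z + c * u := by
      intro c hc
      split_ifs with h3
      · obtain rfl : c = d - 1 := by omega
        rw [hlast]
        push_cast [(by omega : 1 ≤ d)]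
        ring
      · exact hcol c (by omega)
    refine ⟨?_, ?_, ?_⟩
    · have h4 := (ih _ (hbase (d - 1) (by omega)).1 (hbase (d - 1) (by omega)).2).1
      rw [← hcol' (d - 1) (by omega), if_pos (by omega), ← Function.iterate_add_apply, hlast] at h4
      rw [towerHeight, ← hh]
      have e2 : h - 1 + ((d - 1) * h + a M) = d * h + a M - 1 := by
        obtain ⟨D, rfl⟩ := Nat.exists_eq_add_of_le' (by omega : 1 ≤ d)
        rw [Nat.add_sub_cancel, add_mul, one_mul]
        omega
      rw [← e2, h4, e]
      ring
    · intro i hi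
      have hc : i / d ^ M < d := Nat.div_lt_of_lt_mul (by rwa [← pow_succ])
      have hm : i % d ^ M < d ^ M := Nat.mod_lt _ (by positivity)
      have h5 := visitTime_column (by omega : 2 ≤ d) a M hc hm
      rw [show i % d ^ M + i / d ^ M * d ^ M = i by rw [mul_comm]; exact Nat.mod_add_div _ _] at h5
      rw [h5, Function.iterate_add_apply, hcol' _ hc, (ih _ (hbase _ hc).1 (hbase _ hc).2).2.1 _ hm,
        digitRev, e]
      push_cast
      ring
    · intro t ht
      rw [towerHeight, ← hh] at ht
      have hfin : ∀ c s : ℕ, c < d → s < h → t = s + (c * h + if c + 1 = d then a M else 0) →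
          (∃ i < d ^ (M + 1), visitTime d a (M + 1) i = t) ∨ 1 ≤ S^[t] z := by
        intro c s hc hs ht
        rw [ht, Function.iterate_add_apply, hcol' _ hc]
        rcases (ih _ (hbase _ hc).1 (hbase _ hc).2).2.2 s hs with ⟨i, hi, h6⟩ | h6
        · left
          refine ⟨i + c * d ^ M, ?_, ?_⟩
          · rw [pow_succ]; nlinarith
          · rw [visitTime_column (by omega) a M hc hi, h6]
        · right; exact h6
      obtain ⟨D, rfl⟩ := Nat.exists_eq_add_of_le' (by omega : 1 ≤ d)
      rw [Nat.add_sub_cancel] at hspacer0 hspacer1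
      rw [add_mul, one_mul] at ht
      by_cases c1 : t < D * h
      · have hc : t / h < D := (Nat.div_lt_iff_lt_mul hpos).2 c1
        refine hfin (t / h) (t % h) (by omega) (Nat.mod_lt _ hpos) ?_
        rw [if_neg (by omega), add_zero, mul_comm]
        exact (Nat.mod_add_div _ _).symm
      · by_cases c2 : D * h + a M ≤ t
        · refine hfin D (t - (D * h + a M)) (by omega) (by omega) ?_
          rw [if_pos rfl]; omega
        · right
          obtain ⟨e', rfl⟩ := Nat.exists_eq_add_of_le (not_lt.1 c1)
          rcases ha M with h2 | h2
          · obtain rfl : e' = 0 := by omega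
            rw [add_zero, hspacer0]; linarith
          · have : e' = 0 ∨ e' = 1 := by omega
            rcases this with rfl | rfl
            · rw [add_zero, hspacer0]; linarith
            · rw [hspacer1 h2]; linarith

/-- Return sets of the cylinder in the fibre. -/
def returnSet (d k : ℕ) (a : ℕ → ℕ) (n : ℕ) : Set ℝ :=
  {x | x ∈ Set.Ico (0 : ℝ) (((d : ℝ) ^ k)⁻¹) ∧
    (chaconFiber d a)^[n] x ∈ Set.Ico (0 : ℝ) (((d : ℝ) ^ k)⁻¹)}

/-- Levels of the tower of stage `M`. -/
def towerLevel (d M r : ℕ) : Set ℝ :=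
  Set.Ico (r * ((d : ℝ) ^ M)⁻¹) ((r + 1) * ((d : ℝ) ^ M)⁻¹)

lemma volume_towerLevel (d M r : ℕ) :
    volume (towerLevel d M r) = ENNReal.ofReal (((d : ℝ) ^ M)⁻¹) := by
  rw [towerLevel, Real.volume_Ico]
  congr 1
  ring

lemma add_digitRev_mem_iff {d : ℕ} (hd : 2 ≤ d) {k M i : ℕ} (hk : k ≤ M) (hi : i < d ^ M) {z : ℝ}
    (h0 : 0 ≤ z) (h1 : z < ((d : ℝ) ^ M)⁻¹) :
    z + digitRev d M i * ((d : ℝ) ^ M)⁻¹ ∈ Set.Ico (0 : ℝ) (((d : ℝ) ^ k)⁻¹) ↔ d ^ k ∣ i := by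
  obtain ⟨N, rfl⟩ := Nat.exists_eq_add_of_le hk
  rw [← digitRev_lt_pow_iff (by omega) k N i hi]
  have e : ((d : ℝ) ^ k)⁻¹ = d ^ N * ((d : ℝ) ^ (k + N))⁻¹ := by
    rw [pow_add]
    have : (d : ℝ) ≠ 0 := by positivity
    field_simp
  rw [e]
  set u := ((d : ℝ) ^ (k + N))⁻¹
  have hu : 0 < u := by positivity
  constructor
  · intro h
    by_contra hc
    have : (d : ℝ) ^ N ≤ digitRev d (k + N) i := by exact_mod_cast not_lt.1 hc
    have := h.2
    nlinarith
  · intro h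
    have : (digitRev d (k + N) i : ℝ) + 1 ≤ (d : ℝ) ^ N := by exact_mod_cast h
    exact ⟨by positivity, by nlinarith⟩

lemma towerLevel_subset_iff {d : ℕ} (hd : 3 ≤ d) {a : ℕ → ℕ} (ha : ∀ j, a j = 1 ∨ a j = 2)
    {k M i n : ℕ} (hk : k ≤ M) (hi : i < d ^ M)
    (hn : visitTime d a M i + n < towerHeight d a M) {x : ℝ}
    (hx : x ∈ towerLevel d M (digitRev d M i)) :
    x ∈ returnSet d k a n ↔ ∃ i', (i, i') ∈ visitPairs d k a M n := by
  set u := ((d : ℝ) ^ M)⁻¹ with hu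
  have hz0 : 0 ≤ x - digitRev d M i * u := by have := hx.1; linarith
  have hz1 : x - digitRev d M i * u < u := by have := hx.2; linarith
  obtain ⟨-, t1, t2⟩ := chaconFiber_iterate hd ha M _ hz0 hz1
  have ex : (chaconFiber d a)^[visitTime d a M i] (x - digitRev d M i * u) = x := by
    rw [t1 i hi]; ring
  have en : (chaconFiber d a)^[n] x =
      (chaconFiber d a)^[visitTime d a M i + n] (x - digitRev d M i * u) := by
    rw [add_comm, Function.iterate_add_apply, ex]
  have m1 : x ∈ Set.Ico (0 : ℝ) (((d : ℝ) ^ k)⁻¹) ↔ d ^ k ∣ i := by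
    rw [← add_digitRev_mem_iff (by omega) hk hi hz0 hz1, ← hu, sub_add_cancel]
  rw [returnSet, Set.mem_ofPred_eq, m1]
  constructor
  · rintro ⟨h1, h2⟩
    rw [en] at h2
    rcases t2 _ hn with ⟨i', hi', h3⟩ | h3
    · refine ⟨i', mem_visitPairs.2 ⟨⟨hi, hi'⟩, h1, ?_, by simp only; omega⟩⟩
      rw [← h3, t1 i' hi'] at h2
      exact (add_digitRev_mem_iff (by omega) hk hi' hz0 hz1).1 h2
    · have hle : ((d : ℝ) ^ k)⁻¹ ≤ 1 :=
        inv_le_one_of_one_le₀ (one_le_pow₀ (by exact_mod_cast (by omega : 1 ≤ d)))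
      have := h2.2
      linarith
  · rintro ⟨i', h⟩
    obtain ⟨⟨h1, h2⟩, h3, h4, h5⟩ := mem_visitPairs.1 h
    simp only at h1 h2 h3 h4 h5
    refine ⟨h3, ?_⟩
    rw [en, show visitTime d a M i + n = visitTime d a M i' by omega, t1 i' h2]
    exact (add_digitRev_mem_iff (by omega) hk h2 hz0 hz1).2 h4

/-- The measure of a return set is computed up to `n / d ^ M` by counting pairs. -/
lemma volume_returnSet_bounds {d : ℕ} (hd : 3 ≤ d) {a : ℕ → ℕ} (ha : ∀ j, a j = 1 ∨ a j = 2)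
    {k M n : ℕ} (hk : k ≤ M) :
    ((visitPairs d k a M n).card : ℝ) * ((d : ℝ) ^ M)⁻¹ ≤ (volume (returnSet d k a n)).toReal ∧
      (volume (returnSet d k a n)).toReal ≤
        ((visitPairs d k a M n).card + n : ℝ) * ((d : ℝ) ^ M)⁻¹ := by
  classical
  set u := ((d : ℝ) ^ M)⁻¹ with hu
  have hu0 : 0 < u := by positivity
  have hfin : volume (returnSet d k a n) ≠ ⊤ := by
    refine ((measure_mono (t := Set.Ico (0 : ℝ) (((d : ℝ) ^ k)⁻¹)) fun x hx => hx.1).trans_lt ?_).ne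
    rw [Real.volume_Ico]
    exact ENNReal.ofReal_lt_top
  have htop : visitTime d a M (d ^ M) = towerHeight d a M := visitTime_pow (by omega) a M
  set P := (visitPairs d k a M n).image Prod.fst with hP
  have hPc : P.card = (visitPairs d k a M n).card :=
    Finset.card_image_of_injOn (visitPairs_fst_injOn d k a M n)
  have hPmem : ∀ i, i ∈ P ↔ ∃ i', (i, i') ∈ visitPairs d k a M n := by
    intro i
    simp [hP]
  have hPgood : ∀ i ∈ P, i < d ^ M ∧ visitTime d a M i + n < towerHeight d a M := by
    intro i hi
    obtain ⟨i', h⟩ := (hPmem i).1 hi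
    obtain ⟨⟨h1, h2⟩, h3, h4, h5⟩ := mem_visitPairs.1 h
    simp only at h1 h2 h3 h4 h5
    have := visitTime_strictMono d a M h2
    exact ⟨h1, by omega⟩
  constructor
  · have hdisj : Set.PairwiseDisjoint (P : Set ℕ) fun i => towerLevel d M (digitRev d M i) := by
      intro i hi j hj hij
      rw [Function.onFun, Set.disjoint_left]
      intro x hx hx'
      apply hij
      refine digitRev_injOn (by omega) M i (hPgood i hi).1 j (hPgood j hj).1 ?_
      have q : ∀ r s : ℕ, x ∈ towerLevel d M r → x ∈ towerLevel d M s → r ≤ s := by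
        intro r s hr hs
        have h1 := hr.1
        have h2 := hs.2
        have : (r : ℝ) < s + 1 := lt_of_mul_lt_mul_right (h1.trans_lt h2) hu0.le
        exact Nat.lt_succ_iff.1 (by exact_mod_cast this)
      exact le_antisymm (q _ _ hx hx') (q _ _ hx' hx)
    have hsub : (⋃ i ∈ P, towerLevel d M (digitRev d M i)) ⊆ returnSet d k a n := by
      intro x hx
      simp only [Set.mem_iUnion] at hx
      obtain ⟨i, hi, hx⟩ := hx
      exact (towerLevel_subset_iff hd ha hk (hPgood i hi).1 (hPgood i hi).2 hx).2 ((hPmem i).1 hi)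
    have := measure_mono (μ := volume) hsub
    rw [measure_biUnion_finset hdisj (fun i _ => measurableSet_Ico)] at this
    simp only [volume_towerLevel, Finset.sum_const, nsmul_eq_mul] at this
    have h2 := ENNReal.toReal_mono hfin this
    rwa [ENNReal.toReal_mul, ENNReal.toReal_natCast, ENNReal.toReal_ofReal hu0.le, hPc] at h2
  · set Bad := {i ∈ Finset.range (d ^ M) | towerHeight d a M ≤ visitTime d a M i + n} with hBad
    have hbad : Bad.card ≤ n := by
      have : Bad.card ≤ (Finset.Ico (towerHeight d a M - n) (towerHeight d a M)).card := by
        refine Finset.card_le_card_of_injOn (visitTime d a M) ?_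
          (visitTime_strictMono d a M).injective.injOn
        intro q hq
        simp only [hBad, Finset.coe_filter, Set.mem_ofPred_eq, Finset.mem_range] at hq
        have := visitTime_strictMono d a M hq.1
        simp only [Finset.coe_Ico, Set.mem_Ico]
        omega
      rw [Nat.card_Ico] at this
      omega
    have hsub : returnSet d k a n ⊆ ⋃ i ∈ P ∪ Bad, towerLevel d M (digitRev d M i) := by
      intro x hx
      have hle : ((d : ℝ) ^ k)⁻¹ ≤ 1 :=
        inv_le_one_of_one_le₀ (one_le_pow₀ (by exact_mod_cast (by omega : 1 ≤ d)))
      have hx0 : 0 ≤ x := hx.1.1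
      have hx1 : x < 1 := hx.1.2.trans_le hle
      have hr : ⌊x * d ^ M⌋₊ < d ^ M := by
        rw [Nat.floor_lt (by positivity)]
        push_cast
        have : (0 : ℝ) < (d : ℝ) ^ M := by positivity
        nlinarith
      obtain ⟨i, hi, h⟩ := digitRev_surj (by omega : 0 < d) M hr
      have hxi : x ∈ towerLevel d M (digitRev d M i) := by
        rw [h, towerLevel]
        have hp : (0 : ℝ) < (d : ℝ) ^ M := by positivity
        constructor
        · rw [← div_eq_mul_inv, div_le_iff₀ hp]
          exact Nat.floor_le (by positivity)
        · rw [← div_eq_mul_inv, lt_div_iff₀ hp]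
          exact Nat.lt_floor_add_one _
      simp only [Set.mem_iUnion]
      refine ⟨i, ?_, hxi⟩
      by_cases hg : visitTime d a M i + n < towerHeight d a M
      · exact Finset.mem_union_left _ ((hPmem i).2 ((towerLevel_subset_iff hd ha hk hi hg hxi).1 hx))
      · exact Finset.mem_union_right _ (by simp [hBad, hi, not_lt.1 hg])
    have h1 := (measure_mono (μ := volume) hsub).trans (measure_biUnion_finset_le _ _)
    simp only [volume_towerLevel, Finset.sum_const, nsmul_eq_mul] at h1
    have h2 := ENNReal.toReal_mono (by
      exact ENNReal.mul_ne_top (ENNReal.natCast_ne_top _) ENNReal.ofReal_ne_top) h1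
    rw [ENNReal.toReal_mul, ENNReal.toReal_natCast, ENNReal.toReal_ofReal hu0.le] at h2
    refine h2.trans ?_
    gcongr
    rw [← hPc]
    exact_mod_cast (Finset.card_union_le _ _).trans (by omega)

/-- The measure of a return set. -/
def returnMeasure (d k : ℕ) (a : ℕ → ℕ) (n : ℕ) : ℝ := (volume (returnSet d k a n)).toReal

lemma tendsto_card_visitPairs {d : ℕ} (hd : 3 ≤ d) {a : ℕ → ℕ} (ha : ∀ j, a j = 1 ∨ a j = 2)
    (k n : ℕ) :
    Tendsto (fun M => ((visitPairs d k a M n).card : ℝ) * ((d : ℝ) ^ M)⁻¹) atTop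
      (𝓝 (returnMeasure d k a n)) := by
  have hlim : Tendsto (fun M : ℕ => ((d : ℝ) ^ M)⁻¹) atTop (𝓝 0) := by
    simp_rw [← inv_pow]
    exact tendsto_pow_atTop_nhds_zero_of_lt_one (by positivity)
      (inv_lt_one_of_one_lt₀ (by exact_mod_cast (by omega : 1 < d)))
  have h2 : Tendsto (fun M : ℕ => returnMeasure d k a n - n * ((d : ℝ) ^ M)⁻¹) atTop
      (𝓝 (returnMeasure d k a n)) := by
    simpa using tendsto_const_nhds.sub (hlim.const_mul (n : ℝ))
  refine tendsto_of_tendsto_of_tendsto_of_le_of_le' h2 tendsto_const_nhds ?_ ?_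
  all_goals
    filter_upwards [eventually_ge_atTop k] with M hM
    have := volume_returnSet_bounds hd ha (n := n) hM
    unfold returnMeasure
    linarith [this.1, this.2]

lemma tendsto_inv_pow_atTop {d : ℕ} (hd : 2 ≤ d) :
    Tendsto (fun M : ℕ => ((d : ℝ) ^ M)⁻¹) atTop (𝓝 0) := by
  simp_rw [← inv_pow]
  exact tendsto_pow_atTop_nhds_zero_of_lt_one (by positivity)
    (inv_lt_one_of_one_lt₀ (by exact_mod_cast (by omega : 1 < d)))

lemma abs_sum_returnMeasure_sub_le {d : ℕ} (hd : 3 ≤ d) {a : ℕ → ℕ} (ha : ∀ j, a j = 1 ∨ a j = 2)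
    (k m n L : ℕ) :
    |(∑ s ∈ Finset.range L, returnMeasure d k a (n + s)) -
      ((d : ℝ) ^ k)⁻¹ * (L / (d ^ k * (1 + chaconSum d a)))| ≤
      2 * L / d ^ m + 24 * d ^ k + 4 * d ^ m := by
  have hu := tendsto_inv_pow_atTop (by omega : 2 ≤ d)
  have h1 : Tendsto (fun M : ℕ => |(∑ s ∈ Finset.range L,
      ((visitPairs d k a M ((n + s : ℕ) : ℤ)).card : ℝ) * ((d : ℝ) ^ M)⁻¹) -
      ((d : ℝ) ^ k)⁻¹ * (L / (d ^ k * (1 + chaconSum d a)))|) atTop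
      (𝓝 |(∑ s ∈ Finset.range L, returnMeasure d k a (n + s)) -
      ((d : ℝ) ^ k)⁻¹ * (L / (d ^ k * (1 + chaconSum d a)))|) :=
    ((tendsto_finsetSum _ fun s _ => tendsto_card_visitPairs hd ha k (n + s)).sub
      tendsto_const_nhds).abs
  have h2 : Tendsto (fun M : ℕ => (2 * L / (d : ℝ) ^ m + 24 * d ^ k + 4 * d ^ m) +
      ((n : ℝ) + L) * L * ((d : ℝ) ^ M)⁻¹) atTop
      (𝓝 ((2 * L / (d : ℝ) ^ m + 24 * d ^ k + 4 * d ^ m) + ((n : ℝ) + L) * L * 0)) :=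
    tendsto_const_nhds.add (hu.const_mul _)
  rw [mul_zero, add_zero] at h2
  refine le_of_tendsto_of_tendsto h1 h2 ?_
  filter_upwards [eventually_ge_atTop m, eventually_ge_atTop k] with M hm hk
  have h3 := abs_sum_card_visitPairs_sub_le hd (a := a)
    (fun j => by rcases ha j with h | h <;> omega) hm hk n L
  have hd0 : (d : ℝ) ≠ 0 := by positivity
  have hp : (0 : ℝ) < ((d : ℝ) ^ M)⁻¹ := by positivity
  rw [← Finset.sum_mul]
  have e : ((d : ℝ) ^ k)⁻¹ = d ^ (M - k) * ((d : ℝ) ^ M)⁻¹ := by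
    obtain ⟨N, rfl⟩ := Nat.exists_eq_add_of_le hk
    rw [Nat.add_sub_cancel_left, pow_add]
    field_simp
  rw [e, mul_right_comm, ← sub_mul, abs_mul, abs_of_pos hp]
  calc _ ≤ (d ^ M * (2 * L / d ^ m + 24 * d ^ k + 4 * d ^ m) + (n + L) * L) * ((d : ℝ) ^ M)⁻¹ := by
        gcongr
    _ = _ := by field_simp

lemma card_mul_abs_returnMeasure_sub_le {d : ℕ} (hd : 4 ≤ d) {a : ℕ → ℕ}
    (ha : ∀ j, a j = 1 ∨ a j = 2) {k n M₀ : ℕ} {G : Finset ℕ} (hG : ∀ j ∈ G, k ≤ j ∧ a j = 1)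
    {e : ℤ} (he : e = 1 ∨ e = -1)
    (h : ∀ M i r : ℕ, M₀ ≤ M → (visitTime d a M (i + r) = visitTime d a M i + n ∨
      visitTime d a M (i + r) = visitTime d a M i + (n + 1)) → ∀ j ∈ G, ∃ w : ℤ,
      w * d ^ (j + 1) + 2 * d ^ j ≤ e * r ∧ e * r ≤ w * d ^ (j + 1) + (d - 1) * d ^ j) :
    (G.card : ℝ) * |returnMeasure d k a n - returnMeasure d k a (n + 1)| ≤ 2 * d * √G.card := by
  have h1 := (((tendsto_card_visitPairs (by omega : 3 ≤ d) ha k n).sub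
    (tendsto_card_visitPairs (by omega : 3 ≤ d) ha k (n + 1))).abs.const_mul (G.card : ℝ))
  refine le_of_tendsto h1 ?_
  obtain ⟨Q, hQ⟩ := G.exists_nat_subset_range
  filter_upwards [eventually_ge_atTop M₀, eventually_ge_atTop Q] with M hM hMQ
  have hG' : ∀ j ∈ G, k ≤ j ∧ j < M ∧ a j = 1 := fun j hj =>
    ⟨(hG j hj).1, (Finset.mem_range.1 (hQ hj)).trans_le hMQ, (hG j hj).2⟩
  have hp : (0 : ℝ) < (d : ℝ) ^ M := by positivity
  have key : (G.card : ℝ) * |((visitPairs d k a M n).card : ℝ) -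
      (visitPairs d k a M ((n + 1 : ℕ) : ℤ)).card| ≤ d ^ M * (2 * d * √G.card) := by
    have hmono := (visitTime_strictMono d a M)
    rcases he with rfl | rfl
    · push_cast
      refine card_mul_abs_card_visitPairs_sub_le hd hG' fun p hp j hj => ?_
      rw [Finset.mem_union, mem_visitPairs, mem_visitPairs] at hp
      have hle : p.1 ≤ p.2 := hmono.le_iff_le.1 (by omega)
      obtain ⟨r, hr⟩ := Nat.exists_eq_add_of_le hle
      have := h M p.1 r hM (by rw [← hr]; omega) j hj
      rwa [show (1 : ℤ) * r = p.2 - p.1 by omega] at this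
    · have := card_mul_abs_card_visitPairs_sub_le hd hG' (n := -((n + 1 : ℕ) : ℤ)) (k := k)
        fun p hp j hj => by
          rw [Finset.mem_union, mem_visitPairs, mem_visitPairs] at hp
          have hle : p.2 ≤ p.1 := hmono.le_iff_le.1 (by omega)
          obtain ⟨r, hr⟩ := Nat.exists_eq_add_of_le hle
          have := h M p.2 r hM (by rw [← hr]; omega) j hj
          rwa [show (-1 : ℤ) * r = p.2 - p.1 by omega] at this
      rw [show (-((n + 1 : ℕ) : ℤ)) + 1 = -(n : ℤ) by push_cast; ring, card_visitPairs_neg,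
        card_visitPairs_neg, abs_sub_comm] at this
      exact this
  rw [← sub_mul, abs_mul, abs_of_pos (inv_pos.2 hp), ← mul_assoc, ← div_eq_mul_inv, div_le_iff₀ hp,
    mul_comm _ ((d : ℝ) ^ M)]
  exact key

/-- Reals whose first base-`d` digit is neither `0`, `1` nor `d - 1`. -/
def middleDigitSet (d : ℕ) : Set ℝ := {u | ∃ w : ℤ, (w : ℝ) + 2 / d < u ∧ u < w + 1 - 1 / d}

lemma isOpen_middleDigitSet (d : ℕ) : IsOpen (middleDigitSet d) := by
  have : middleDigitSet d = ⋃ w : ℤ, Set.Ioo ((w : ℝ) + 2 / d) (w + 1 - 1 / d) := by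
    ext u; simp [middleDigitSet]
  rw [this]
  exact isOpen_iUnion fun w => isOpen_Ioo

/-- If the digits of order `p ∈ P` of `e * τ / (1 + α')` are generic, the toggle estimate applies
at all the scales `M - 1 - p` with `α_{M-1-p} = 1`. -/
lemma eventually_card_mul_abs_returnMeasure_sub_le {d : ℕ} (hd : 4 ≤ d) {a : ℕ → ℕ}
    (ha : ∀ j, a j = 1 ∨ a j = 2) (k s : ℕ) {n M : ℕ → ℕ} (hM : Tendsto M atTop atTop) {τ : ℝ}
    (hτ : Tendsto (fun i => (n i : ℝ) / d ^ M i) atTop (𝓝 τ)) (P : Finset ℕ) {e : ℤ}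
    (he : e = 1 ∨ e = -1)
    (hP : ∀ p ∈ P, e * d ^ p * (τ / (1 + chaconSum d a)) ∈ middleDigitSet d) :
    ∀ᶠ i in atTop, (({p ∈ P | a (M i - 1 - p) = 1}).card : ℝ) *
      |returnMeasure d k a (n i + s) - returnMeasure d k a (n i + s + 1)| ≤
        2 * d * √({p ∈ P | a (M i - 1 - p) = 1}).card := by
  classical
  have ha2 : ∀ j, a j ≤ 2 := fun j => by rcases ha j with h | h <;> omega
  have hθ0 := chaconSum_nonneg d a
  set θ := 1 + chaconSum d a with hθ
  have hθ1 : 1 ≤ θ := by linarith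
  set y := τ / θ with hy
  have hopen : ∀ᶠ x in 𝓝 y, ∀ p ∈ P, (e : ℝ) * d ^ p * x ∈ middleDigitSet d := by
    rw [Filter.eventually_all_finset]
    intro p hp
    have hc : Continuous fun x : ℝ => (e : ℝ) * d ^ p * x := by fun_prop
    exact hc.continuousAt.eventually ((isOpen_middleDigitSet d).mem_nhds (hP p hp))
  obtain ⟨δ, hδ, hball⟩ := Metric.eventually_nhds_iff.1 hopen
  have hu := tendsto_inv_pow_atTop (by omega : 2 ≤ d)
  have huM := hu.comp hM
  obtain ⟨m, hm⟩ : ∃ m : ℕ, 2 * τ * ((d : ℝ) ^ m)⁻¹ < δ := by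
    have := hu.const_mul (2 * τ)
    rw [mul_zero] at this
    exact (this.eventually (gt_mem_nhds hδ)).exists
  set f : ℕ → ℝ := fun i => 2 * ((n i : ℝ) / d ^ M i + (s + 1) * ((d : ℝ) ^ M i)⁻¹) *
    ((d : ℝ) ^ m)⁻¹ + 4 * d ^ m * ((d : ℝ) ^ M i)⁻¹ + |(n i : ℝ) / d ^ M i - τ| +
    (s + 1) * ((d : ℝ) ^ M i)⁻¹ with hf
  have hflim : Tendsto f atTop (𝓝 (2 * (τ + (s + 1) * 0) * ((d : ℝ) ^ m)⁻¹ + 4 * d ^ m * 0 +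
      |τ - τ| + (s + 1) * 0)) :=
    (((((hτ.add (huM.const_mul _)).const_mul 2).mul_const _).add (huM.const_mul _)).add
      (hτ.sub_const τ).abs).add (huM.const_mul _)
  have hfδ : ∀ᶠ i in atTop, f i < δ := by
    refine hflim.eventually (gt_mem_nhds ?_)
    simpa using hm
  obtain ⟨Q, hQ⟩ := P.exists_nat_subset_range
  filter_upwards [hfδ, hM.eventually_ge_atTop (Q + 1 + k)] with i hi hMi
  set G := ({p ∈ P | a (M i - 1 - p) = 1}).image fun p => M i - 1 - p with hG
  have hPQ : ∀ p ∈ P, p < Q := fun p hp => Finset.mem_range.1 (hQ hp)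
  have hcard : G.card = ({p ∈ P | a (M i - 1 - p) = 1}).card := by
    refine Finset.card_image_of_injOn ?_
    intro p hp q hq hpq
    have h1 := hPQ p (Finset.mem_filter.1 hp).1
    have h2 := hPQ q (Finset.mem_filter.1 hq).1
    simp only at hpq
    omega
  rw [← hcard]
  refine card_mul_abs_returnMeasure_sub_le hd ha ?_ he (M₀ := m) ?_
  · intro j hj
    obtain ⟨p, hp, rfl⟩ := Finset.mem_image.1 hj
    have := hPQ p (Finset.mem_filter.1 hp).1
    exact ⟨by omega, (Finset.mem_filter.1 hp).2⟩
  · intro N l r hN hr j hj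
    obtain ⟨p, hp, rfl⟩ := Finset.mem_image.1 hj
    have hpP := (Finset.mem_filter.1 hp).1
    have hpQ := hPQ p hpP
    have hest := abs_visitTime_sub_le (by omega : 3 ≤ d) ha2 hN l r
    have hr1 : (r : ℝ) ≤ n i + s + 1 := by
      have := spacerTime_mono d a N (Nat.le_add_right l r)
      have : r ≤ n i + s + 1 := by unfold visitTime at hr; omega
      exact_mod_cast this
    obtain ⟨v, hv0, hv1, hv⟩ : ∃ v : ℝ, (n i : ℝ) ≤ v ∧ v ≤ n i + s + 1 ∧
        (visitTime d a N (l + r) : ℝ) - visitTime d a N l = v := by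
      rcases hr with h | h
      · refine ⟨(n i + s : ℕ), by push_cast; linarith, by push_cast; linarith, by rw [h]; push_cast; ring⟩
      · refine ⟨(n i + s + 1 : ℕ), by push_cast; linarith, by push_cast; linarith, by rw [h]; push_cast; ring⟩
    rw [hv, ← hθ] at hest
    have hD : (0 : ℝ) < (d : ℝ) ^ M i := by positivity
    set D := (d : ℝ) ^ M i
    have hclose : dist ((r : ℝ) / D) y < δ := by
      refine lt_of_le_of_lt ?_ hi
      have e1 : (r : ℝ) / D - y = (r * θ / D - τ) / θ := by
        rw [hy]; field_simp
      rw [Real.dist_eq, e1, abs_div, abs_of_pos (by linarith : 0 < θ)]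
      refine (div_le_self (abs_nonneg _) hθ1).trans ?_
      have e2 : (r : ℝ) * θ / D - τ = -((v - r * θ) * D⁻¹) + ((n i : ℝ) / D - τ) + (v - n i) * D⁻¹ := by
        field_simp; ring
      have hDi : 0 < D⁻¹ := inv_pos.2 hD
      have e3 : |(v - r * θ) * D⁻¹| ≤ (2 * (n i + s + 1) / d ^ m + 4 * d ^ m) * D⁻¹ := by
        rw [abs_mul, abs_of_pos hDi]
        gcongr
        refine hest.trans ?_
        gcongr
      have e4 : |(v - n i) * D⁻¹| ≤ (s + 1) * D⁻¹ := by
        rw [abs_mul, abs_of_pos hDi, abs_of_nonneg (by linarith)]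
        gcongr
        linarith
      rw [e2]
      refine (abs_add_le _ _).trans ?_
      refine (add_le_add_left (abs_add_le _ _) _).trans ?_
      rw [abs_neg]
      have e5 : (2 * (n i + s + 1) / (d : ℝ) ^ m + 4 * d ^ m) * D⁻¹ =
        2 * ((n i : ℝ) / D + (s + 1) * D⁻¹) * ((d : ℝ) ^ m)⁻¹ + 4 * d ^ m * D⁻¹ := by
        field_simp; ring
      rw [e5] at e3
      simp only [hf]
      linarith
    obtain ⟨w, hw1, hw2⟩ := hball hclose p hpP
    refine ⟨w, ?_⟩
    obtain ⟨N', hN'⟩ : ∃ N', M i = N' + 1 + p := ⟨M i - 1 - p, by omega⟩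
    rw [show M i - 1 - p = N' by omega]
    have hd0 : (0 : ℝ) < d := by positivity
    have e1 : (e : ℝ) * d ^ p * (r / D) = e * r / d ^ (N' + 1) := by
      simp only [D]
      rw [hN', pow_add]
      field_simp
    rw [e1] at hw1 hw2
    have hp0 : (0 : ℝ) < d ^ (N' + 1) := by positivity
    rw [lt_div_iff₀ hp0] at hw1
    rw [div_lt_iff₀ hp0] at hw2
    have e2 : ((w : ℝ) + 2 / d) * d ^ (N' + 1) = w * d ^ (N' + 1) + 2 * d ^ N' := by
      rw [pow_succ]; field_simp
    have e3 : ((w : ℝ) + 1 - 1 / d) * d ^ (N' + 1) = w * d ^ (N' + 1) + (d - 1) * d ^ N' := by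
      rw [pow_succ]; field_simp; ring
    rw [e2] at hw1
    rw [e3] at hw2
    exact ⟨by exact_mod_cast hw1.le, by exact_mod_cast hw2.le⟩

lemma measurable_nat_sInf {X : Type*} [MeasurableSpace X] {P : ℕ → X → Prop}
    (hP : ∀ n, MeasurableSet {x | P n x}) : Measurable fun x => sInf {n | P n x} := by
  classical
  refine measurable_to_countable' fun n => ?_
  have : (fun x => sInf {n | P n x}) ⁻¹' {n} =
      ({x | P n x} ∩ ⋂ m ∈ Set.Iio n, {x | P m x}ᶜ) ∪ (if n = 0 then ⋂ m, {x | P m x}ᶜ else ∅) := by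
    ext x
    simp only [Set.mem_preimage, Set.mem_singleton_iff, Set.mem_union, Set.mem_inter_iff,
      Set.mem_iInter, Set.mem_compl_iff, Set.mem_Iio, Set.mem_ofPred_eq]
    constructor
    · rintro rfl
      rcases Set.eq_empty_or_nonempty {n | P n x} with h | h
      · right
        rw [h]
        simp only [Nat.sInf_empty, if_true, Set.mem_iInter, Set.mem_compl_iff]
        intro m hm
        exact (Set.ext_iff.1 h m).1 hm
      · exact Or.inl ⟨Nat.sInf_mem h, fun m hm => Nat.notMem_of_lt_sInf hm⟩
    · rintro (⟨h1, h2⟩ | h)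
      · refine le_antisymm (Nat.sInf_le h1) (le_of_not_gt fun hlt => ?_)
        exact h2 _ hlt (Nat.sInf_mem (s := {n | P n x}) ⟨n, h1⟩)
      · split_ifs at h with h0
        · simp only [Set.mem_iInter, Set.mem_compl_iff] at h
          have : {n | P n x} = ∅ := Set.eq_empty_of_forall_notMem h
          rw [this, h0, Nat.sInf_empty]
        · exact h.elim
  rw [this]
  refine ((hP n).inter (MeasurableSet.biInter (Set.to_countable _) fun m _ => (hP m).compl)).union ?_
  split_ifs
  · exact MeasurableSet.iInter fun m => (hP m).compl
  · exact MeasurableSet.empty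

lemma measurable_chaconPartial (d m : ℕ) : Measurable fun a => chaconPartial d a m := by
  unfold chaconPartial
  fun_prop

lemma measurable_chaconSum (d : ℕ) : Measurable (chaconSum d) := by
  have : chaconSum d = fun a => (∑' j : ℕ, ENNReal.ofReal ((a j : ℝ) * (d : ℝ) ^ (-(j : ℤ) - 1))).toReal := by
    ext a
    rw [ENNReal.tsum_toReal_eq fun _ => ENNReal.ofReal_ne_top, chaconSum]
    congr 1; ext j
    rw [ENNReal.toReal_ofReal (by positivity)]
  rw [this]
  refine (Measurable.tsum fun j => ?_).ennreal_toReal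
  fun_prop

lemma measurable_chaconIndex (d : ℕ) :
    Measurable fun q : (ℕ → ℕ) × ℝ => chaconIndex d q.1 q.2 := by
  unfold chaconIndex
  refine Measurable.ite (measurableSet_lt measurable_snd measurable_const) ?_ ?_
  · exact measurable_nat_sInf fun n => measurableSet_lt measurable_snd measurable_const
  · exact measurable_nat_sInf fun n => measurableSet_lt measurable_snd
      (((measurable_chaconPartial d (n + 1)).comp measurable_fst).const_add 1)

lemma measurable_chaconMap (d : ℕ) :
    Measurable fun q : (ℕ → ℕ) × ℝ => chaconMap d q.1 q.2 := by
  have hI := measurable_chaconIndex d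
  have hpow (j : ℕ → ℤ) : Measurable fun q : (ℕ → ℕ) × ℝ => (d : ℝ) ^ j (chaconIndex d q.1 q.2) :=
    (measurable_from_nat (f := fun n => (d : ℝ) ^ j n)).comp hI
  have hpart (i : ℕ) : Measurable fun q : (ℕ → ℕ) × ℝ =>
      chaconPartial d q.1 (chaconIndex d q.1 q.2 + i) := by
    have : Measurable fun q : ((ℕ → ℕ) × ℝ) × ℕ => chaconPartial d q.1.1 (q.2 + i) :=
      measurable_from_prod_countable_left fun n =>
        (measurable_chaconPartial d (n + i)).comp measurable_fst
    exact this.comp (measurable_id.prodMk hI)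
  have h1 := hpow fun n => -(n : ℤ) - 1
  have h0 := hpow fun n => -(n : ℤ)
  have hp0 := hpart 0
  simp only [add_zero] at hp0
  have hp1 := hpart 1
  unfold chaconMap
  refine Measurable.ite (measurableSet_lt measurable_snd measurable_const) ?_ ?_
  · refine Measurable.ite (measurableSet_lt measurable_snd ?_) ?_ ?_
    · exact (h1.const_mul 2).const_sub 1
    · exact (measurable_snd.sub (h0.const_sub 1)).add h1
    · exact (measurable_snd.add (h1.const_mul 2)).add hp0
  · have h2 := (hp1.const_add 1).sub h1
    refine Measurable.ite (measurableSet_le h2 measurable_snd) ?_ ?_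
    · exact (measurable_snd.sub h2).add (h1.const_mul _)
    · exact measurable_snd.add h1

lemma measurable_chaconSkew (d : ℕ) : Measurable (chaconSkew d) := by
  refine measurable_fst.prodMk (Measurable.ite ?_ (measurable_chaconMap d) measurable_snd)
  exact (measurableSet_le measurable_const measurable_snd).inter
    (measurableSet_lt measurable_snd (((measurable_chaconSum d).comp measurable_fst).const_add 1))

lemma measurableSet_skewReturn (d k n : ℕ) : MeasurableSet
    {q : (ℕ → ℕ) × ℝ | q.2 ∈ returnSet d k q.1 n} := by
  have : {q : (ℕ → ℕ) × ℝ | q.2 ∈ returnSet d k q.1 n} =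
      {q | q.2 ∈ Set.Ico 0 ((d : ℝ) ^ k)⁻¹} ∩
      (chaconSkew d)^[n] ⁻¹' {q | q.2 ∈ Set.Ico 0 ((d : ℝ) ^ k)⁻¹} := by
    ext ⟨a, x⟩
    simp [returnSet, chaconSkew_iterate]
  rw [this]
  have h : MeasurableSet {q : (ℕ → ℕ) × ℝ | q.2 ∈ Set.Ico 0 ((d : ℝ) ^ k)⁻¹} :=
    measurable_snd measurableSet_Ico
  exact h.inter ((measurable_chaconSkew d).iterate n h)

lemma measurable_returnMeasure (d k n : ℕ) : Measurable fun a => returnMeasure d k a n :=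
  (measurable_measure_prodMk_left (measurableSet_skewReturn d k n)).ennreal_toReal

lemma returnMeasure_nonneg (d k n : ℕ) (a : ℕ → ℕ) : 0 ≤ returnMeasure d k a n :=
  ENNReal.toReal_nonneg

lemma volume_returnSet_le (d k n : ℕ) (a : ℕ → ℕ) :
    volume (returnSet d k a n) ≤ ENNReal.ofReal ((d : ℝ) ^ k)⁻¹ := by
  have := measure_mono (μ := volume) (fun x hx => hx.1 : returnSet d k a n ⊆ Set.Ico 0 ((d : ℝ) ^ k)⁻¹)
  rwa [Real.volume_Ico, sub_zero] at this

lemma returnMeasure_le_one {d : ℕ} (hd : 1 ≤ d) (k n : ℕ) (a : ℕ → ℕ) :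
    returnMeasure d k a n ≤ 1 := by
  refine ENNReal.toReal_le_of_le_ofReal zero_le_one ((volume_returnSet_le d k n a).trans ?_)
  exact ENNReal.ofReal_le_ofReal (inv_le_one_of_one_le₀ (one_le_pow₀ (by exact_mod_cast hd)))

lemma lebAlpha_returnSet {d : ℕ} (hd : 1 ≤ d) (k n : ℕ) (a : ℕ → ℕ) :
    lebAlpha d a (returnSet d k a n) =
      ENNReal.ofReal (returnMeasure d k a n / (1 + chaconSum d a)) := by
  have h0 := chaconSum_nonneg d a
  have hsub : returnSet d k a n ∩ Set.Ico 0 (1 + chaconSum d a) = returnSet d k a n := by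
    refine Set.inter_eq_left.2 fun x hx => ⟨hx.1.1, hx.1.2.trans_le ?_⟩
    have : ((d : ℝ) ^ k)⁻¹ ≤ 1 := inv_le_one_of_one_le₀ (one_le_pow₀ (by exact_mod_cast hd))
    linarith
  rw [lebAlpha, Measure.smul_apply, Measure.restrict_apply' measurableSet_Ico, hsub, smul_eq_mul,
    ENNReal.ofReal_div_of_pos (by linarith), returnMeasure, ENNReal.ofReal_toReal, div_eq_mul_inv,
    mul_comm]
  exact ((volume_returnSet_le d k n a).trans_lt ENNReal.ofReal_lt_top).ne

/-- The correlations of a cylinder disintegrate into the fibrewise return measures. -/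
lemma toReal_measure_inter_preimage {d : ℕ} (hd : 1 ≤ d) {H : Measure (ℕ → ℕ)}
    {μ : Measure ((ℕ → ℕ) × ℝ)} (hμ : ∀ E : Set ((ℕ → ℕ) × ℝ), MeasurableSet E →
      μ E = ∫⁻ a, lebAlpha d a {x : ℝ | (a, x) ∈ E} ∂H)
    (k n : ℕ) {B : Set (ℕ → ℕ)} (hB : MeasurableSet B) :
    (μ ((B ×ˢ Set.Ico (0 : ℝ) ((d : ℝ) ^ (-(k : ℤ)))) ∩
      (chaconSkew d)^[n] ⁻¹' (B ×ˢ Set.Ico (0 : ℝ) ((d : ℝ) ^ (-(k : ℤ)))))).toReal =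
    ∫ a in B, returnMeasure d k a n / (1 + chaconSum d a) ∂H := by
  have hpow : (d : ℝ) ^ (-(k : ℤ)) = ((d : ℝ) ^ k)⁻¹ := by rw [zpow_neg, zpow_natCast]
  have hm : MeasurableSet (B ×ˢ Set.Ico (0 : ℝ) ((d : ℝ) ^ k)⁻¹) := hB.prod measurableSet_Ico
  rw [hpow, hμ _ (hm.inter ((measurable_chaconSkew d).iterate n hm)),
    integral_eq_lintegral_of_nonneg_ae, ← lintegral_indicator hB]
  · congr 2
    ext a
    by_cases ha : a ∈ B
    · rw [Set.indicator_of_mem ha, ← lebAlpha_returnSet hd]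
      congr 1
      ext x
      simp [ha, returnSet, chaconSkew_iterate]
    · simp [ha]
  · exact ae_of_all _ fun a => div_nonneg (returnMeasure_nonneg d k n a)
      (by have := chaconSum_nonneg d a; positivity)
  · exact ((measurable_returnMeasure d k n).div
      ((measurable_chaconSum d).const_add 1)).aestronglyMeasurable

/-- The probability of every cylinder over a set `s` of coordinates with values in `{1, 2}` is
`2 ^ (-#s)`. -/
def HasUniformCylinders (H : Measure (ℕ → ℕ)) : Prop :=
  ∀ (s : Finset ℕ) (f : ℕ → ℕ), (∀ i ∈ s, f i = 1 ∨ f i = 2) →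
    H {a | ∀ i ∈ s, a i = f i} = (1 / 2 : ENNReal) ^ s.card

lemma measurableSet_cylinder (s : Finset ℕ) (f : ℕ → ℕ) :
    MeasurableSet {a : ℕ → ℕ | ∀ i ∈ s, a i = f i} := by
  have : {a : ℕ → ℕ | ∀ i ∈ s, a i = f i} = ⋂ i ∈ s, {a | a i = f i} := by ext; simp
  rw [this]
  exact Finset.measurableSet_biInter s fun i _ => measurable_pi_apply i (measurableSet_singleton _)

/-- The cylinder sets of `ℕ → ℕ`. -/
def cylinderSets : Set (Set (ℕ → ℕ)) := {S | ∃ (s : Finset ℕ) (f : ℕ → ℕ), S = {a | ∀ i ∈ s, a i = f i}}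

lemma isPiSystem_cylinderSets : IsPiSystem cylinderSets := by
  rintro _ ⟨s, f, rfl⟩ _ ⟨t, g, rfl⟩ ⟨b, hb1, hb2⟩
  refine ⟨s ∪ t, b, ?_⟩
  ext a
  simp only [Set.mem_inter_iff, Set.mem_ofPred_eq, Finset.mem_union] at *
  constructor
  · rintro ⟨h1, h2⟩ i (hi | hi)
    · rw [h1 i hi, hb1 i hi]
    · rw [h2 i hi, hb2 i hi]
  · intro h
    exact ⟨fun i hi => by rw [h i (Or.inl hi), hb1 i hi], fun i hi => by rw [h i (Or.inr hi), hb2 i hi]⟩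

lemma pi_eq_generateFrom_cylinderSets :
    (inferInstance : MeasurableSpace (ℕ → ℕ)) = MeasurableSpace.generateFrom cylinderSets := by
  refine le_antisymm ?_ (MeasurableSpace.generateFrom_le ?_)
  · refine iSup_le fun i => ?_
    rw [MeasurableSpace.comap_le_iff_le_map]
    intro S _
    change MeasurableSet[MeasurableSpace.generateFrom cylinderSets] ((fun a : ℕ → ℕ => a i) ⁻¹' S)
    have : (fun a : ℕ → ℕ => a i) ⁻¹' S =
        ⋃ n ∈ S, {a : ℕ → ℕ | ∀ j ∈ ({i} : Finset ℕ), a j = (fun _ => n) j} := by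
      ext a; simp
    rw [this]
    exact MeasurableSet.biUnion (Set.to_countable S) fun n _ =>
      MeasurableSpace.measurableSet_generateFrom ⟨{i}, fun _ => n, rfl⟩
  · rintro _ ⟨s, f, rfl⟩
    exact measurableSet_cylinder s f

/-- Exchange the values `1` and `2` at all coordinates in `A`. -/
def flipAt (A : Finset ℕ) (a : ℕ → ℕ) : ℕ → ℕ := fun i => if i ∈ A then 3 - a i else a i

lemma measurable_flipAt (A : Finset ℕ) : Measurable (flipAt A) := by
  refine measurable_pi_lambda _ fun i => ?_
  unfold flipAt
  split_ifs
  · exact (measurable_from_nat (f := fun n => 3 - n)).comp (measurable_pi_apply i)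
  · exact measurable_pi_apply i

lemma flipAt_eq_one_or_two {A : Finset ℕ} {a : ℕ → ℕ} (ha : ∀ j, a j = 1 ∨ a j = 2) (j : ℕ) :
    flipAt A a j = 1 ∨ flipAt A a j = 2 := by
  have := ha j
  unfold flipAt
  split_ifs <;> omega

section FlipInvariance

variable {H : Measure (ℕ → ℕ)} [IsProbabilityMeasure H]

lemma HasUniformCylinders.ae_eq_one_or_two (hH : HasUniformCylinders H) :
    ∀ᵐ a ∂H, ∀ i, a i = 1 ∨ a i = 2 := by
  rw [ae_all_iff]
  intro i
  have h (n : ℕ) (hn : n = 1 ∨ n = 2) : H {a | a i = n} = 1 / 2 := by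
    simpa using hH {i} (fun _ => n) (by simpa using hn)
  have hm (n : ℕ) : MeasurableSet {a : ℕ → ℕ | a i = n} :=
    measurable_pi_apply i (measurableSet_singleton _)
  have hu : H ({a | a i = 1} ∪ {a | a i = 2}) = 1 := by
    rw [measure_union _ (hm 2), h 1 (Or.inl rfl), h 2 (Or.inr rfl), ENNReal.add_halves]
    rw [Set.disjoint_left]
    intro a h1 h2
    simp only [Set.mem_ofPred_eq] at h1 h2
    omega
  exact (prob_compl_eq_zero_iff ((hm 1).union (hm 2))).2 hu

lemma HasUniformCylinders.measurePreserving_flipAt (hH : HasUniformCylinders H) (A : Finset ℕ) :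
    MeasurePreserving (flipAt A) H H := by
  have hA := measurable_flipAt A
  refine ⟨hA, ?_⟩
  have : IsProbabilityMeasure (H.map (flipAt A)) := Measure.isProbabilityMeasure_map hA.aemeasurable
  refine ext_of_generate_finite cylinderSets pi_eq_generateFrom_cylinderSets isPiSystem_cylinderSets
    ?_ (by simp)
  rintro _ ⟨s, f, rfl⟩
  rw [Measure.map_apply hA (measurableSet_cylinder s f)]
  by_cases hf : ∀ i ∈ s, f i = 1 ∨ f i = 2
  · rw [hH s f hf, ← hH s (flipAt A f)]
    · refine measure_congr ?_
      filter_upwards [hH.ae_eq_one_or_two] with a ha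
      refine propext (forall₂_congr fun i hi => ?_)
      have h1 := ha i
      have h2 := hf i hi
      unfold flipAt
      split_ifs <;> omega
    · intro i hi
      have h2 := hf i hi
      unfold flipAt
      split_ifs <;> omega
  · push Not at hf
    obtain ⟨i, hi, hf⟩ := hf
    have h0 (T : (ℕ → ℕ) → ℕ → ℕ) (hT : ∀ a, (∀ j, a j = 1 ∨ a j = 2) → T a i = 1 ∨ T a i = 2) :
        H {a | ∀ j ∈ s, T a j = f j} = 0 := by
      rw [← compl_compl {a | ∀ j ∈ s, T a j = f j}]
      refine mem_ae_iff.1 ?_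
      filter_upwards [hH.ae_eq_one_or_two] with a ha h
      have h1 := hT a ha
      have h2 := h i hi
      omega
    rw [h0 (fun a => a) fun a ha => ha i]
    exact h0 (flipAt A) fun a ha => flipAt_eq_one_or_two ha i

/-- Flipping far away coordinates moves a measurable set by very little. -/
lemma HasUniformCylinders.tendsto_measureReal_symmDiff_flipAt (hH : HasUniformCylinders H)
    {ι : Type*} {l : Filter ι} {A : ι → Finset ℕ} (hA : ∀ m, ∀ᶠ i in l, ∀ j ∈ A i, m ≤ j)
    {E : Set (ℕ → ℕ)} (hE : MeasurableSet E) :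
    Tendsto (fun i => H.real (symmDiff E (flipAt (A i) ⁻¹' E))) l (𝓝 0) := by
  induction E, hE using MeasurableSpace.induction_on_inter
    pi_eq_generateFrom_cylinderSets isPiSystem_cylinderSets with
  | empty => simpa using tendsto_const_nhds
  | basic S hS =>
    obtain ⟨s, f, rfl⟩ := hS
    refine tendsto_const_nhds.congr' ?_
    filter_upwards [hA (s.sup id + 1)] with i hi
    have : flipAt (A i) ⁻¹' {a | ∀ j ∈ s, a j = f j} = {a | ∀ j ∈ s, a j = f j} := by
      ext a
      refine forall₂_congr fun j hj => ?_
      have h1 : j ≤ s.sup id := Finset.le_sup (f := id) hj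
      have h2 : j ∉ A i := fun h => by have := hi j h; omega
      simp [flipAt, h2]
    rw [this, symmDiff_self]
    simp
  | compl S hS ih =>
    simpa only [Set.preimage_compl, compl_symmDiff_compl] using ih
  | iUnion f hd hm ih =>
    have hsum : Summable fun n => H.real (f n) :=
      (ENNReal.summable_toReal (by
        rw [← measure_iUnion hd hm]; exact measure_ne_top _ _))
    have hmp (i) := hH.measurePreserving_flipAt (A i)
    have hbound (i n) : H.real (symmDiff (f n) (flipAt (A i) ⁻¹' f n)) ≤ 2 * H.real (f n) := by
      refine (measureReal_mono (Set.symmDiff_subset_union)).trans ?_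
      refine (measureReal_union_le _ _).trans ?_
      rw [(hmp i).measureReal_preimage (hm n).nullMeasurableSet]
      linarith
    have hT := tendsto_tsum_of_dominated_convergence (𝓕 := l)
      (f := fun i n => H.real (symmDiff (f n) (flipAt (A i) ⁻¹' f n))) (g := fun _ => 0)
      (hsum.mul_left 2) (fun n => ih n)
      (Eventually.of_forall fun i n => by
        rw [Real.norm_of_nonneg measureReal_nonneg]; exact hbound i n)
    rw [tsum_zero] at hT
    refine squeeze_zero (fun _ => measureReal_nonneg) (fun i => ?_) hT
    have hs : Summable fun n => H.real (symmDiff (f n) (flipAt (A i) ⁻¹' f n)) :=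
      Summable.of_nonneg_of_le (fun _ => measureReal_nonneg) (hbound i) (hsum.mul_left 2)
    have hsub : symmDiff (⋃ n, f n) (flipAt (A i) ⁻¹' ⋃ n, f n) ⊆
        ⋃ n, symmDiff (f n) (flipAt (A i) ⁻¹' f n) := by
      rw [Set.preimage_iUnion]
      intro a ha
      simp only [Set.mem_symmDiff, Set.mem_iUnion, not_exists] at ha ⊢
      rcases ha with ⟨⟨n, h1⟩, h2⟩ | ⟨⟨n, h1⟩, h2⟩
      · exact ⟨n, Or.inl ⟨h1, h2 n⟩⟩
      · exact ⟨n, Or.inr ⟨h1, h2 n⟩⟩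
    have h1 := (measure_mono hsub).trans (measure_iUnion_le (μ := H) _)
    rw [Measure.real]
    refine ENNReal.toReal_le_of_le_ofReal (tsum_nonneg fun _ => measureReal_nonneg) (h1.trans ?_)
    rw [ENNReal.ofReal_tsum_of_nonneg (fun _ => measureReal_nonneg) hs]
    refine ENNReal.tsum_le_tsum fun n => ?_
    rw [ofReal_measureReal]

/-- Almost every point of `E` stays in `E` after flipping arbitrary coordinates in a suitable window
of length `t`, arbitrarily far away. -/
lemma HasUniformCylinders.ae_frequently_flipAt_mem (hH : HasUniformCylinders H)
    {E : Set (ℕ → ℕ)} (hE : MeasurableSet E) (t : ℕ) :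
    ∀ᵐ a ∂H, a ∈ E → ∃ᶠ s in atTop, ∀ A ⊆ Finset.range t,
      flipAt (A.map (addLeftEmbedding s)) a ∈ E := by
  set bad : ℕ → Set (ℕ → ℕ) := fun s =>
    ⋃ A ∈ (Finset.range t).powerset, symmDiff E (flipAt (A.map (addLeftEmbedding s)) ⁻¹' E) with hbad
  have hlim : Tendsto (fun s => H.real (bad s)) atTop (𝓝 0) := by
    have h0 : Tendsto (fun s => ∑ A ∈ (Finset.range t).powerset,
        H.real (symmDiff E (flipAt (A.map (addLeftEmbedding s)) ⁻¹' E))) atTop (𝓝 0) := by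
      rw [← Finset.sum_const_zero (s := (Finset.range t).powerset) (M := ℝ)]
      refine tendsto_finsetSum _ fun A _ => hH.tendsto_measureReal_symmDiff_flipAt ?_ hE
      intro m
      filter_upwards [eventually_ge_atTop m] with s hs j hj
      obtain ⟨i, _, rfl⟩ := Finset.mem_map.1 hj
      simp only [addLeftEmbedding_apply]
      omega
    exact squeeze_zero (fun _ => measureReal_nonneg) (fun s => measureReal_biUnion_finset_le _ _) h0
  have hz (m : ℕ) : H (⋂ s ∈ Set.Ici m, bad s) = 0 := by
    have : H.real (⋂ s ∈ Set.Ici m, bad s) ≤ 0 := by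
      refine ge_of_tendsto hlim ?_
      filter_upwards [eventually_ge_atTop m] with s hs
      exact measureReal_mono (Set.biInter_subset_of_mem hs) (measure_ne_top _ _)
    exact (measureReal_eq_zero_iff).1 (le_antisymm this measureReal_nonneg)
  have hz' := measure_iUnion_null hz
  filter_upwards [compl_mem_ae_iff.2 hz'] with a ha haE
  by_contra hcon
  rw [not_frequently, eventually_atTop] at hcon
  obtain ⟨m, hm⟩ := hcon
  refine ha (Set.mem_iUnion.2 ⟨m, Set.mem_iInter₂.2 fun s hs => ?_⟩)
  have := hm s hs
  push Not at this
  obtain ⟨A, hA, hAE⟩ := this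
  exact Set.mem_iUnion₂.2 ⟨A, Finset.mem_powerset.2 hA, Or.inl ⟨haE, hAE⟩⟩

end FlipInvariance

lemma chaconSum_flipAt {d : ℕ} (hd : 2 ≤ d) {a : ℕ → ℕ} (ha : ∀ j, a j = 1 ∨ a j = 2)
    (A : Finset ℕ) : chaconSum d (flipAt A a) =
      chaconSum d a + ∑ i ∈ A, (3 - 2 * (a i : ℝ)) * ((d : ℝ) ^ (i + 1))⁻¹ := by
  have h1 := summable_chaconSum hd (a := a) fun j => by have := ha j; omega
  have h2 := summable_chaconSum hd (a := flipAt A a) fun j => by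
    have := flipAt_eq_one_or_two (A := A) ha j; omega
  have h3 : chaconSum d (flipAt A a) - chaconSum d a =
      ∑ i ∈ A, (3 - 2 * (a i : ℝ)) * ((d : ℝ) ^ (i + 1))⁻¹ := by
    rw [chaconSum, chaconSum, ← h2.tsum_sub h1, tsum_eq_sum (s := A)]
    · refine Finset.sum_congr rfl fun i hi => ?_
      rw [zpow_neg_sub_one, ← sub_mul]
      congr 1
      simp only [flipAt, hi, if_true]
      rcases ha i with h | h <;> rw [h] <;> norm_num
    · intro i hi
      simp [flipAt, hi]
  linarith

/-- Numbers whose subset sums all stay within `1 / 3` of an integer have small total residue. -/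
lemma sum_abs_sub_round_le {t : ℕ} {v : ℕ → ℝ}
    (h : ∀ A ⊆ Finset.range t, ∃ w : ℤ, |(∑ i ∈ A, v i) - w| < 1 / 3) :
    ∑ i ∈ Finset.range t, |v i - round (v i)| ≤ 2 / 3 := by
  have hsum : ∀ A ⊆ Finset.range t, |∑ i ∈ A, (v i - round (v i))| < 1 / 3 := by
    intro A
    induction A using Finset.induction_on with
    | empty => simp
    | insert b A hb ih =>
      intro hA
      have hA' := (Finset.subset_insert b A).trans hA
      have h1 := ih hA'
      have h2 : |v b - round (v b)| < 1 / 3 := by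
        obtain ⟨w, hw⟩ := h {b} (by
          intro x hx
          exact hA (by simp only [Finset.mem_singleton] at hx; simp [hx]))
        rw [Finset.sum_singleton] at hw
        exact (round_le (v b) w).trans_lt hw
      obtain ⟨w, hw⟩ := h _ hA
      rw [Finset.sum_insert hb] at hw ⊢
      set S := ∑ i ∈ A, (v i - round (v i)) with hS
      have hv : ∑ i ∈ A, v i = S + (∑ i ∈ A, round (v i) : ℤ) := by
        rw [hS, Finset.sum_sub_distrib]; push_cast; ring
      rw [hv] at hw
      obtain ⟨u, hu⟩ : ∃ u : ℤ, u = w - ∑ i ∈ A, round (v i) - round (v b) := ⟨_, rfl⟩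
      have hu' : (u : ℝ) = w - (∑ i ∈ A, round (v i) : ℤ) - round (v b) := by
        rw [hu]; push_cast; ring
      have h3 : |v b - round (v b) + S - u| < 1 / 3 := by
        rw [hu']; convert hw using 2; ring
      rw [abs_lt] at *
      have hu0 : u = 0 := by
        have hlt : (u : ℝ) < 1 := by linarith
        have hgt : (-1 : ℝ) < u := by linarith
        have hlt' : u < 1 := by exact_mod_cast hlt
        have hgt' : -1 < u := by exact_mod_cast hgt
        omega
      rw [hu0] at h3
      push_cast at h3
      constructor <;> linarith
  have hp := hsum ({i ∈ Finset.range t | 0 ≤ v i - round (v i)}) (Finset.filter_subset _ _)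
  have hn := hsum ({i ∈ Finset.range t | ¬ 0 ≤ v i - round (v i)}) (Finset.filter_subset _ _)
  rw [← Finset.sum_filter_add_sum_filter_not (Finset.range t) (fun i => 0 ≤ v i - round (v i))]
  rw [Finset.sum_congr rfl (g := fun i => v i - round (v i)) fun i hi =>
      abs_of_nonneg (Finset.mem_filter.1 hi).2,
    Finset.sum_congr (s₁ := {i ∈ Finset.range t | ¬ 0 ≤ v i - round (v i)}) rfl
      (g := fun i => -(v i - round (v i))) fun i hi =>
      abs_of_neg (not_le.1 (Finset.mem_filter.1 hi).2), Finset.sum_neg_distrib]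
  rw [abs_lt] at hp hn
  linarith

/-- If the distances of `c * d ^ b` to the integers tend to zero then `c * d ^ b` is an integer for
some `b`. -/
lemma exists_mul_pow_eq_intCast {d : ℕ} (hd : 2 ≤ d) {c : ℝ}
    (h : Tendsto (fun b : ℕ => |c * d ^ b - round (c * d ^ b)|) atTop (𝓝 0)) :
    ∃ (b : ℕ) (z : ℤ), c * d ^ b = z := by
  have hd0 : (2 : ℝ) ≤ d := by exact_mod_cast hd
  obtain ⟨b₀, hb₀⟩ := eventually_atTop.1 (h.eventually_lt_const (show (0 : ℝ) < 1 / (d + 1) by positivity))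
  set r : ℕ → ℝ := fun b => c * d ^ b - round (c * d ^ b) with hr
  have hstep : ∀ b ≥ b₀, r (b + 1) = d * r b := by
    intro b hb
    have h1 := hb₀ b hb
    have h2 := hb₀ (b + 1) (by omega)
    have h3 : |(d : ℝ) * r b - r (b + 1)| < 1 := by
      calc |(d : ℝ) * r b - r (b + 1)| ≤ |(d : ℝ) * r b| + |r (b + 1)| := abs_sub _ _
        _ = d * |r b| + |r (b + 1)| := by rw [abs_mul, abs_of_nonneg (by linarith)]
        _ < d * (1 / (d + 1)) + 1 / (d + 1) := by
          have : (d : ℝ) * |r b| < d * (1 / (d + 1)) := by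
            exact mul_lt_mul_of_pos_left h1 (by linarith)
          linarith
        _ = 1 := by field_simp
    have h4 : (d : ℝ) * r b - r (b + 1) = ((round (c * (d : ℝ) ^ (b + 1)) - d * round (c * (d : ℝ) ^ b) : ℤ) : ℝ) := by
      simp only [hr]; push_cast; ring
    rw [h4] at h3
    have h5 : (round (c * (d : ℝ) ^ (b + 1)) - d * round (c * (d : ℝ) ^ b) : ℤ) = 0 := by
      rw [← Int.cast_abs] at h3
      exact Int.abs_lt_one_iff.1 (by exact_mod_cast h3)
    rw [h5] at h4
    push_cast at h4
    linarith
  have hpow (m : ℕ) : r (b₀ + m) = d ^ m * r b₀ := by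
    induction m with
    | zero => simp
    | succ m ih => rw [← add_assoc, hstep _ (by omega), ih]; ring
  have hle : |r b₀| ≤ 0 := by
    refine ge_of_tendsto h ?_
    filter_upwards [eventually_ge_atTop b₀] with b hb
    obtain ⟨m, rfl⟩ := Nat.exists_eq_add_of_le hb
    change |r b₀| ≤ |r (b₀ + m)|
    rw [hpow, abs_mul, abs_pow, Nat.abs_cast]
    exact le_mul_of_one_le_left (abs_nonneg _) (one_le_pow₀ (show (1 : ℝ) ≤ d by linarith))
  refine ⟨b₀, round (c * (d : ℝ) ^ b₀), ?_⟩
  have := abs_nonpos_iff.1 hle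
  simp only [hr] at this
  linarith

section FlipInvariance

variable {H : Measure (ℕ → ℕ)} [IsProbabilityMeasure H]

lemma HasUniformCylinders.ae_chaconSum_ne (hH : HasUniformCylinders H) {d : ℕ} (hd : 2 ≤ d) (v : ℝ) :
    ∀ᵐ a ∂H, chaconSum d a ≠ v := by
  filter_upwards [hH.ae_eq_one_or_two, hH.ae_frequently_flipAt_mem
    (measurable_chaconSum d (measurableSet_singleton v)) 1] with a ha hfr hv
  obtain ⟨s, hs⟩ := (hfr hv).exists
  have h1 : chaconSum d (flipAt ({s} : Finset ℕ) a) = v := by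
    have := hs {0} (by simp)
    simpa using this
  rw [chaconSum_flipAt hd ha, Finset.sum_singleton, hv] at h1
  have h2 : (3 - 2 * (a s : ℝ)) * ((d : ℝ) ^ (s + 1))⁻¹ ≠ 0 := by
    refine mul_ne_zero ?_ (by positivity)
    rcases ha s with h | h <;> rw [h] <;> norm_num
  exact h2 (by linarith)

lemma HasUniformCylinders.ae_not_integral (hH : HasUniformCylinders H) {d : ℕ} (hd : 2 ≤ d) {τ : ℝ}
    (hτ : 0 < τ) : ∀ᵐ a ∂H, ∀ (b : ℕ) (z : ℤ), τ / (1 + chaconSum d a) ^ 2 * d ^ b ≠ z := by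
  rw [ae_all_iff]; intro b
  rw [ae_all_iff]; intro z
  filter_upwards [hH.ae_chaconSum_ne hd (√(τ * d ^ b / z) - 1)] with a ha h
  have h0 := chaconSum_nonneg d a
  refine ha ?_
  have : τ * d ^ b / z = (1 + chaconSum d a) ^ 2 := by
    rw [← h]; field_simp
  rw [this, Real.sqrt_sq (by linarith)]
  ring

lemma abs_sum_flip_le {d : ℕ} (hd : 3 ≤ d) {a : ℕ → ℕ} (ha : ∀ j, a j = 1 ∨ a j = 2) (s : ℕ)
    (A : Finset ℕ) :
    |∑ j ∈ A, (3 - 2 * (a (s + j) : ℝ)) * ((d : ℝ) ^ (s + j + 1))⁻¹| ≤ ((d : ℝ) ^ s)⁻¹ := by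
  have hd' : (3 : ℝ) ≤ d := by exact_mod_cast hd
  calc _ ≤ ∑ j ∈ A, ((d : ℝ) ^ s)⁻¹ * ((d : ℝ) ^ (j + 1))⁻¹ := by
        refine (Finset.abs_sum_le_sum_abs _ _).trans (Finset.sum_le_sum fun j _ => ?_)
        rw [abs_mul, abs_of_nonneg (a := ((d : ℝ) ^ (s + j + 1))⁻¹) (by positivity), ← mul_inv, ← pow_add,
          ← add_assoc]
        refine mul_le_of_le_one_left (by positivity) ?_
        rcases ha (s + j) with h | h <;> rw [h] <;> norm_num
    _ ≤ ((d : ℝ) ^ s)⁻¹ * ((d : ℝ) - 1)⁻¹ := by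
        rw [← Finset.mul_sum, ← tsum_inv_pow_succ (by omega : 2 ≤ d)]
        gcongr
        exact (summable_inv_pow_succ (by omega)).sum_le_tsum _ fun j _ => by positivity
    _ ≤ ((d : ℝ) ^ s)⁻¹ :=
        mul_le_of_le_one_right (by positivity) (inv_le_one_of_one_le₀ (by linarith))

/-- Almost surely, infinitely many base-`d` scalings of `τ / (1 + α')` stay away from the integers. -/
lemma HasUniformCylinders.ae_frequently_lt_abs_sub_round (hH : HasUniformCylinders H) {d : ℕ}
    (hd : 7 ≤ d) {τ : ℝ} (hτ : 0 < τ) :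
    ∀ᵐ a ∂H, ∃ᶠ p : ℕ in atTop, 1 / (d : ℝ) < |(d : ℝ) ^ p * (τ / (1 + chaconSum d a)) -
      round ((d : ℝ) ^ p * (τ / (1 + chaconSum d a)))| := by
  have hd' : (7 : ℝ) ≤ d := by exact_mod_cast hd
  set u : ℕ → (ℕ → ℕ) → ℝ := fun p a => (d : ℝ) ^ p * (τ / (1 + chaconSum d a)) with hu
  set E : ℕ → Set (ℕ → ℕ) := fun J => {a | ∀ p ≥ J, |u p a - round (u p a)| ≤ 1 / d} with hE
  have hum (p) : Measurable (u p) := ((measurable_chaconSum d).const_add 1).const_div τ |>.const_mul _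
  have hEm (J) : MeasurableSet (E J) := by
    have : E J = ⋂ p ∈ Set.Ici J, {a | |u p a - round (u p a)| ≤ 1 / d} := by
      ext a; simp [hE]
    rw [this]
    refine MeasurableSet.biInter (Set.to_countable _) fun p _ => measurableSet_le ?_ measurable_const
    refine ((hum p).sub ?_).norm
    simp_rw [round_eq]
    exact (measurable_from_top (f := fun z : ℤ => (z : ℝ))).comp
      (Int.measurable_floor.comp ((hum p).add_const _))
  have hfr : ∀ᵐ a ∂H, ∀ J t, a ∈ E J → ∃ᶠ s in atTop, ∀ A ⊆ Finset.range t,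
      flipAt (A.map (addLeftEmbedding s)) a ∈ E J := by
    rw [ae_all_iff]; intro J
    rw [ae_all_iff]; intro t
    exact hH.ae_frequently_flipAt_mem (hEm J) t
  filter_upwards [hfr, hH.ae_eq_one_or_two, hH.ae_not_integral (by omega : 2 ≤ d) hτ] with a hfr ha hni
  by_contra hcon
  rw [not_frequently, eventually_atTop] at hcon
  obtain ⟨J, hJ⟩ := hcon
  have haE : a ∈ E J := fun p hp => not_lt.1 (hJ p hp)
  set θ := 1 + chaconSum d a with hθ
  have hθ1 : 1 ≤ θ := by have := chaconSum_nonneg d a; linarith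
  set c := τ / θ ^ 2 with hc
  have hbound (t : ℕ) : ∑ b ∈ Finset.range t, |c * d ^ b - round (c * (d : ℝ) ^ b)| ≤ 2 / 3 := by
    have hsmall : ∀ᶠ s : ℕ in atTop, τ * d ^ t * ((d : ℝ) ^ s)⁻¹ < 1 / 100 := by
      have := (tendsto_inv_pow_atTop (by omega : 2 ≤ d)).const_mul (τ * d ^ t)
      rw [mul_zero] at this
      exact this.eventually_lt_const (by norm_num)
    obtain ⟨s, hs, hs1, hs2⟩ := ((hfr J t haE).and_eventually
      (hsmall.and (eventually_ge_atTop J))).exists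
    set v : ℕ → ℝ := fun j => (2 * (a (s + j) : ℝ) - 3) * (c * d ^ (t - 1 - j)) with hv
    have hv3 : ∀ A ⊆ Finset.range t, ∃ w : ℤ, |(∑ i ∈ A, v i) - w| < 1 / 3 := by
      intro A hA
      have hmem := hs A hA
      set b := flipAt (A.map (addLeftEmbedding s)) a with hb
      set δ := ∑ j ∈ A, (3 - 2 * (a (s + j) : ℝ)) * ((d : ℝ) ^ (s + j + 1))⁻¹ with hδ
      have hθb : 1 + chaconSum d b = θ + δ := by
        rw [hb, chaconSum_flipAt (by omega) ha, Finset.sum_map]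
        simp only [addLeftEmbedding_apply]
        rw [hθ]; ring
      have hδle : |δ| ≤ ((d : ℝ) ^ s)⁻¹ := abs_sum_flip_le (by omega) ha s A
      have hθδ : 1 ≤ θ + δ := by
        rw [← hθb]; have := chaconSum_nonneg d b; linarith
      have hsumv : ∑ i ∈ A, v i = -(d ^ (s + t) * c * δ) := by
        rw [hδ, Finset.mul_sum, ← Finset.sum_neg_distrib]
        refine Finset.sum_congr rfl fun j hj => ?_
        have hjt := Finset.mem_range.1 (hA hj)
        obtain ⟨m, rfl⟩ : ∃ m, t = m + 1 + j := ⟨t - 1 - j, by omega⟩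
        have e1 : m + 1 + j - 1 - j = m := by omega
        simp only [hv]
        rw [e1]
        have e2 : (d : ℝ) ^ (s + (m + 1 + j)) = d ^ m * d ^ (s + j + 1) := by rw [← pow_add]; congr 1; ring
        rw [e2]
        field_simp
        ring
      have hdiff : u (s + t) b - u (s + t) a - ∑ i ∈ A, v i =
          d ^ (s + t) * τ * δ ^ 2 / (θ ^ 2 * (θ + δ)) := by
        simp only [hu]
        rw [hsumv, hθb, ← hθ, hc]
        have : θ + δ ≠ 0 := by linarith
        field_simp
        ring
      have herr : |(d : ℝ) ^ (s + t) * τ * δ ^ 2 / (θ ^ 2 * (θ + δ))| ≤ τ * d ^ t * ((d : ℝ) ^ s)⁻¹ := by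
        have h1 : (1 : ℝ) ≤ θ ^ 2 * (θ + δ) := one_le_mul_of_one_le_of_one_le (one_le_pow₀ hθ1) hθδ
        rw [abs_of_nonneg (by positivity)]
        refine (div_le_self (by positivity) h1).trans ?_
        have h2 : δ ^ 2 ≤ (((d : ℝ) ^ s)⁻¹) ^ 2 := by
          rw [← sq_abs]; gcongr
        calc (d : ℝ) ^ (s + t) * τ * δ ^ 2 ≤ (d : ℝ) ^ (s + t) * τ * (((d : ℝ) ^ s)⁻¹) ^ 2 := by gcongr
          _ = τ * d ^ t * ((d : ℝ) ^ s)⁻¹ := by rw [pow_add]; field_simp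
      have hr1 := haE (s + t) (by omega)
      have hr2 := hmem (s + t) (by omega)
      have hd7 : 1 / (d : ℝ) ≤ 1 / 7 := by gcongr
      refine ⟨round (u (s + t) b) - round (u (s + t) a), ?_⟩
      rw [hdiff.symm] at herr
      rw [abs_le] at hr1 hr2 herr
      rw [abs_lt]
      push_cast
      constructor <;> linarith
    refine le_trans ?_ (sum_abs_sub_round_le hv3)
    rw [← Finset.sum_range_reflect]
    refine Finset.sum_le_sum fun j hj => ?_
    simp only [hv]
    rcases ha (s + j) with h | h <;> rw [h]
    · refine (round_le _ (-round (((2 * (1 : ℕ) - 3 : ℝ)) * (c * (d : ℝ) ^ (t - 1 - j))))).trans ?_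
      rw [← abs_neg]
      refine le_of_eq ?_
      congr 1
      push_cast
      ring
    · norm_num
  have hsummable := summable_of_sum_range_le (fun b => abs_nonneg _) hbound
  obtain ⟨b, z, hz⟩ := exists_mul_pow_eq_intCast (by omega : 2 ≤ d) hsummable.tendsto_atTop_zero
  exact hni b z hz

end FlipInvariance

lemma mem_middleDigitSet_or_neg {d : ℕ} (hd : 7 ≤ d) {u : ℝ} (hu : 1 / (d : ℝ) < |u - round u|) :
    u ∈ middleDigitSet d ∨ -u ∈ middleDigitSet d := by
  have hd' : (7 : ℝ) ≤ d := by exact_mod_cast hd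
  have h7 : 2 / (d : ℝ) ≤ 2 / 7 := by gcongr
  have h2 : 2 / (d : ℝ) = 1 / d + 1 / d := by ring
  have h := abs_le.1 (abs_sub_round u)
  rcases lt_abs.1 hu with h1 | h1
  · right
    refine ⟨-round u - 1, ?_, ?_⟩ <;> push_cast <;> linarith
  · left
    refine ⟨round u - 1, ?_, ?_⟩ <;> push_cast <;> linarith

/-- The centred indicator of the event that the `j`-th coordinate equals `1`. -/
def centredDigit (j : ℕ) (a : ℕ → ℕ) : ℝ := if a j = 1 then 1 / 2 else -1 / 2

lemma measurable_centredDigit (j : ℕ) : Measurable (centredDigit j) :=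
  Measurable.ite (measurable_pi_apply j (measurableSet_singleton 1)) measurable_const measurable_const

lemma abs_centredDigit (j : ℕ) (a : ℕ → ℕ) : |centredDigit j a| = 1 / 2 := by
  unfold centredDigit
  split_ifs <;> norm_num [abs_of_nonneg, abs_of_neg]

section FlipInvariance

variable {H : Measure (ℕ → ℕ)} [IsProbabilityMeasure H]

lemma integrable_of_abs_le {f : (ℕ → ℕ) → ℝ} (hf : Measurable f) {C : ℝ} (hC : ∀ a, |f a| ≤ C) :
    Integrable f H :=
  Integrable.of_bound hf.aestronglyMeasurable C (ae_of_all _ hC)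

/-- Distinct digits, one of them far away, are nearly uncorrelated on every measurable set. -/
lemma HasUniformCylinders.tendsto_setIntegral_centredDigit_mul (hH : HasUniformCylinders H)
    {ι : Type*} {l : Filter ι} {s t : ι → ℕ} (hs : Tendsto s l atTop) (hst : ∀ᶠ i in l, s i ≠ t i)
    {E : Set (ℕ → ℕ)} (hE : MeasurableSet E) :
    Tendsto (fun i => ∫ a in E, centredDigit (s i) a * centredDigit (t i) a ∂H) l (𝓝 0) := by
  have hlim := hH.tendsto_measureReal_symmDiff_flipAt (A := fun i => {s i}) (l := l) (by
    intro m
    filter_upwards [hs.eventually_ge_atTop m] with i hi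
    simpa using hi) hE
  refine squeeze_zero_norm' ?_ hlim
  filter_upwards [hst] with i hi
  set g : (ℕ → ℕ) → ℝ := fun a => centredDigit (s i) a * centredDigit (t i) a with hg
  have hgm : Measurable g := (measurable_centredDigit _).mul (measurable_centredDigit _)
  have hgb (a) : |g a| ≤ 1 := by
    simp only [hg]
    rw [abs_mul, abs_centredDigit, abs_centredDigit]; norm_num
  have hF := hH.measurePreserving_flipAt {s i}
  set F := flipAt {s i} with hFd
  have hFE : MeasurableSet (F ⁻¹' E) := hF.measurable hE
  have hgi : Integrable g H := integrable_of_abs_le hgm hgb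
  have h1 : ∫ a in E, g a ∂H = - ∫ a in F ⁻¹' E, g a ∂H := by
    have e1 : ∫ a in E, g a ∂H = ∫ a in F ⁻¹' E, g (F a) ∂H := by
      conv_lhs => rw [← hF.map_eq]
      rw [setIntegral_map hE (by rw [hF.map_eq]; exact hgi.aestronglyMeasurable)
        hF.measurable.aemeasurable]
    rw [e1, ← integral_neg]
    refine integral_congr_ae (ae_restrict_of_ae ?_)
    filter_upwards [hH.ae_eq_one_or_two] with a ha
    have h2 : F a (t i) = a (t i) := by simp [hFd, flipAt, Ne.symm hi]
    have h3 : F a (s i) = 3 - a (s i) := by simp [hFd, flipAt]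
    simp only [hg, centredDigit]
    rw [h2, h3]
    rcases ha (s i) with h | h <;> rw [h] <;> split_ifs <;> norm_num at *
  have h2 : ∫ a in E, g a ∂H = ∫ a in E \ F ⁻¹' E, g a ∂H + ∫ a in E ∩ F ⁻¹' E, g a ∂H := by
    rw [add_comm, integral_inter_add_sdiff hFE hgi.integrableOn]
  have h3 : ∫ a in F ⁻¹' E, g a ∂H = ∫ a in F ⁻¹' E \ E, g a ∂H + ∫ a in E ∩ F ⁻¹' E, g a ∂H := by
    rw [add_comm, Set.inter_comm, integral_inter_add_sdiff hE hgi.integrableOn]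
  have h4 : |∫ a in E \ F ⁻¹' E, g a ∂H| ≤ H.real (E \ F ⁻¹' E) := by
    have := norm_setIntegral_le_of_norm_le_const (μ := H) (s := E \ F ⁻¹' E) (f := g) (C := 1)
      (measure_lt_top _ _) (fun a _ => hgb a)
    simpa using this
  have h5 : |∫ a in F ⁻¹' E \ E, g a ∂H| ≤ H.real (F ⁻¹' E \ E) := by
    have := norm_setIntegral_le_of_norm_le_const (μ := H) (s := F ⁻¹' E \ E) (f := g) (C := 1)
      (measure_lt_top _ _) (fun a _ => hgb a)
    simpa using this
  have h6 : H.real (symmDiff E (F ⁻¹' E)) = H.real (E \ F ⁻¹' E) + H.real (F ⁻¹' E \ E) := by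
    rw [Set.symmDiff_def, measureReal_union disjoint_sdiff_sdiff (hFE.diff hE)]
  rw [Real.norm_eq_abs, h6, abs_le]
  rw [abs_le] at h4 h5
  have := measureReal_nonneg (μ := H) (s := E \ F ⁻¹' E)
  have := measureReal_nonneg (μ := H) (s := F ⁻¹' E \ E)
  constructor <;> linarith

lemma card_filter_eq_one_sub {P : Finset ℕ} (σ : ℕ → ℕ) (a : ℕ → ℕ) :
    (({p ∈ P | a (σ p) = 1}).card : ℝ) - P.card / 2 = ∑ p ∈ P, centredDigit (σ p) a := by
  rw [Finset.card_filter, Finset.card_eq_sum_ones]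
  push_cast
  rw [Finset.sum_div, ← Finset.sum_sub_distrib]
  refine Finset.sum_congr rfl fun p _ => ?_
  unfold centredDigit
  split_ifs <;> norm_num

/-- The variance of the number of ones among `#P` far away digits is asymptotically `#P / 4`, on
every measurable set. -/
lemma HasUniformCylinders.tendsto_setIntegral_card_sub_sq (hH : HasUniformCylinders H)
    {M : ℕ → ℕ} (hM : Tendsto M atTop atTop) (P : Finset ℕ) {E : Set (ℕ → ℕ)} (hE : MeasurableSet E) :
    Tendsto (fun i => ∫ a in E, ((({p ∈ P | a (M i - 1 - p) = 1}).card : ℝ) - P.card / 2) ^ 2 ∂H)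
      atTop (𝓝 (P.card / 4 * H.real E)) := by
  have hi (j j') : Integrable (fun a => centredDigit j a * centredDigit j' a) (H.restrict E) :=
    (integrable_of_abs_le (C := 1) ((measurable_centredDigit _).mul (measurable_centredDigit _))
      fun a => by rw [Pi.mul_apply, abs_mul, abs_centredDigit, abs_centredDigit]; norm_num).integrableOn
  have h1 : Tendsto (fun i => ∑ p ∈ P, ∑ p' ∈ P, ∫ a in E, centredDigit (M i - 1 - p) a *
      centredDigit (M i - 1 - p') a ∂H) atTop
      (𝓝 (∑ p ∈ P, ∑ p' ∈ P, if p = p' then H.real E / 4 else 0)) := by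
    refine tendsto_finsetSum _ fun p _ => tendsto_finsetSum _ fun p' _ => ?_
    split_ifs with h
    · subst h
      refine tendsto_const_nhds.congr fun i => ?_
      have : ∀ a, centredDigit (M i - 1 - p) a * centredDigit (M i - 1 - p) a = 1 / 4 := fun a => by
        rw [← abs_mul_abs_self, abs_centredDigit]; norm_num
      simp only [this, integral_const, measureReal_restrict_apply_univ, smul_eq_mul]
      ring
    · refine hH.tendsto_setIntegral_centredDigit_mul ?_ ?_ hE
      · exact (tendsto_sub_atTop_nat p).comp ((tendsto_sub_atTop_nat 1).comp hM)
      · filter_upwards [hM.eventually_ge_atTop (p + p' + 1)] with i hi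
        omega
  have h2 : ∑ p ∈ P, ∑ p' ∈ P, (if p = p' then H.real E / 4 else 0) = P.card / 4 * H.real E := by
    rw [Finset.sum_congr rfl fun p hp => by rw [Finset.sum_ite_eq P p, if_pos hp]]
    rw [Finset.sum_const, nsmul_eq_mul]; ring
  rw [h2] at h1
  refine h1.congr fun i => ?_
  simp_rw [card_filter_eq_one_sub, sq, Finset.sum_mul_sum]
  rw [integral_finsetSum _ fun p _ => integrable_finsetSum _ fun p' _ => hi _ _]
  refine Finset.sum_congr rfl fun p _ => ?_
  rw [integral_finsetSum _ fun p' _ => hi _ _]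

lemma abs_returnMeasure_sub_le_one {d : ℕ} (hd : 1 ≤ d) (k n n' : ℕ) (a : ℕ → ℕ) :
    |returnMeasure d k a n - returnMeasure d k a n'| ≤ 1 := by
  have h1 := returnMeasure_nonneg d k n a
  have h2 := returnMeasure_nonneg d k n' a
  have h3 := returnMeasure_le_one hd k n a
  have h4 := returnMeasure_le_one hd k n' a
  rw [abs_le]
  constructor <;> linarith

/-- On a set where the digits of order `p ∈ P` are generic, consecutive return measures are close
in mean. -/
lemma HasUniformCylinders.eventually_setIntegral_abs_sub_le (hH : HasUniformCylinders H)
    {d : ℕ} (hd : 4 ≤ d) (k s : ℕ) {n M : ℕ → ℕ} (hM : Tendsto M atTop atTop) {τ : ℝ}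
    (hτ : Tendsto (fun i => (n i : ℝ) / d ^ M i) atTop (𝓝 τ)) {P : Finset ℕ} (hP0 : P.Nonempty) {e : ℤ}
    (he : e = 1 ∨ e = -1) {E : Set (ℕ → ℕ)} (hE : MeasurableSet E)
    (hP : ∀ a ∈ E, ∀ p ∈ P, e * d ^ p * (τ / (1 + chaconSum d a)) ∈ middleDigitSet d)
    {ε : ℝ} (hε : 0 < ε) :
    ∀ᶠ i in atTop, ∫ a in E, |returnMeasure d k a (n i + s) - returnMeasure d k a (n i + s + 1)| ∂H ≤
      2 * (2 * d + 1) / √P.card * H.real E + ε := by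
  set ρ : ℝ := (P.card : ℝ) with hρ
  have hρ1 : 1 ≤ ρ := Nat.one_le_cast.2 hP0.card_pos
  have hr1 : 1 ≤ √ρ := by rw [Real.one_le_sqrt]; exact hρ1
  have hrr : √ρ * √ρ = ρ := Real.mul_self_sqrt (by linarith)
  set N : ℕ → (ℕ → ℕ) → ℝ := fun i a => (({p ∈ P | a (M i - 1 - p) = 1}).card : ℝ) with hN
  set D : ℕ → (ℕ → ℕ) → ℝ := fun i a =>
    |returnMeasure d k a (n i + s) - returnMeasure d k a (n i + s + 1)| with hD
  have hNm (i) : Measurable (N i) := by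
    have : N i = fun a => ∑ p ∈ P, centredDigit (M i - 1 - p) a + ρ / 2 := by
      ext a
      rw [← card_filter_eq_one_sub]; ring
    rw [this]
    exact (Finset.measurable_fun_sum _ fun p _ => measurable_centredDigit _).add_const _
  have hN0 (i a) : 0 ≤ N i a := Nat.cast_nonneg _
  have hNρ (i a) : N i a ≤ ρ := by
    simp only [hN, hρ]; exact_mod_cast Finset.card_filter_le _ _
  have hDm (i) : Measurable (D i) :=
    ((measurable_returnMeasure d k _).sub (measurable_returnMeasure d k _)).norm
  have hD0 (i a) : 0 ≤ D i a := abs_nonneg _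
  have hD1 (i a) : D i a ≤ 1 := abs_returnMeasure_sub_le_one (by omega) k _ _ a
  set Z : ℕ → (ℕ → ℕ) → ℝ := fun i a => max (N i a * D i a - 2 * d * √ρ) 0 with hZ
  have hZm (i) : Measurable (Z i) := (((hNm i).mul (hDm i)).sub_const _).max measurable_const
  have hZb (i a) : |Z i a| ≤ ρ := by
    rw [abs_of_nonneg (le_max_right _ _)]
    refine max_le ?_ (by linarith)
    have := mul_le_mul (hNρ i a) (hD1 i a) (hD0 i a) (by linarith)
    have : 0 ≤ 2 * d * √ρ := by positivity
    linarith
  have hZlim : Tendsto (fun i => ∫ a in E, Z i a ∂H) atTop (𝓝 0) := by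
    have := tendsto_integral_of_dominated_convergence (μ := H.restrict E) (F := Z) (f := fun _ => 0)
      (fun _ => ρ) (fun i => (hZm i).aestronglyMeasurable) (integrable_const ρ)
      (fun i => ae_of_all _ (hZb i)) ?_
    · simpa using this
    · rw [ae_restrict_iff' hE]
      filter_upwards [hH.ae_eq_one_or_two] with a ha haE
      refine tendsto_const_nhds.congr' ?_
      filter_upwards [eventually_card_mul_abs_returnMeasure_sub_le hd ha k s hM hτ P he (hP a haE)]
        with i hi
      refine (max_eq_right ?_).symm
      have h1 : √(N i a) ≤ √ρ := Real.sqrt_le_sqrt (hNρ i a)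
      have h2 : 2 * d * √(N i a) ≤ 2 * d * √ρ := by gcongr
      have h3 : N i a * D i a ≤ 2 * d * √(N i a) := hi
      linarith
  have hV := hH.tendsto_setIntegral_card_sub_sq hM P hE
  have hpt (i a) : D i a ≤ 2 / ρ * Z i a + 1 / (ρ * √ρ) * (N i a - ρ / 2) ^ 2 + (4 * d + 1) / √ρ := by
    have h1 : N i a * D i a ≤ Z i a + 2 * d * √ρ := by
      have := le_max_left (N i a * D i a - 2 * d * √ρ) 0
      simp only [hZ]; linarith
    have h2 : (ρ / 2 - N i a) * D i a ≤ |N i a - ρ / 2| := by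
      rw [abs_sub_comm]
      exact (mul_le_mul_of_nonneg_right (le_abs_self _) (hD0 i a)).trans
        (mul_le_of_le_one_right (abs_nonneg _) (hD1 i a))
    have h3 : 2 * √ρ * |N i a - ρ / 2| ≤ (N i a - ρ / 2) ^ 2 + ρ := by
      have := sq_nonneg (|N i a - ρ / 2| - √ρ)
      rw [← sq_abs (N i a - ρ / 2)]
      nlinarith
    have h4 : ρ * D i a ≤ 2 * Z i a + 4 * d * √ρ + ((N i a - ρ / 2) ^ 2 + ρ) / √ρ := by
      have : 2 * |N i a - ρ / 2| ≤ ((N i a - ρ / 2) ^ 2 + ρ) / √ρ := by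
        rw [le_div_iff₀ (by linarith)]; linarith
      linarith
    have h5 : D i a ≤ (2 * Z i a + 4 * d * √ρ + ((N i a - ρ / 2) ^ 2 + ρ) / √ρ) / ρ := by
      rw [le_div_iff₀ (by linarith)]; linarith
    refine h5.trans (le_of_eq ?_)
    have hr0 : √ρ ≠ 0 := by linarith
    rw [← hrr]
    have : √(√ρ * √ρ) = √ρ := by rw [hrr]
    rw [this]
    field_simp
    ring
  have hbd : Tendsto (fun i => 2 / ρ * ∫ a in E, Z i a ∂H + 1 / (ρ * √ρ) *
      (∫ a in E, (N i a - ρ / 2) ^ 2 ∂H) + (4 * d + 1) / √ρ * H.real E) atTop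
      (𝓝 (2 / ρ * 0 + 1 / (ρ * √ρ) * (ρ / 4 * H.real E) + (4 * d + 1) / √ρ * H.real E)) :=
    ((hZlim.const_mul _).add (hV.const_mul _)).add_const _
  have hlt : 2 / ρ * 0 + 1 / (ρ * √ρ) * (ρ / 4 * H.real E) + (4 * d + 1) / √ρ * H.real E <
      2 * (2 * d + 1) / √ρ * H.real E + ε := by
    have e1 : 2 / ρ * 0 + 1 / (ρ * √ρ) * (ρ / 4 * H.real E) + (4 * d + 1) / √ρ * H.real E =
      2 * (2 * d + 1) / √ρ * H.real E - 3 / 4 * (H.real E / √ρ) := by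
      field_simp; ring
    have : 0 ≤ H.real E / √ρ := by positivity
    linarith
  filter_upwards [hbd.eventually_lt_const hlt] with i hi
  refine le_trans ?_ hi.le
  have hsqm : Measurable fun a => (N i a - ρ / 2) ^ 2 := ((hNm i).sub_const _).pow_const 2
  have hI1 : Integrable (Z i) (H.restrict E) := (integrable_of_abs_le (hZm i) (hZb i)).integrableOn
  have hI2 : Integrable (fun a => (N i a - ρ / 2) ^ 2) (H.restrict E) := by
    refine (integrable_of_abs_le (C := ρ ^ 2) hsqm fun a => ?_).integrableOn
    rw [abs_of_nonneg (sq_nonneg _), sq_le_sq, abs_of_nonneg (by linarith : 0 ≤ ρ), abs_le]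
    have := hN0 i a
    have := hNρ i a
    constructor <;> linarith
  have hI3 : Integrable (D i) (H.restrict E) :=
    (integrable_of_abs_le (C := 1) (hDm i) fun a => by rw [abs_of_nonneg (hD0 i a)]; exact hD1 i a).integrableOn
  refine (integral_mono hI3 (((hI1.const_mul (2 / ρ)).add (hI2.const_mul (1 / (ρ * √ρ)))).add
    (integrable_const ((4 * d + 1) / √ρ))) (hpt i)).trans (le_of_eq ?_)
  rw [integral_add' ((hI1.const_mul _).add (hI2.const_mul _)) (integrable_const _),
    integral_add' (hI1.const_mul _) (hI2.const_mul _), integral_const_mul, integral_const_mul,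
    integral_const, measureReal_restrict_apply_univ, smul_eq_mul]
  ring

end FlipInvariance

open Classical in
/-- The orders `p < J` at which the base-`d` digit of `e * τ / (1 + α')` is generic. -/
def genericOrders (d : ℕ) (τ : ℝ) (e : ℤ) (J : ℕ) (a : ℕ → ℕ) : Finset ℕ :=
  {p ∈ Finset.range J | e * d ^ p * (τ / (1 + chaconSum d a)) ∈ middleDigitSet d}

open Classical in
lemma mem_genericOrders {d : ℕ} {τ : ℝ} {e : ℤ} {J : ℕ} {a : ℕ → ℕ} {p : ℕ} :
    p ∈ genericOrders d τ e J a ↔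
      p < J ∧ e * d ^ p * (τ / (1 + chaconSum d a)) ∈ middleDigitSet d := by
  simp [genericOrders]

open Classical in
lemma genericOrders_mono (d : ℕ) (τ : ℝ) (e : ℤ) (a : ℕ → ℕ) :
    Monotone fun J => genericOrders d τ e J a := fun _ _ h =>
  Finset.filter_subset_filter _ (Finset.range_mono h)

lemma measurableSet_mem_middleDigitSet (d : ℕ) (τ : ℝ) (e : ℤ) (p : ℕ) :
    MeasurableSet {a | e * d ^ p * (τ / (1 + chaconSum d a)) ∈ middleDigitSet d} := by
  have : Measurable fun a => e * (d : ℝ) ^ p * (τ / (1 + chaconSum d a)) :=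
    (((measurable_chaconSum d).const_add 1).const_div τ).const_mul _
  exact this (isOpen_middleDigitSet d).measurableSet

lemma measurableSet_genericOrders_eq (d : ℕ) (τ : ℝ) (e : ℤ) (J : ℕ) (P : Finset ℕ) :
    MeasurableSet {a | genericOrders d τ e J a = P} := by
  have : {a | genericOrders d τ e J a = P} = ⋂ p, {a | (p < J ∧
      e * d ^ p * (τ / (1 + chaconSum d a)) ∈ middleDigitSet d) ↔ p ∈ P} := by
    ext a
    simp [mem_genericOrders, Finset.ext_iff]
  rw [this]
  refine MeasurableSet.iInter fun p => ?_
  have h1 := measurableSet_mem_middleDigitSet d τ e p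
  exact ((MeasurableSet.const (p < J)).inter h1).iff (MeasurableSet.const (p ∈ P))

lemma exists_le_card_genericOrders {d : ℕ} {τ : ℝ} {e : ℤ} {a : ℕ → ℕ}
    (h : ∃ᶠ p : ℕ in atTop, e * d ^ p * (τ / (1 + chaconSum d a)) ∈ middleDigitSet d) (R : ℕ) :
    ∃ J, R ≤ (genericOrders d τ e J a).card := by
  rw [Nat.frequently_atTop_iff_infinite] at h
  obtain ⟨T, hT, rfl⟩ := h.exists_subset_card_eq R
  refine ⟨T.sup id + 1, Finset.card_le_card fun p hp => ?_⟩
  have : p ≤ T.sup id := Finset.le_sup (f := id) hp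
  exact mem_genericOrders.2 ⟨by omega, hT hp⟩

section FlipInvariance

variable {H : Measure (ℕ → ℕ)} [IsProbabilityMeasure H]

lemma HasUniformCylinders.exists_measureReal_card_genericOrders_lt (hH : HasUniformCylinders H)
    {d : ℕ} (hd : 7 ≤ d) {τ : ℝ} (hτ : 0 < τ) (R : ℕ) {ε : ℝ} (hε : 0 < ε) :
    ∃ J, H.real {a | (genericOrders d τ 1 J a).card < R ∧ (genericOrders d τ (-1) J a).card < R} < ε := by
  set S : ℕ → Set (ℕ → ℕ) := fun J =>
    {a | (genericOrders d τ 1 J a).card < R ∧ (genericOrders d τ (-1) J a).card < R} with hS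
  have hSm (e : ℤ) (J) : MeasurableSet {a | (genericOrders d τ e J a).card < R} := by
    have : {a | (genericOrders d τ e J a).card < R} =
        ⋃ P ∈ {P : Finset ℕ | P.card < R}, {a | genericOrders d τ e J a = P} := by
      ext a; simp
    rw [this]
    exact MeasurableSet.biUnion (Set.to_countable _) fun P _ => measurableSet_genericOrders_eq d τ e J P
  have hanti : Antitone S := fun J J' h a ha =>
    ⟨(Finset.card_le_card (genericOrders_mono d τ 1 a h)).trans_lt ha.1,
      (Finset.card_le_card (genericOrders_mono d τ (-1) a h)).trans_lt ha.2⟩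
  have hnull : H (⋂ J, S J) = 0 := by
    rw [← compl_compl (⋂ J, S J)]
    refine mem_ae_iff.1 ?_
    filter_upwards [hH.ae_frequently_lt_abs_sub_round hd hτ] with a ha hmem
    rw [Set.mem_iInter] at hmem
    have h2 := ha.mono fun p hp => mem_middleDigitSet_or_neg hd hp
    rw [frequently_or_distrib] at h2
    rcases h2 with h2 | h2
    · obtain ⟨J, hJ⟩ := exists_le_card_genericOrders (d := d) (τ := τ) (e := 1) (a := a)
        (by simpa using h2) R
      exact absurd (hmem J).1 (not_lt.2 hJ)
    · obtain ⟨J, hJ⟩ := exists_le_card_genericOrders (d := d) (τ := τ) (e := -1) (a := a)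
        (by simpa using h2) R
      exact absurd (hmem J).2 (not_lt.2 hJ)
  have hlim := tendsto_measure_iInter_atTop (μ := H)
    (fun J => ((hSm 1 J).inter (hSm (-1) J)).nullMeasurableSet) hanti ⟨0, measure_ne_top _ _⟩
  have hlim' := (ENNReal.tendsto_toReal (measure_ne_top H _)).comp hlim
  rw [show H (⋂ J, {a | (genericOrders d τ 1 J a).card < R} ∩
    {a | (genericOrders d τ (-1) J a).card < R}) = 0 from hnull, ENNReal.toReal_zero] at hlim'
  exact (hlim'.eventually_lt_const hε).exists

lemma HasUniformCylinders.eventually_setIntegral_genericOrders_le (hH : HasUniformCylinders H)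
    {d : ℕ} (hd : 4 ≤ d) (k s : ℕ) {n M : ℕ → ℕ} (hM : Tendsto M atTop atTop) {τ : ℝ}
    (hτ : Tendsto (fun i => (n i : ℝ) / d ^ M i) atTop (𝓝 τ)) {e : ℤ} (he : e = 1 ∨ e = -1)
    {R : ℕ} (hR : 1 ≤ R) (J : ℕ) {ε : ℝ} (hε : 0 < ε) :
    ∀ᶠ i in atTop, ∫ a in {a | R ≤ (genericOrders d τ e J a).card},
      |returnMeasure d k a (n i + s) - returnMeasure d k a (n i + s + 1)| ∂H ≤
      2 * (2 * d + 1) / √R + ε := by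
  set fam : Finset (Finset ℕ) := {P ∈ (Finset.range J).powerset | R ≤ P.card} with hfam
  have hunion : {a | R ≤ (genericOrders d τ e J a).card} =
      ⋃ P ∈ fam, {a | genericOrders d τ e J a = P} := by
    ext a
    have : genericOrders d τ e J a ⊆ Finset.range J := fun p hp =>
      Finset.mem_range.2 (mem_genericOrders.1 hp).1
    simp [hfam, this]
  have hm (P) := measurableSet_genericOrders_eq d τ e J P
  have hdisj : Set.PairwiseDisjoint (fam : Set (Finset ℕ)) fun P => {a | genericOrders d τ e J a = P} := by
    intro P _ Q _ hPQ
    exact Set.disjoint_left.2 fun a h1 h2 => hPQ (h1.symm.trans h2)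
  have hε' : 0 < ε / (fam.card + 1) := by positivity
  have hev : ∀ᶠ i in atTop, ∀ P ∈ fam, ∫ a in {a | genericOrders d τ e J a = P},
      |returnMeasure d k a (n i + s) - returnMeasure d k a (n i + s + 1)| ∂H ≤
      2 * (2 * d + 1) / √P.card * H.real {a | genericOrders d τ e J a = P} + ε / (fam.card + 1) := by
    rw [eventually_all_finset]
    intro P hP
    have hPR := (Finset.mem_filter.1 hP).2
    refine hH.eventually_setIntegral_abs_sub_le hd k s hM hτ
      (Finset.card_pos.1 (by omega)) he (hm P) ?_ hε'
    rintro a rfl p hp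
    exact (mem_genericOrders.1 hp).2
  filter_upwards [hev] with i hi
  have hint : Integrable (fun a => |returnMeasure d k a (n i + s) - returnMeasure d k a (n i + s + 1)|) H :=
    integrable_of_abs_le (C := 1) ((measurable_returnMeasure d k _).sub (measurable_returnMeasure d k _)).norm
      fun a => by rw [abs_abs]; exact abs_returnMeasure_sub_le_one (by omega) k _ _ a
  rw [hunion, integral_biUnion_finset _ (fun P _ => hm P) hdisj fun P _ => hint.integrableOn]
  calc _ ≤ ∑ P ∈ fam, (2 * (2 * d + 1) / √R * H.real {a | genericOrders d τ e J a = P} +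
        ε / (fam.card + 1)) := by
        refine Finset.sum_le_sum fun P hP => (hi P hP).trans ?_
        have hPR : (R : ℝ) ≤ P.card := by exact_mod_cast (Finset.mem_filter.1 hP).2
        have hR0 : (0 : ℝ) < √R := Real.sqrt_pos.2 (by exact_mod_cast hR)
        gcongr
    _ = 2 * (2 * d + 1) / √R * H.real (⋃ P ∈ fam, {a | genericOrders d τ e J a = P}) +
        fam.card * (ε / (fam.card + 1)) := by
        rw [Finset.sum_add_distrib, ← Finset.mul_sum, measureReal_biUnion_finset hdisj fun P _ => hm P,
          Finset.sum_const, nsmul_eq_mul]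
    _ ≤ 2 * (2 * d + 1) / √R * 1 + ε := by
        gcongr
        · exact measureReal_le_one
        · rw [mul_div_assoc', div_le_iff₀ (by positivity)]
          nlinarith
    _ = _ := by rw [mul_one]

/-- Consecutive return measures are close in mean. -/
lemma HasUniformCylinders.tendsto_integral_abs_returnMeasure_sub (hH : HasUniformCylinders H)
    {d : ℕ} (hd : 7 ≤ d) (k s : ℕ) {n M : ℕ → ℕ} (hM : Tendsto M atTop atTop) {τ : ℝ} (hτ0 : 0 < τ)
    (hτ : Tendsto (fun i => (n i : ℝ) / d ^ M i) atTop (𝓝 τ)) :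
    Tendsto (fun i => ∫ a, |returnMeasure d k a (n i + s) - returnMeasure d k a (n i + s + 1)| ∂H)
      atTop (𝓝 0) := by
  rw [Metric.tendsto_atTop']
  intro ε hε
  obtain ⟨R, hR1, hR⟩ : ∃ R : ℕ, 1 ≤ R ∧ 2 * (2 * d + 1) / √(R : ℝ) < ε / 5 := by
    have h1 : Tendsto (fun R : ℕ => 2 * (2 * d + 1) / √(R : ℝ)) atTop (𝓝 0) :=
      (Real.tendsto_sqrt_atTop.comp tendsto_natCast_atTop_atTop).const_div_atTop _
    exact ((eventually_ge_atTop 1).and (h1.eventually_lt_const (by positivity))).exists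
  obtain ⟨J, hJ⟩ := hH.exists_measureReal_card_genericOrders_lt hd hτ0 R (show 0 < ε / 5 by positivity)
  have hp := hH.eventually_setIntegral_genericOrders_le (by omega) k s hM hτ (Or.inl rfl) hR1 J
    (show 0 < ε / 5 by positivity)
  have hn := hH.eventually_setIntegral_genericOrders_le (by omega) k s hM hτ (Or.inr rfl) hR1 J
    (show 0 < ε / 5 by positivity)
  obtain ⟨i₀, hi₀⟩ := eventually_atTop.1 (hp.and hn)
  refine ⟨i₀, fun i hi => ?_⟩
  obtain ⟨h1, h2⟩ := hi₀ i hi.le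
  set f : (ℕ → ℕ) → ℝ := fun a =>
    |returnMeasure d k a (n i + s) - returnMeasure d k a (n i + s + 1)| with hf
  have hf0 (a) : 0 ≤ f a := abs_nonneg _
  have hf1 (a) : f a ≤ 1 := abs_returnMeasure_sub_le_one (by omega) k _ _ a
  have hint : Integrable f H :=
    integrable_of_abs_le (C := 1) ((measurable_returnMeasure d k _).sub (measurable_returnMeasure d k _)).norm
      fun a => by rw [abs_of_nonneg (hf0 a)]; exact hf1 a
  rw [Real.dist_eq, sub_zero, abs_of_nonneg (integral_nonneg hf0)]
  set Sp := {a | R ≤ (genericOrders d τ 1 J a).card} with hSp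
  set Sn := {a | R ≤ (genericOrders d τ (-1) J a).card} with hSn
  set Sb := {a | (genericOrders d τ 1 J a).card < R ∧ (genericOrders d τ (-1) J a).card < R} with hSb
  have hcover : Sp ∪ Sn ∪ Sb = Set.univ := by
    ext a
    simp only [hSp, hSn, hSb, Set.mem_union, Set.mem_ofPred_eq, Set.mem_univ, iff_true]
    omega
  have hle : ∫ a, f a ∂H ≤ ∫ a in Sp, f a ∂H + ∫ a in Sn, f a ∂H + ∫ a in Sb, f a ∂H := by
    rw [← setIntegral_univ, ← hcover]
    have hu (A B : Set (ℕ → ℕ)) : ∫ a in A ∪ B, f a ∂H ≤ ∫ a in A, f a ∂H + ∫ a in B, f a ∂H := by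
      rw [← integral_add_measure hint.integrableOn hint.integrableOn]
      exact integral_mono_measure (Measure.restrict_union_le _ _) (ae_of_all _ hf0)
        (Integrable.add_measure hint.integrableOn hint.integrableOn)
    exact (hu _ _).trans (add_le_add_left (hu _ _) _)
  have hb : ∫ a in Sb, f a ∂H ≤ H.real Sb := by
    have := norm_setIntegral_le_of_norm_le_const (μ := H) (s := Sb) (f := f) (C := 1)
      (measure_lt_top _ _) (fun a _ => by rw [Real.norm_of_nonneg (hf0 a)]; exact hf1 a)
    rw [one_mul] at this
    exact (le_abs_self _).trans this
  linarith

/-- The return measures converge in mean to the square of the length of the cylinder divided by the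
length of the whole interval. -/
lemma HasUniformCylinders.tendsto_integral_abs_returnMeasure_sub_limit (hH : HasUniformCylinders H)
    {d : ℕ} (hd : 7 ≤ d) (k : ℕ) {n M : ℕ → ℕ} (hM : Tendsto M atTop atTop) {τ : ℝ} (hτ0 : 0 < τ)
    (hτ : Tendsto (fun i => (n i : ℝ) / d ^ M i) atTop (𝓝 τ)) :
    Tendsto (fun i => ∫ a, |returnMeasure d k a (n i) -
      ((d : ℝ) ^ k)⁻¹ * (1 / (d ^ k * (1 + chaconSum d a)))| ∂H) atTop (𝓝 0) := by
  rw [Metric.tendsto_atTop']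
  intro ε hε
  obtain ⟨m, hm⟩ : ∃ m : ℕ, 2 * ((d : ℝ) ^ m)⁻¹ < ε / 3 := by
    have := (tendsto_inv_pow_atTop (by omega : 2 ≤ d)).const_mul 2
    rw [mul_zero] at this
    exact (this.eventually_lt_const (by positivity)).exists
  obtain ⟨L, hL1, hL⟩ : ∃ L : ℕ, 1 ≤ L ∧ (24 * (d : ℝ) ^ k + 4 * d ^ m) / L < ε / 3 := by
    have := tendsto_const_div_atTop_nhds_zero_nat (24 * (d : ℝ) ^ k + 4 * d ^ m)
    exact ((eventually_ge_atTop 1).and (this.eventually_lt_const (by positivity))).exists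
  have hsum : Tendsto (fun i => ∑ s ∈ Finset.range L,
      ∫ a, |returnMeasure d k a (n i + s) - returnMeasure d k a (n i + s + 1)| ∂H) atTop (𝓝 0) := by
    rw [← Finset.sum_const_zero (s := Finset.range L) (M := ℝ)]
    exact tendsto_finsetSum _ fun s _ => hH.tendsto_integral_abs_returnMeasure_sub hd k s hM hτ0 hτ
  obtain ⟨i₀, hi₀⟩ := eventually_atTop.1 (hsum.eventually_lt_const (show 0 < ε / 3 by positivity))
  refine ⟨i₀, fun i hi => ?_⟩
  have hi' := hi₀ i hi.le
  rw [Real.dist_eq, sub_zero, abs_of_nonneg (integral_nonneg fun _ => abs_nonneg _)]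
  set f : ℕ → (ℕ → ℕ) → ℝ := fun s a =>
    |returnMeasure d k a (n i + s) - returnMeasure d k a (n i + s + 1)| with hf
  set q : (ℕ → ℕ) → ℝ := fun a => ((d : ℝ) ^ k)⁻¹ * (1 / (d ^ k * (1 + chaconSum d a))) with hq
  have hint (s) : Integrable (f s) H :=
    integrable_of_abs_le (C := 1) ((measurable_returnMeasure d k _).sub (measurable_returnMeasure d k _)).norm
      fun a => by rw [abs_abs]; exact abs_returnMeasure_sub_le_one (by omega) k _ _ a
  set K : ℝ := 2 * ((d : ℝ) ^ m)⁻¹ + (24 * (d : ℝ) ^ k + 4 * d ^ m) / L with hK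
  have hpt : ∀ᵐ a ∂H, |returnMeasure d k a (n i) - q a| ≤ ∑ s ∈ Finset.range L, f s a + K := by
    filter_upwards [hH.ae_eq_one_or_two] with a ha
    have hL0 : (0 : ℝ) < L := by exact_mod_cast hL1
    have h1 := abs_sum_returnMeasure_sub_le (by omega : 3 ≤ d) ha k m (n i) L
    have hstep (s : ℕ) (hs : s ≤ L) : |returnMeasure d k a (n i) - returnMeasure d k a (n i + s)| ≤
        ∑ j ∈ Finset.range L, f j a := by
      have h2 := Finset.sum_range_sub' (fun s => returnMeasure d k a (n i + s)) s
      rw [add_zero] at h2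
      rw [← h2]
      refine (Finset.abs_sum_le_sum_abs _ _).trans ?_
      exact Finset.sum_le_sum_of_subset_of_nonneg (Finset.range_mono hs) fun _ _ _ => abs_nonneg _
    have h3 : |∑ s ∈ Finset.range L, (returnMeasure d k a (n i) - returnMeasure d k a (n i + s))| ≤
        L * ∑ j ∈ Finset.range L, f j a := by
      refine (Finset.abs_sum_le_sum_abs _ _).trans ?_
      refine (Finset.sum_le_card_nsmul _ _ _ fun s hs => hstep s (Finset.mem_range.1 hs).le).trans ?_
      rw [Finset.card_range, nsmul_eq_mul]
    have h4 : L * (returnMeasure d k a (n i) - q a) =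
        ∑ s ∈ Finset.range L, (returnMeasure d k a (n i) - returnMeasure d k a (n i + s)) +
        ((∑ s ∈ Finset.range L, returnMeasure d k a (n i + s)) -
          ((d : ℝ) ^ k)⁻¹ * (L / (d ^ k * (1 + chaconSum d a)))) := by
      rw [Finset.sum_sub_distrib, Finset.sum_const, Finset.card_range, nsmul_eq_mul, hq]
      ring
    have h5 : L * |returnMeasure d k a (n i) - q a| ≤ L * ∑ j ∈ Finset.range L, f j a +
        (2 * L / d ^ m + 24 * d ^ k + 4 * d ^ m) := by
      rw [← abs_of_pos hL0, ← abs_mul, abs_of_pos hL0, h4]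
      exact (abs_add_le _ _).trans (add_le_add h3 h1)
    have h6 : L * K = 2 * L / d ^ m + 24 * d ^ k + 4 * d ^ m := by
      rw [hK]; field_simp; ring
    rw [← h6, ← mul_add] at h5
    exact le_of_mul_le_mul_left h5 hL0
  have hsumi : Integrable (fun a => ∑ s ∈ Finset.range L, f s a) H :=
    integrable_finsetSum _ fun s _ => hint s
  have hle : ∫ a, |returnMeasure d k a (n i) - q a| ∂H ≤ ∫ a, (∑ s ∈ Finset.range L, f s a + K) ∂H :=
    integral_mono_of_nonneg (ae_of_all _ fun _ => abs_nonneg _) (hsumi.add (integrable_const K)) hpt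
  rw [integral_add hsumi (integrable_const K), integral_finsetSum _ fun s _ => hint s, integral_const,
    probReal_univ, one_smul] at hle
  linarith

lemma HasUniformCylinders.tendsto_setIntegral_returnMeasure_div (hH : HasUniformCylinders H)
    {d : ℕ} (hd : 7 ≤ d) (k : ℕ) {n M : ℕ → ℕ} (hM : Tendsto M atTop atTop) {τ : ℝ} (hτ0 : 0 < τ)
    (hτ : Tendsto (fun i => (n i : ℝ) / d ^ M i) atTop (𝓝 τ)) (B : Set (ℕ → ℕ)) :
    Tendsto (fun i => ∫ a in B, returnMeasure d k a (n i) / (1 + chaconSum d a) ∂H) atTop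
      (𝓝 (∫ a in B, ((d : ℝ) ^ (-(k : ℤ)) / (1 + chaconSum d a)) ^ 2 ∂H)) := by
  rw [tendsto_iff_dist_tendsto_zero]
  refine squeeze_zero (fun _ => dist_nonneg) (fun i => ?_)
    (hH.tendsto_integral_abs_returnMeasure_sub_limit hd k hM hτ0 hτ)
  have hθ (a) : 1 ≤ 1 + chaconSum d a := by have := chaconSum_nonneg d a; linarith
  have hdk : (1 : ℝ) ≤ (d : ℝ) ^ k := one_le_pow₀ (by exact_mod_cast (by omega : 1 ≤ d))
  have hsm := (measurable_chaconSum d).const_add 1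
  have hI1 : Integrable (fun a => returnMeasure d k a (n i) / (1 + chaconSum d a)) H :=
    integrable_of_abs_le (C := 1) ((measurable_returnMeasure d k _).div hsm) fun a => by
      have h1 := returnMeasure_nonneg d k (n i) a
      have h2 := returnMeasure_le_one (by omega : 1 ≤ d) k (n i) a
      have h3 := hθ a
      rw [abs_of_nonneg (by positivity)]
      exact (div_le_self h1 h3).trans h2
  have hI2 : Integrable (fun a => ((d : ℝ) ^ (-(k : ℤ)) / (1 + chaconSum d a)) ^ 2) H :=
    integrable_of_abs_le (C := 1) ((hsm.const_div _).pow_const 2) fun a => by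
      have h3 := hθ a
      rw [abs_of_nonneg (sq_nonneg _), zpow_neg, zpow_natCast]
      refine pow_le_one₀ (by positivity) ((div_le_self (by positivity) h3).trans ?_)
      exact inv_le_one_of_one_le₀ hdk
  have hI3 : Integrable (fun a => |returnMeasure d k a (n i) -
      ((d : ℝ) ^ k)⁻¹ * (1 / (d ^ k * (1 + chaconSum d a)))|) H :=
    integrable_of_abs_le (C := 2) ((measurable_returnMeasure d k _).sub
      (((hsm.const_mul _).const_div 1).const_mul _)).norm fun a => by
      have h1 := returnMeasure_nonneg d k (n i) a
      have h2 := returnMeasure_le_one (by omega : 1 ≤ d) k (n i) a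
      have h3 := hθ a
      have h4 : 0 ≤ ((d : ℝ) ^ k)⁻¹ * (1 / (d ^ k * (1 + chaconSum d a))) := by positivity
      have h5 : ((d : ℝ) ^ k)⁻¹ * (1 / (d ^ k * (1 + chaconSum d a))) ≤ 1 := by
        refine mul_le_one₀ (inv_le_one_of_one_le₀ hdk) (by positivity) ?_
        rw [one_div]
        exact inv_le_one_of_one_le₀ (one_le_mul_of_one_le_of_one_le hdk h3)
      rw [abs_abs, abs_le]
      constructor <;> linarith
  rw [Real.dist_eq, ← integral_sub hI1.integrableOn hI2.integrableOn]
  refine (abs_integral_le_integral_abs).trans ?_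
  refine le_trans ?_ (setIntegral_le_integral (s := B) hI3 (ae_of_all _ fun _ => abs_nonneg _))
  refine integral_mono (hI1.sub hI2).abs.integrableOn hI3.integrableOn fun a => ?_
  have h3 := hθ a
  have e1 : returnMeasure d k a (n i) / (1 + chaconSum d a) -
      ((d : ℝ) ^ (-(k : ℤ)) / (1 + chaconSum d a)) ^ 2 =
      (returnMeasure d k a (n i) - ((d : ℝ) ^ k)⁻¹ * (1 / (d ^ k * (1 + chaconSum d a)))) /
        (1 + chaconSum d a) := by
    rw [zpow_neg, zpow_natCast]
    field_simp
  change |_ - _| ≤ _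
  rw [e1, abs_div, abs_of_nonneg (by linarith : 0 ≤ 1 + chaconSum d a)]
  exact div_le_self (abs_nonneg _) h3

end FlipInvariance

/-- Every sequence of times tending to infinity has a subsequence whose ratios to the powers of `d`
below converge. -/
lemma exists_subseq_tendsto_div_pow_log {d : ℕ} (hd : 2 ≤ d) {n : ℕ → ℕ} (hn : Tendsto n atTop atTop) :
    ∃ φ : ℕ → ℕ, Tendsto (fun i => Nat.log d (n (φ i))) atTop atTop ∧ ∃ τ : ℝ, 0 < τ ∧
      Tendsto (fun i => (n (φ i) : ℝ) / d ^ Nat.log d (n (φ i))) atTop (𝓝 τ) := by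
  have hd0 : (0 : ℝ) < d := by exact_mod_cast (by omega : 0 < d)
  have hpos (i) : (0 : ℝ) < (d : ℝ) ^ Nat.log d (n i) := by positivity
  have hmem : ∀ i, (n i : ℝ) / d ^ Nat.log d (n i) ∈ Set.Icc (0 : ℝ) d := fun i => by
    refine ⟨by positivity, ?_⟩
    rw [div_le_iff₀ (hpos i), ← pow_succ']
    exact_mod_cast (Nat.lt_pow_succ_log_self (by omega) (n i)).le
  obtain ⟨τ, -, φ, hφ, hlim⟩ := isCompact_Icc.tendsto_subseq hmem
  refine ⟨φ, ?_, τ, ?_, hlim⟩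
  · refine tendsto_atTop.2 fun b => ?_
    filter_upwards [(hn.comp hφ.tendsto_atTop).eventually_ge_atTop (d ^ b)] with i hi
    exact Nat.le_log_of_pow_le (by omega) hi
  · refine lt_of_lt_of_le one_pos (ge_of_tendsto hlim ?_)
    filter_upwards [(hn.comp hφ.tendsto_atTop).eventually_ge_atTop 1] with i hi
    have : n (φ i) ≠ 0 := by simp only [Function.comp_apply] at hi; omega
    simp only [Function.comp_apply]
    rw [le_div_iff₀ (hpos _), one_mul]
    exact_mod_cast Nat.pow_log_le_self d this

/-- For every `k ∈ ℕ` and every Borel set `B ⊆ {1,2}^ℕ`,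
`μ((B×A_k) ∩ T^{-n}(B×A_k)) → ∫_B (Leb_α(A_k))² dH(α)` as `n → ∞`,
where `A_k = [0, d^{-k})` and `Leb_α(A_k) = d^{-k}/(1+α')`. -/
theorem chacon_correlation_cylinder_tendsto
    (d : ℕ) (hd_odd : Odd d) (hd7 : 7 ≤ d)
    (H : Measure (ℕ → ℕ)) [IsProbabilityMeasure H]
    (hH : ∀ (s : Finset ℕ) (f : ℕ → ℕ), (∀ i ∈ s, f i = 1 ∨ f i = 2) →
      H {a | ∀ i ∈ s, a i = f i} = (1 / 2 : ENNReal) ^ s.card)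
    (μ : Measure ((ℕ → ℕ) × ℝ)) [IsProbabilityMeasure μ]
    (hμ : ∀ E : Set ((ℕ → ℕ) × ℝ), MeasurableSet E →
      μ E = ∫⁻ a, lebAlpha d a {x : ℝ | (a, x) ∈ E} ∂H)
    (k : ℕ) (B : Set (ℕ → ℕ)) (hB : MeasurableSet B) :
    Tendsto
      (fun n : ℕ =>
        (μ ((B ×ˢ Set.Ico (0 : ℝ) ((d : ℝ) ^ (-(k : ℤ)))) ∩
            (chaconSkew d)^[n] ⁻¹' (B ×ˢ Set.Ico (0 : ℝ) ((d : ℝ) ^ (-(k : ℤ)))))).toReal)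
      atTop
      (𝓝 (∫ a in B, ((d : ℝ) ^ (-(k : ℤ)) / (1 + chaconSum d a)) ^ 2 ∂H)) := by
  refine tendsto_of_subseq_tendsto fun n hn => ?_
  obtain ⟨φ, hM, τ, hτ0, hτ⟩ := exists_subseq_tendsto_div_pow_log (by omega : 2 ≤ d) hn
  refine ⟨φ, ?_⟩
  have hHu : HasUniformCylinders H := hH
  refine (hHu.tendsto_setIntegral_returnMeasure_div hd7 k hM hτ0 hτ B).congr fun i => ?_
  rw [toReal_measure_inter_preimage (by omega) hμ k _ hB]

end
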